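/- arXiv:2303.03479 — 4 statements merged into one kernel-verified Lean document; each statement's English description precedes it below -/
import Mathlib

section
/- If G is a 4-tough graph on n ≥ 3 vertices whose degree sequence d_1 ≤ d_2 ≤ … ≤ d_n satisfies: for every index i < n/2, if d_i ≤ i then d_{n-i+4} ≥ n-i, then G is Hamiltonian. -/
open SimpleGraph

/-- A graph `G` is `t`-tough if for every set `S` of vertices such that `G - S` is
disconnected, `t * c(G - S) ≤ |S|`, where `c` counts connected components. -/
def Tough {V : Type*} [Fintype V] (t : ℝ) (G : SimpleGraph V) : Prop :=
  ∀ S : Finset V, ¬ (G.induce ((↑S : Set V)ᶜ)).Connected →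
    t * (Nat.card (G.induce ((↑S : Set V)ᶜ)).ConnectedComponent) ≤ S.card



theorem core_AB (w : ℕ → ℕ) (hw : ∀ i, w i ≤ 2) (h0 : w 0 = 0) (k : ℕ) :
    ((Finset.Icc 1 k).filter (fun p => w (p-1) = 0 ∧ w p = 1)).card ≤
    ((Finset.Icc 1 k).filter (fun p => w (p-1) = 1 ∧ w p = 0)).card +
    ((Finset.Icc 1 k).filter (fun p => w p = 2)).card + (if w k = 1 then 1 else 0) := by
  induction k with
  | zero => simp
  | succ k ih =>
    have h1 := hw k
    have h2 := hw (k+1)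
    rw [← Finset.insert_Icc_right_eq_Icc_add_one (by omega)]
    simp only [Finset.filter_insert]
    have hn : ∀ P : ℕ → Prop, ∀ [DecidablePred P], (k+1) ∉ (Finset.Icc 1 k).filter P := by
      intro P _ h
      simp at h
    simp only [Nat.add_sub_cancel]
    split_ifs at * <;> (try simp only [Finset.card_insert_of_notMem (hn _)]) <;> omega

/-- counting lemma -/
theorem core_count (w : ℕ → ℕ) (n : ℕ) (hw : ∀ i, w i ≤ 2) (h0 : w 0 = 0)
    (S : Finset ℕ) (T : ℕ → Finset ℕ) (t : ℕ) (hT : ∀ c, (T c).card ≤ t)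
    (hS : ∀ p ∈ S, (1 ≤ p ∧ p ≤ n ∧ w (p-1) = 0 ∧ w p = 1) ∨
      (∃ z, 1 ≤ z ∧ z ≤ n ∧ w (z-1) = 1 ∧ w z = 0 ∧ (p = z - 1 ∨ p = z + 1)) ∨
      (∃ c, 1 ≤ c ∧ c ≤ n ∧ w c = 2 ∧ p ∈ T c)) :
    S.card ≤ 3 * ((Finset.Icc 1 n).filter (fun p => w (p-1) = 1 ∧ w p = 0)).card + 1 +
      (t + 1) * ((Finset.Icc 1 n).filter (fun p => w p = 2)).card := by
  classical
  set Z := (Finset.Icc 1 n).filter (fun p => w (p-1) = 1 ∧ w p = 0) with hZ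
  set C := (Finset.Icc 1 n).filter (fun p => w p = 2) with hC
  set AB := (Finset.Icc 1 n).filter (fun p => w (p-1) = 0 ∧ w p = 1) with hAB
  have hsub : S ⊆ AB ∪ (Z.image (fun z => z - 1) ∪ (Z.image (fun z => z + 1) ∪ C.biUnion T)) := by
    intro p hp
    simp only [Finset.mem_union, Finset.mem_image, Finset.mem_biUnion, hAB, hZ, hC,
      Finset.mem_filter, Finset.mem_Icc]
    rcases hS p hp with h | ⟨z, h1, h2, h3, h4, h5 | h5⟩ | ⟨c, h1, h2, h3, h4⟩
    · left; tauto
    · right; left; exact ⟨z, ⟨⟨h1, h2⟩, h3, h4⟩, h5.symm⟩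
    · right; right; left; exact ⟨z, ⟨⟨h1, h2⟩, h3, h4⟩, h5.symm⟩
    · right; right; right; exact ⟨c, ⟨⟨h1, h2⟩, h3⟩, h4⟩
  have c0 := Finset.card_le_card hsub
  have c1 := Finset.card_union_le AB (Z.image (fun z => z - 1) ∪ (Z.image (fun z => z + 1) ∪ C.biUnion T))
  have c2 := Finset.card_union_le (Z.image (fun z => z - 1)) (Z.image (fun z => z + 1) ∪ C.biUnion T)
  have c3 := Finset.card_union_le (Z.image (fun z => z + 1)) (C.biUnion T)
  have c4 : (Z.image (fun z => z - 1)).card ≤ Z.card := Finset.card_image_le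
  have c5 : (Z.image (fun z => z + 1)).card ≤ Z.card := Finset.card_image_le
  have c6 : (C.biUnion T).card ≤ C.card * t := Finset.card_biUnion_le_card_mul _ _ _ (fun c _ => hT c)
  have c7 := core_AB w hw h0 n
  rw [← hZ, ← hC, ← hAB] at c7
  have : (if w n = 1 then 1 else 0) ≤ 1 := by split_ifs <;> omega
  nlinarith


set_option maxHeartbeats 1000000 in
theorem core_mem1 (n τ : ℕ) (w : ℕ → ℕ) (hw : ∀ i, w i ≤ 2) (h0 : w 0 = 0) (h1 : w 1 = 0)
    (hge : ∀ i, n ≤ i → w i = 1)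
    (hτ2 : τ = n+1 ∨ (1 ≤ τ ∧ τ ≤ n ∧ w (τ-1) = 1 ∧ w τ = 0)) (p : ℕ) (hp1 : 1 ≤ p) (hp2 : p ≤ n)
    (hp : (w (p-1) ≠ 1 ∧ w p ≠ 0) ∨
      (p < τ ∧ w (p-1) = 1 ∧ w p ≠ 0 ∧ w (p+1) ≠ 1) ∨
      (τ < p ∧ w p = 0 ∧ w (p-1) ≠ 1 ∧ w (p-2) ≠ 0)) :
    (1 ≤ p ∧ p ≤ n ∧ w (p-1) = 0 ∧ w p = 1) ∨
      (∃ z, 1 ≤ z ∧ z ≤ n ∧ w (z-1) = 1 ∧ w z = 0 ∧ (p = z - 1 ∨ p = z + 1)) ∨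
      (∃ c, 1 ≤ c ∧ c ≤ n ∧ w c = 2 ∧ p ∈ (fun c => if c < τ then
          (if w (c+1) = 1 then (if w (c-1) = 1 then ({c-1, c+1} : Finset ℕ) else {c, c+1}) else {c-1, c})
          else (if w (c-1) = 0 then (if w (c+1) = 0 then {c, c+2} else {c, c+1}) else {c+1,c+2})) c) := by
  obtain ⟨r, rfl⟩ : ∃ r, p = r + 2 := by
    refine ⟨p - 2, ?_⟩
    by_contra hcon
    have : p = 1 := by omega
    subst this
    simp [h0, h1] at hp
  have e1 : r + 2 - 1 = r + 1 := rfl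
  have e2 : r + 2 - 2 = r := rfl
  have e3 : r + 2 + 1 = r + 3 := rfl
  have e4 : r + 1 + 1 = r + 2 := rfl
  have e5 : r + 1 - 1 = r := rfl
  have e6 : r + 3 - 1 = r + 2 := rfl
  have e7 : r + 1 + 2 = r + 3 := rfl
  have e8 : r + 3 + 1 = r + 4 := rfl
  have e9 : r + 3 + 2 = r + 5 := rfl
  have e10 : r + 2 + 2 = r + 4 := rfl
  rw [e1, e2, e3] at hp
  rw [e1]
  have l0 := hw r
  have l1 := hw (r+1)
  have l2 := hw (r+2)
  have l3 := hw (r+3)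
  have hr : ∀ i, w i ≠ 1 → i < n := by
    intro i hi
    by_contra hcon
    exact hi (hge i (by omega))
  have m3 := hr (r+3)
  have m2 := hr (r+2)
  have m1 := hr (r+1)
  have t1 : w (r+2) ≠ 0 → τ ≠ r + 2 := by
    rintro h rfl; omega
  have t3 : r + 3 ≤ n → w (r+3) ≠ 0 → τ ≠ r + 3 := by
    intro h' h h''; subst h''; omega
  have t4 : w r ≠ 1 → r + 1 ≤ n → τ ≠ r + 1 := by
    intro h' h h''; subst h''; rw [e5] at hτ2; omega
  have t5 : w (r+1) ≠ 0 → r + 1 ≤ n → τ ≠ r + 1 := by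
    intro h' h h''; subst h''; omega
  have t6 : r = 0 → w r = 0 := by rintro rfl; exact h0
  clear hge hw hr hτ2 h0 h1
  by_cases a1 : w (r+1) = 0 ∧ w (r+2) = 1
  · left; omega
  right
  by_cases a2 : w (r+2) = 1 ∧ w (r+3) = 0
  · left; exact ⟨r+3, by omega, by omega, a2.1, a2.2, by omega⟩
  by_cases a3 : w r = 1 ∧ w (r+1) = 0
  · left; exact ⟨r+1, by omega, by omega, a3.1, a3.2, by omega⟩
  right
  by_cases b1 : w (r+2) = 2 ∧ (r + 2 < τ ∨ w (r+1) = 0)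
  · refine ⟨r+2, by omega, by omega, b1.1, ?_⟩
    simp only [e1,e2,e3,e4,e5,e6,e7,e8,e9,e10]
    generalize w (r+1) = x1 at *
    generalize w (r+2) = x2 at *
    generalize w (r+3) = x3 at *
    generalize w r = x0 at *
    clear e1 e2 e3 e4 e5 e6 e7 e8 e9 e10
    split_ifs <;> simp only [Finset.mem_insert, Finset.mem_singleton, true_or, or_true] <;> omega
  by_cases b2 : w (r+1) = 2
  · refine ⟨r+1, by omega, by omega, b2, ?_⟩
    simp only [e1,e2,e3,e4,e5,e6,e7,e8,e9,e10]
    generalize w (r+1) = x1 at *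
    generalize w (r+2) = x2 at *
    generalize w (r+3) = x3 at *
    generalize w r = x0 at *
    clear e1 e2 e3 e4 e5 e6 e7 e8 e9 e10
    split_ifs <;> simp only [Finset.mem_insert, Finset.mem_singleton, true_or, or_true] <;> omega
  by_cases b3 : w (r+3) = 2 ∧ w (r+2) = 1
  · refine ⟨r+3, by omega, by omega, b3.1, ?_⟩
    simp only [e1,e2,e3,e4,e5,e6,e7,e8,e9,e10]
    generalize w (r+1) = x1 at *
    generalize w (r+2) = x2 at *
    generalize w (r+3) = x3 at *
    generalize w r = x0 at *
    clear e1 e2 e3 e4 e5 e6 e7 e8 e9 e10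
    split_ifs <;> simp only [Finset.mem_insert, Finset.mem_singleton, true_or, or_true] <;> omega
  have b4 : w r = 2 ∧ w (r+1) = 0 ∧ w (r+2) = 0 := by
    clear e1 e2 e3 e4 e5 e6 e7 e8 e9 e10 m1 m2 m3 t1 t3 t4 t5 t6
    rcases hp with hp | hp | hp
    · exfalso
      omega
    · exfalso
      omega
    · omega
  have b5 : 1 ≤ r := by
    clear hp e1 e2 e3 e4 e5 e6 e7 e8 e9 e10 m1 m2 m3 t1 t3 t4 t5 a1 a2 a3 b1 b2 b3
    omega
  refine ⟨r, b5, by omega, b4.1, ?_⟩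
  have b6 : ¬ r < τ := by
    clear e1 e2 e3 e4 e5 e6 e7 e8 e9 e10 m1 m2 m3 
    omega
  clear e1 e2 e3 e4 e5 e6 e7 e8 e9 e10 m1 m2 m3 t1 t3 t5 t6 a1 a2 a3 b1 b2 b3
  simp only [if_neg b6]
  split_ifs <;> simp only [Finset.mem_insert, Finset.mem_singleton, true_or, or_true] <;> omega

set_option maxHeartbeats 1000000 in
theorem core_mem2 (n : ℕ) (kb : ℕ → Prop) (w : ℕ → ℕ) (hw : ∀ i, w i ≤ 2) (h0 : w 0 = 0) (h1 : w 1 = 0)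
    (hge : ∀ i, n ≤ i → w i = 1)
    (p : ℕ) (hp1 : 1 ≤ p) (hp2 : p ≤ n)
    (hp : (w (p-1) ≠ 1 ∧ w p ≠ 0) ∨
      (w (p-1) = 1 ∧ w p ≠ 0 ∧ w (p+1) ≠ 1 ∧ ¬ (w p = 2 ∧ w (p+1) = 0 ∧ kb p)) ∨
      (w p = 0 ∧ w (p-1) ≠ 1 ∧ w (p-2) ≠ 0 ∧ ¬ (w (p-1) = 2 ∧ w (p-2) = 1 ∧ ¬ kb (p-1)))) [DecidablePred kb] :
    (1 ≤ p ∧ p ≤ n ∧ w (p-1) = 0 ∧ w p = 1) ∨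
      (∃ z, 1 ≤ z ∧ z ≤ n ∧ w (z-1) = 1 ∧ w z = 0 ∧ (p = z - 1 ∨ p = z + 1)) ∨
      (∃ c, 1 ≤ c ∧ c ≤ n ∧ w c = 2 ∧ p ∈ (fun c => if w (c-1) = 1 then (if w (c+1) = 0 then (if kb c then ({c-1, c+1, c+2} : Finset ℕ) else {c-1, c, c+2})
            else {c-1, c, c+1}) else {c, c+1, c+2}) c) := by
  obtain ⟨r, rfl⟩ : ∃ r, p = r + 2 := by
    refine ⟨p - 2, ?_⟩
    by_contra hcon
    have : p = 1 := by omega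
    subst this
    simp [h0, h1] at hp
  have e1 : r + 2 - 1 = r + 1 := rfl
  have e2 : r + 2 - 2 = r := rfl
  have e3 : r + 2 + 1 = r + 3 := rfl
  have e4 : r + 1 + 1 = r + 2 := rfl
  have e5 : r + 1 - 1 = r := rfl
  have e6 : r + 3 - 1 = r + 2 := rfl
  have e7 : r + 1 + 2 = r + 3 := rfl
  have e8 : r + 3 + 1 = r + 4 := rfl
  have e9 : r + 3 + 2 = r + 5 := rfl
  have e10 : r + 2 + 2 = r + 4 := rfl
  rw [e1, e2, e3] at hp
  rw [e1]
  have l0 := hw r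
  have l1 := hw (r+1)
  have l2 := hw (r+2)
  have l3 := hw (r+3)
  have hr : ∀ i, w i ≠ 1 → i < n := by
    intro i hi
    by_contra hcon
    exact hi (hge i (by omega))
  have m3 := hr (r+3)
  have m2 := hr (r+2)
  have m1 := hr (r+1)
  have t6 : r = 0 → w r = 0 := by rintro rfl; exact h0
  clear hge hw hr h0 h1
  by_cases a1 : w (r+1) = 0 ∧ w (r+2) = 1
  · left; omega
  right
  by_cases a2 : w (r+2) = 1 ∧ w (r+3) = 0
  · left; exact ⟨r+3, by omega, by omega, a2.1, a2.2, by omega⟩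
  by_cases a3 : w r = 1 ∧ w (r+1) = 0
  · left; exact ⟨r+1, by omega, by omega, a3.1, a3.2, by omega⟩
  right
  by_cases b1 : w (r+2) = 2
  · refine ⟨r+2, by omega, by omega, b1, ?_⟩
    simp only [e1,e2,e3,e4,e5,e6,e7,e8,e9,e10]
    generalize w (r+1) = x1 at *
    generalize w (r+2) = x2 at *
    generalize w (r+3) = x3 at *
    generalize w r = x0 at *
    clear e1 e2 e3 e4 e5 e6 e7 e8 e9 e10
    split_ifs <;> simp only [Finset.mem_insert, Finset.mem_singleton, true_or, or_true] <;> grind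
  by_cases b2 : w (r+1) = 2
  · refine ⟨r+1, by omega, by omega, b2, ?_⟩
    simp only [e1,e2,e3,e4,e5,e6,e7,e8,e9,e10]
    generalize w (r+1) = x1 at *
    generalize w (r+2) = x2 at *
    generalize w (r+3) = x3 at *
    generalize w r = x0 at *
    clear e1 e2 e3 e4 e5 e6 e7 e8 e9 e10
    split_ifs <;> simp only [Finset.mem_insert, Finset.mem_singleton, true_or, or_true] <;> grind
  by_cases b3 : w (r+3) = 2 ∧ w (r+2) = 1
  · refine ⟨r+3, by omega, by omega, b3.1, ?_⟩
    simp only [e1,e2,e3,e4,e5,e6,e7,e8,e9,e10]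
    generalize w (r+1) = x1 at *
    generalize w (r+2) = x2 at *
    generalize w (r+3) = x3 at *
    generalize w r = x0 at *
    clear e1 e2 e3 e4 e5 e6 e7 e8 e9 e10
    split_ifs <;> simp only [Finset.mem_insert, Finset.mem_singleton, true_or, or_true] <;> grind
  have b4 : w r = 2 ∧ w (r+1) = 0 ∧ w (r+2) = 0 := by
    clear e1 e2 e3 e4 e5 e6 e7 e8 e9 e10 m1 m2 m3  t6
    rcases hp with hp | hp | hp
    · exfalso
      omega
    · exfalso
      omega
    · omega
  have b5 : 1 ≤ r := by
    clear hp e1 e2 e3 e4 e5 e6 e7 e8 e9 e10 m1 m2 m3  a1 a2 a3 b1 b2 b3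
    omega
  refine ⟨r, b5, by omega, b4.1, ?_⟩
  clear e1 e2 e3 e4 e5 e6 e7 e8 e9 e10 m1 m2 m3 t6 a1 a2 a3 b1 b2 b3
  try simp only [*]
  split_ifs <;> simp only [Finset.mem_insert, Finset.mem_singleton, true_or, or_true] <;> grind

theorem core_edge1 (p q τ n a b c d e f : ℕ) (hpq : p < q)
    (hp1 : ¬ (a ≠ 1 ∧ b ≠ 0)) (hp2 : ¬ (p < τ ∧ a = 1 ∧ b ≠ 0 ∧ c ≠ 1))
    (hq1 : ¬ (e ≠ 1 ∧ f ≠ 0)) (hq2 : ¬ (τ < q ∧ f = 0 ∧ e ≠ 1 ∧ d ≠ 0))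
    (g1 : ¬ (b = 0 ∧ e = 1)) (g2 : ¬ (c = 1 ∧ f = 0)) (g3 : ¬ (a = 1 ∧ d = 0))
    (z1 : a = 1 ∧ b = 0 → p = τ) (z1' : p = τ → b = 0)
    (z2 : e = 1 ∧ f = 0 → q = τ) :
    (if a = 1 ∧ b = 0 then p else if b = 0 then 1 else n) =
    (if e = 1 ∧ f = 0 then q else if f = 0 then 1 else n) := by
  by_cases hb : b = 0 <;> by_cases hf : f = 0 <;> by_cases ha : a = 1 <;> by_cases he : e = 1 <;>
    simp only [ha, hb, hf, he, ne_eq, not_true, not_false_iff, true_and, and_true, and_false, false_and, if_true, if_false, true_implies, implies_true, not_and, not_not] at * <;> omega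

theorem core_edge2 (p q n a b c d e f : ℕ) (k1 k2 : Prop) (hpq : p < q)
    (hc : c ≤ 2) (hb : b ≤ 2) (hd : d ≤ 2) (he : e ≤ 2) 
    (hp1 : ¬ (a ≠ 1 ∧ b ≠ 0)) (hp2 : ¬ (a = 1 ∧ b ≠ 0 ∧ c ≠ 1 ∧ ¬ (b = 2 ∧ c = 0 ∧ k1)))
    (hq1 : ¬ (e ≠ 1 ∧ f ≠ 0)) (hq2 : ¬ (f = 0 ∧ e ≠ 1 ∧ d ≠ 0 ∧ ¬ (e = 2 ∧ d = 1 ∧ ¬ k2)))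
    (g1 : ¬ (b = 0 ∧ e = 1)) (g2 : ¬ (c = 1 ∧ f = 0)) (g3 : ¬ (a = 1 ∧ d = 0))
    (kbq : k1 → b = 2 → e = 1 → False)
    (kbz : f = 0 → e = 2 → d = 1 → ¬ k2 → b = 0 → False)
    (kbb : k1 → ¬ k2 → a = 1 → b = 2 → c = 0 → f = 0 → e = 2 → False) :
    (if a = 1 ∧ b = 0 then p else if b = 0 then 1 else n) =
    (if e = 1 ∧ f = 0 then q else if f = 0 then 1 else n) := by
  by_cases hb : b = 0 <;> by_cases hf : f = 0 <;> by_cases ha : a = 1 <;> by_cases he : e = 1 <;>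
   by_cases h1 : k1 <;> by_cases h2 : k2 <;> grind

set_option maxHeartbeats 2000000 in
theorem core (n : ℕ) (hn : 2 ≤ n) (w : ℕ → ℕ) (R : ℕ → ℕ → Prop)
    (hw : ∀ i, w i ≤ 2) (h0 : w 0 = 0) (h1 : w 1 = 0) (hl : w (n-1) = 1)
    (hge : ∀ i, n ≤ i → w i = 1)
    (F1 : ∀ p q, 1 ≤ p → p < q → q ≤ n → R p q → w p = 0 → w (q-1) = 1 → False)
    (F2 : ∀ p q, 1 ≤ p → p < q → q ≤ n → R p q → w (p+1) = 1 → w q = 0 → False)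
    (F3 : ∀ p q, 1 ≤ p → p < q → q ≤ n → R p q → w (p-1) = 1 → w (q-2) = 0 → False)
    (F4 : ∀ p j q, 1 ≤ p → p < j → j + 1 < q → q ≤ n → w p = 0 → R p (j+1) → R j q →
      w (q-1) = 1 → False)
    (F5 : ∀ p j k q, 1 ≤ p → p < j → j < k → k + 1 < q → q ≤ n → w p = 0 → R p (j+1) →
      R j (k+1) → R k q → w (q-1) = 1 → False)
    (hC : ((Finset.Icc 1 n).filter (fun p => w p = 2)).card ≤ 2)
    (hT : ∀ (S : Finset ℕ) (f : ℕ → ℕ), S ⊆ Finset.Icc 1 n →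
      (∀ p q, 1 ≤ p → p < q → q ≤ n → p ∉ S → q ∉ S → R p q → f p = f q) →
      ∀ K : Finset ℕ, (∀ k ∈ K, ∃ p, 1 ≤ p ∧ p ≤ n ∧ p ∉ S ∧ f p = k) → 2 ≤ K.card →
      4 * K.card ≤ S.card) : False := by
  classical
  set Z := (Finset.Icc 1 n).filter (fun p => w (p-1) = 1 ∧ w p = 0) with hZ
  have memZ : ∀ z, z ∈ Z ↔ (1 ≤ z ∧ z ≤ n) ∧ w (z-1) = 1 ∧ w z = 0 := by
    intro z; simp [hZ]
  have hwn := hge n le_rfl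
  have hwn1 := hge (n+1) (by omega)
  set f : ℕ → ℕ := fun p => if p ∈ Z then p else if w p = 0 then 1 else n with hf
  have h1Z : 1 ∉ Z := by rw [memZ]; simp [h0]
  have hnZ : n ∉ Z := by rw [memZ]; omega
  -- generic finish
  have fin : ∀ (S : Finset ℕ), S ⊆ Finset.Icc 1 n →
      (∀ p q, 1 ≤ p → p < q → q ≤ n → p ∉ S → q ∉ S → R p q → f p = f q) →
      1 ∉ S → n ∉ S → (∀ z ∈ Z, z ∉ S) → 4 * (Z.card + 2) ≤ S.card := by
    intro S hS hR a1 a2 a3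
    have := hT S f hS hR (insert 1 (insert n Z)) ?_ ?_
    · rwa [Finset.card_insert_of_notMem, Finset.card_insert_of_notMem hnZ] at this
      simp only [Finset.mem_insert, not_or]
      exact ⟨by omega, h1Z⟩
    · intro k hk
      simp only [Finset.mem_insert] at hk
      rcases hk with rfl | rfl | hk
      · exact ⟨1, le_rfl, by omega, a1, by simp [hf, h1Z, h1]⟩
      · exact ⟨k, by omega, le_rfl, a2, by simp [hf, hnZ, hwn]⟩
      · exact ⟨k, by have := (memZ k).1 hk; omega, by have := (memZ k).1 hk; omega, a3 k hk, by simp [hf, hk]⟩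
    · rw [Finset.card_insert_of_notMem, Finset.card_insert_of_notMem hnZ]
      · omega
      · simp only [Finset.mem_insert, not_or]
        exact ⟨by omega, h1Z⟩
  by_cases hm : Z.card ≤ 1
  · -- threshold
    obtain ⟨τ, hτ1, hτ⟩ : ∃ τ, (τ = n + 1 ∨ τ ∈ Z) ∧ ∀ z ∈ Z, z = τ := by
      rcases Z.eq_empty_or_nonempty with h | ⟨z, hz⟩
      · exact ⟨n+1, Or.inl rfl, by simp [h]⟩
      · exact ⟨z, Or.inr hz, fun y hy => Finset.card_le_one.1 hm _ hy _ hz⟩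
    have hτ2 : τ = n+1 ∨ (1 ≤ τ ∧ τ ≤ n ∧ w (τ-1) = 1 ∧ w τ = 0) := by
      rw [memZ] at hτ1; tauto
    set S := (Finset.Icc 1 n).filter (fun p => (w (p-1) ≠ 1 ∧ w p ≠ 0) ∨
      (p < τ ∧ w (p-1) = 1 ∧ w p ≠ 0 ∧ w (p+1) ≠ 1) ∨
      (τ < p ∧ w p = 0 ∧ w (p-1) ≠ 1 ∧ w (p-2) ≠ 0)) with hS
    have memS : ∀ p, p ∈ S ↔ (1 ≤ p ∧ p ≤ n) ∧ ((w (p-1) ≠ 1 ∧ w p ≠ 0) ∨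
      (p < τ ∧ w (p-1) = 1 ∧ w p ≠ 0 ∧ w (p+1) ≠ 1) ∨
      (τ < p ∧ w p = 0 ∧ w (p-1) ≠ 1 ∧ w (p-2) ≠ 0)) := by
      intro p; simp [hS]
    have key := fin S (Finset.filter_subset _ _) ?_ ?_ ?_ ?_
    · have cnt := core_count w n hw h0 S (fun c => if c < τ then
          (if w (c+1) = 1 then (if w (c-1) = 1 then {c-1, c+1} else {c, c+1}) else {c-1, c})
          else (if w (c-1) = 0 then (if w (c+1) = 0 then {c, c+2} else {c, c+1}) else {c+1,c+2})) 2 ?_ ?_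
      · rw [← hZ] at cnt
        omega
      · intro c
        split_ifs <;> exact Finset.card_le_two
      · intro p hp
        rw [memS] at hp
        exact core_mem1 n τ w hw h0 h1 hge hτ2 p hp.1.1 hp.1.2 hp.2
    · intro p q hp hpq hq hpS hqS hR
      have g1 := F1 p q hp hpq hq hR
      have g2 := F2 p q hp hpq hq hR
      have g3 := F3 p q hp hpq hq hR
      rw [memS] at hpS hqS
      have i1 : p ∈ Z ↔ w (p-1) = 1 ∧ w p = 0 := by rw [memZ]; exact ⟨fun h => h.2, fun h => ⟨⟨by omega, by omega⟩, h⟩⟩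
      have i2 : q ∈ Z ↔ w (q-1) = 1 ∧ w q = 0 := by rw [memZ]; exact ⟨fun h => h.2, fun h => ⟨⟨by omega, by omega⟩, h⟩⟩
      simp only [hf, i1, i2]
      refine core_edge1 p q τ n (w (p-1)) (w p) (w (p+1)) (w (q-2)) (w (q-1)) (w q) hpq ?_ ?_ ?_ ?_
        (fun h => g1 h.1 h.2) (fun h => g2 h.1 h.2) (fun h => g3 h.1 h.2) (fun h => hτ p (i1.2 h)) ?_ (fun h => hτ q (i2.2 h))
      · exact fun h => hpS ⟨⟨hp, by omega⟩, Or.inl h⟩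
      · exact fun h => hpS ⟨⟨hp, by omega⟩, Or.inr (Or.inl h)⟩
      · exact fun h => hqS ⟨⟨by omega, by omega⟩, Or.inl h⟩
      · exact fun h => hqS ⟨⟨by omega, by omega⟩, Or.inr (Or.inr h)⟩
      · rintro rfl
        rcases hτ2 with h | h
        · omega
        · exact h.2.2.2
    · rw [memS]; simp [h0, h1]
    · rw [memS]; simp [hl, hwn, hwn1]
    · intro z hz
      rw [memZ] at hz
      rw [memS]; omega
  · -- full removal
    have C3 : ∀ a b c, a < b → b < c → 1 ≤ a → c ≤ n → w a = 2 → w b = 2 → w c = 2 → False := by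
      intro a b c hab hbc ha hc wa wb wc
      have : ({a, b, c} : Finset ℕ) ⊆ (Finset.Icc 1 n).filter (fun p => w p = 2) := by
        intro i hi
        simp only [Finset.mem_insert, Finset.mem_singleton] at hi
        simp only [Finset.mem_filter, Finset.mem_Icc]
        rcases hi with rfl | rfl | rfl <;> (refine ⟨by omega, by assumption⟩)
      have h3 := Finset.card_le_card this
      rw [Finset.card_eq_three.2 ⟨a, b, c, by omega, by omega, by omega, rfl⟩] at h3
      omega
    let blk : ℕ → Prop := fun c => 1 ≤ c ∧ c < n ∧ w (c-1) = 1 ∧ w c = 2 ∧ w (c+1) = 0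
    let D : ℕ → Prop := fun c => ∃ p, 1 ≤ p ∧ p < c ∧ w p = 0 ∧ R p (c+1)
    let kb : ℕ → Prop := fun c => ∃ c0, blk c0 ∧ D c0 ∧ (c0 = c ∨ (c0 < c ∧ R c0 (c+1)))
    have kbE : ∀ c q, kb c → c + 1 < q → q ≤ n → R c q → w (q-1) = 1 → False := by
      rintro c q ⟨c0, hb, ⟨p, hp1, hp2, hp3, hp4⟩, rfl | ⟨hlt, hR⟩⟩ hq1 hq2 hcq hq3
      · exact F4 p c0 q hp1 hp2 hq1 hq2 hp3 hp4 hcq hq3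
      · exact F5 p c0 c q hp1 hp2 hlt hq1 hq2 hp3 hp4 hR hcq hq3
    have kbD : ∀ c, blk c → ¬ kb c → ¬ D c := fun c hb hk hD => hk ⟨c, hb, hD, Or.inl rfl⟩
    set S := (Finset.Icc 1 n).filter (fun p => (w (p-1) ≠ 1 ∧ w p ≠ 0) ∨
      (w (p-1) = 1 ∧ w p ≠ 0 ∧ w (p+1) ≠ 1 ∧ ¬ (w p = 2 ∧ w (p+1) = 0 ∧ kb p)) ∨
      (w p = 0 ∧ w (p-1) ≠ 1 ∧ w (p-2) ≠ 0 ∧ ¬ (w (p-1) = 2 ∧ w (p-2) = 1 ∧ ¬ kb (p-1)))) with hS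
    have memS : ∀ p, p ∈ S ↔ (1 ≤ p ∧ p ≤ n) ∧ ((w (p-1) ≠ 1 ∧ w p ≠ 0) ∨
      (w (p-1) = 1 ∧ w p ≠ 0 ∧ w (p+1) ≠ 1 ∧ ¬ (w p = 2 ∧ w (p+1) = 0 ∧ kb p)) ∨
      (w p = 0 ∧ w (p-1) ≠ 1 ∧ w (p-2) ≠ 0 ∧ ¬ (w (p-1) = 2 ∧ w (p-2) = 1 ∧ ¬ kb (p-1)))) := by
      intro p; simp only [hS, Finset.mem_filter, Finset.mem_Icc]
    have key := fin S (Finset.filter_subset _ _) ?_ ?_ ?_ ?_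
    · have cnt := core_count w n hw h0 S (fun c =>
          if w (c-1) = 1 then (if w (c+1) = 0 then (if kb c then {c-1, c+1, c+2} else {c-1, c, c+2})
            else {c-1, c, c+1}) else {c, c+1, c+2}) 3 ?_ ?_
      · rw [← hZ] at cnt
        omega
      · intro c
        split_ifs <;> exact Finset.card_le_three
      · intro p hp
        rw [memS] at hp
        exact core_mem2 n kb w hw h0 h1 hge p hp.1.1 hp.1.2 hp.2
    · intro p q hp hpq hq hpS hqS hR
      have g1 := F1 p q hp hpq hq hR
      have g2 := F2 p q hp hpq hq hR
      have g3 := F3 p q hp hpq hq hR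
      have l1 := hw p
      have l2 := hw q
      have l3 := hw (p-1)
      have l4 := hw (q-1)
      have l5 := hw (p+1)
      have l6 := hw (q-2)
      have e1 : q - 1 - 1 = q - 2 := by omega
      have e2 : q - 1 + 1 = q := by omega
      have hqn : w q = 0 → q < n := by
        intro h; by_contra hcon; rw [hge q (by omega)] at h; omega
      have kbq : kb p → w p = 2 → w (q-1) = 1 → False := by
        intro k wp wq
        refine kbE p q k ?_ hq hR wq
        rcases Nat.lt_or_ge (p+1) q with h | h
        · exact h
        · have : p = q - 1 := by omega
          subst this; omega
      have kbz : w q = 0 → w (q-1) = 2 → w (q-2) = 1 → ¬ kb (q-1) → w p = 0 → False := by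
        intro a1 a2 a3 a4 a5
        refine kbD (q-1) ⟨by omega, by omega, by rw [e1]; exact a3, a2, by rw [e2]; exact a1⟩ a4
          ⟨p, hp, ?_, a5, by rw [e2]; exact hR⟩
        rcases Nat.lt_or_ge p (q-1) with h | h
        · exact h
        · have : p = q - 1 := by omega
          subst this; omega
      have kbb : kb p → ¬ kb (q-1) → w (p-1) = 1 → w p = 2 → w (p+1) = 0 →
          w q = 0 → w (q-1) = 2 → False := by
        intro k1 k2 w1 w2 w3 w4 w5
        have hne : p ≠ q - 1 := by rintro rfl; exact k2 k1
        obtain ⟨c0, hb, hD, rfl | ⟨hlt, hR'⟩⟩ := k1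
        · exact k2 ⟨c0, hb, hD, Or.inr ⟨by omega, by rw [e2]; exact hR⟩⟩
        · exact C3 c0 p (q-1) hlt (by omega) hb.1 (by omega) hb.2.2.2.1 w2 w5
      rw [memS] at hpS hqS
      have i1 : p ∈ Z ↔ w (p-1) = 1 ∧ w p = 0 := by rw [memZ]; exact ⟨fun h => h.2, fun h => ⟨⟨by omega, by omega⟩, h⟩⟩
      have i2 : q ∈ Z ↔ w (q-1) = 1 ∧ w q = 0 := by rw [memZ]; exact ⟨fun h => h.2, fun h => ⟨⟨by omega, by omega⟩, h⟩⟩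
      simp only [hf, i1, i2]
      refine core_edge2 p q n (w (p-1)) (w p) (w (p+1)) (w (q-2)) (w (q-1)) (w q) (kb p) (kb (q-1)) hpq
        l5 l1 l6 l4 ?_ ?_ ?_ ?_
        (fun h => g1 h.1 h.2) (fun h => g2 h.1 h.2) (fun h => g3 h.1 h.2) kbq kbz kbb
      · exact fun h => hpS ⟨⟨hp, by omega⟩, Or.inl h⟩
      · exact fun h => hpS ⟨⟨hp, by omega⟩, Or.inr (Or.inl h)⟩
      · exact fun h => hqS ⟨⟨by omega, by omega⟩, Or.inl h⟩
      · exact fun h => hqS ⟨⟨by omega, by omega⟩, Or.inr (Or.inr h)⟩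
    · rw [memS]; simp [h0, h1]
    · rw [memS]; simp [hl, hwn, hwn1]
    · intro z hz
      rw [memZ] at hz
      rw [memS]; omega

def PF {α : Type*} (R : α → α → Prop) (l : List α) (a b : α) : Prop :=
  l.IsChain R ∧ l.head? = some a ∧ l.getLast? = some b

theorem PF.app {α : Type*} {R : α → α → Prop} {l m : List α} {a b c d : α}
    (h1 : PF R l a b) (h : R b c) (h2 : PF R m c d) : PF R (l ++ m) a d := by
  obtain ⟨a1, a2, a3⟩ := h1
  obtain ⟨b1, b2, b3⟩ := h2
  refine ⟨?_, ?_, ?_⟩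
  · rw [List.isChain_append]
    refine ⟨a1, b1, ?_⟩
    intro x hx y hy
    rw [a3] at hx
    rw [b2] at hy
    simp at hx hy
    subst hx; subst hy; exact h
  · rw [List.head?_append, a2]; rfl
  · rw [List.getLast?_append, b3]; rfl

theorem PF.rev {α : Type*} {R : α → α → Prop} (hs : ∀ x y, R x y → R y x) {l : List α} {a b : α}
    (h1 : PF R l a b) : PF R l.reverse b a := by
  obtain ⟨a1, a2, a3⟩ := h1
  refine ⟨?_, ?_, ?_⟩
  · rw [List.isChain_reverse]
    exact a1.imp (fun x y h => hs x y h)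
  · rw [List.head?_reverse, a3]
  · rw [List.getLast?_reverse, a2]

def sg (i j : ℕ) : List ℕ := List.range' i (j + 1 - i)

theorem mem_sg (i j k : ℕ) : k ∈ sg i j ↔ i ≤ k ∧ k ≤ j := by
  unfold sg
  rw [List.mem_range'_1]
  omega

theorem nodup_sg (i j : ℕ) : (sg i j).Nodup := by
  unfold sg
  exact List.nodup_range'

theorem PF_sg {R : ℕ → ℕ → Prop} {n : ℕ} (hp : ∀ i, 1 ≤ i → i < n → R i (i+1)) (i j : ℕ)
    (hi : 1 ≤ i) (hij : i ≤ j) (hj : j ≤ n) : PF R (sg i j) i j := by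
  obtain ⟨k, rfl⟩ := Nat.exists_eq_add_of_le hij
  clear hij
  induction k with
  | zero => simp [sg, PF]
  | succ k ih =>
    have := (ih (by omega)).app (hp (i+k) (by omega) (by omega)) (m := [i+k+1]) (d := i+k+1) (by simp [PF])
    have e : sg i (i + (k+1)) = sg i (i+k) ++ [i+k+1] := by
      unfold sg
      rw [show i + (k+1) + 1 - i = (k + 1) + 1 by omega, show i + k + 1 - i = k+1 by omega, List.range'_concat]
      simp; omega
    rw [e]
    exact this

theorem clo (n : ℕ) (hn : 3 ≤ n) (R : ℕ → ℕ → Prop) (hs : ∀ x y, R x y → R y x)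
    (hirr : ∀ x, ¬ R x x)
    (hp : ∀ i, 1 ≤ i → i < n → R i (i+1))
    (NH : ∀ l : List ℕ, l.Nodup → (∀ k, k ∈ l ↔ 1 ≤ k ∧ k ≤ n) → ∀ a b, PF R l a b → R b a → False)
    [DecidableRel R]
    (hdeg : n ≤ ((Finset.Icc 1 n).filter (fun i => R 1 i)).card +
      ((Finset.Icc 1 n).filter (fun i => R i n)).card + 3)
    (hT : ∀ (S : Finset ℕ) (f : ℕ → ℕ), S ⊆ Finset.Icc 1 n →
      (∀ p q, 1 ≤ p → p < q → q ≤ n → p ∉ S → q ∉ S → R p q → f p = f q) →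
      ∀ K : Finset ℕ, (∀ k ∈ K, ∃ p, 1 ≤ p ∧ p ≤ n ∧ p ∉ S ∧ f p = k) → 2 ≤ K.card →
      4 * K.card ≤ S.card) : False := by
  have sgp := fun i j => PF_sg hp i j
  have F0 : ∀ p, 1 ≤ p → p < n → R 1 (p+1) → R p n → False := by
    intro p h1 h2 h3 h4
    refine NH (sg 1 p ++ (sg (p+1) n).reverse) ?_ ?_ _ _
      ((sgp 1 p (by omega) (by omega) (by omega)).app h4
      (PF.rev hs (sgp (p+1) n (by omega) (by omega) (by omega)))) (hs _ _ h3)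
    · simp only [List.nodup_append', List.nodup_reverse, nodup_sg, true_and, List.disjoint_left, List.mem_reverse, mem_sg, List.mem_append]
      intro a ha; omega
    · intro k; simp only [List.mem_append, List.mem_reverse, mem_sg]; omega
  have h1n : ¬ R 1 n := by
    intro h
    exact NH (sg 1 n) (nodup_sg _ _) (fun k => mem_sg _ _ _) _ _ (sgp 1 n (by omega) (by omega) le_rfl) (hs _ _ h)
  set w : ℕ → ℕ := fun i => if i = 0 then 0 else if n ≤ i then 1 else if R 1 (i+1) then 0 else
    if R i n then 1 else 2 with hw
  have wR0 : ∀ i, 1 ≤ i → w i = 0 → i < n ∧ R 1 (i+1) := by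
    intro i hi h
    simp only [hw] at h
    split_ifs at h with c1 c2 c3
    all_goals first | omega | exact ⟨by omega, c3⟩
  have wR1 : ∀ i, i < n → w i = 1 → 1 ≤ i ∧ R i n := by
    intro i hi h
    simp only [hw] at h
    split_ifs at h with c1 c2 c3 c4
    all_goals first | omega | exact ⟨by omega, c4⟩
  refine core n (by omega) w R ?_ ?_ ?_ ?_ ?_ ?_ ?_ ?_ ?_ ?_ ?_ hT
  · intro i; simp only [hw]; split_ifs <;> omega
  · simp [hw]
  · have := hp 1 le_rfl (by omega)
    simp [hw, this, show ¬ n ≤ 1 by omega]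
  · have h := hp (n-1) (by omega) (by omega)
    rw [show n - 1 + 1 = n by omega] at h
    simp [hw, h, show ¬ n ≤ n - 1 by omega, show n - 1 + 1 = n by omega, h1n, show n - 1 ≠ 0 by omega]
  · intro i hi
    simp [hw, hi, show i ≠ 0 by omega]
  · intro p q hp1 hpq hq hR w1 w2
    have hne : p ≠ q - 1 := by intro h; rw [h] at w1; omega
    obtain ⟨c1, c2⟩ := wR0 _ hp1 w1
    obtain ⟨d1, d2⟩ := wR1 _ (by omega) w2
    refine NH (sg 1 p ++ (sg q n ++ (sg (p+1) (q-1)).reverse)) ?_ ?_ _ _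
      ((sgp 1 p (by omega) (by omega) (by omega)).app hR
      ((sgp q n (by omega) (by omega) (by omega)).app (hs _ _ d2)
      (PF.rev hs (sgp (p+1) (q-1) (by omega) (by omega) (by omega))))) (hs _ _ c2)
    · simp only [List.nodup_append', List.nodup_reverse, nodup_sg, true_and, List.disjoint_left, List.mem_reverse, mem_sg, List.mem_append]
      refine ⟨fun a ha => ?_, fun a ha => ?_⟩ <;> omega
    · intro k; simp only [List.mem_append, List.mem_reverse, mem_sg]; omega
  · intro p q hp1 hpq hq hR w1 w2
    have hne : p + 1 ≠ q := by intro h; rw [h] at w1; omega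
    obtain ⟨c1, c2⟩ := wR0 _ (by omega) w2
    obtain ⟨d1, d2⟩ := wR1 _ (by omega) w1
    refine NH (sg 1 p ++ ((sg (p+1) q).reverse ++ (sg (q+1) n).reverse)) ?_ ?_ _ _
      ((sgp 1 p (by omega) (by omega) (by omega)).app hR
      ((PF.rev hs (sgp (p+1) q (by omega) (by omega) (by omega))).app d2
      (PF.rev hs (sgp (q+1) n (by omega) (by omega) (by omega))))) (hs _ _ c2)
    · simp only [List.nodup_append', List.nodup_reverse, nodup_sg, true_and, List.disjoint_left, List.mem_reverse, mem_sg, List.mem_append]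
      refine ⟨fun a ha => ?_, fun a ha => ?_⟩ <;> omega
    · intro k; simp only [List.mem_append, List.mem_reverse, mem_sg]; omega
  · intro p q hp1 hpq hq hR w1 w2
    have hne : p - 1 ≠ q - 2 := by intro h; rw [h] at w1; omega
    obtain ⟨d1, d2⟩ := wR1 _ (by omega) w1
    obtain ⟨c1, c2⟩ := wR0 _ (by omega) w2
    rw [show q - 2 + 1 = q - 1 by omega] at c2
    refine NH (sg 1 (p-1) ++ ((sg q n).reverse ++ (sg p (q-1)))) ?_ ?_ _ _
      ((sgp 1 (p-1) (by omega) (by omega) (by omega)).app d2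
      ((PF.rev hs (sgp q n (by omega) (by omega) (by omega))).app (hs _ _ hR)
      (sgp p (q-1) (by omega) (by omega) (by omega)))) (hs _ _ c2)
    · simp only [List.nodup_append', List.nodup_reverse, nodup_sg, true_and, List.disjoint_left, List.mem_reverse, mem_sg, List.mem_append]
      refine ⟨fun a ha => ?_, fun a ha => ?_⟩ <;> omega
    · intro k; simp only [List.mem_append, List.mem_reverse, mem_sg]; omega
  · intro p j q hp1 hpj hjq hq w1 r1 r2 w2
    obtain ⟨c1, c2⟩ := wR0 _ (by omega) w1
    obtain ⟨d1, d2⟩ := wR1 _ (by omega) w2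
    refine NH ((sg (p+1) j).reverse ++ (sg 1 p ++ ((sg (j+1) (q-1)) ++ (sg q n).reverse))) ?_ ?_ _ _
      ((PF.rev hs (sgp (p+1) j (by omega) (by omega) (by omega))).app (hs _ _ c2)
      ((sgp 1 p (by omega) (by omega) (by omega)).app r1
      ((sgp (j+1) (q-1) (by omega) (by omega) (by omega)).app d2
      (PF.rev hs (sgp q n (by omega) (by omega) (by omega)))))) (hs _ _ r2)
    · simp only [List.nodup_append', List.nodup_reverse, nodup_sg, true_and, List.disjoint_left, List.mem_reverse, mem_sg, List.mem_append]
      refine ⟨⟨fun a ha => ?_, fun a ha => ?_⟩, fun a ha => ?_⟩ <;> omega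
    · intro k; simp only [List.mem_append, List.mem_reverse, mem_sg]; omega
  · intro p j k q hp1 hpj hjk hkq hq w1 r1 r2 r3 w2
    obtain ⟨c1, c2⟩ := wR0 _ (by omega) w1
    obtain ⟨d1, d2⟩ := wR1 _ (by omega) w2
    refine NH (sg 1 p ++ (sg (j+1) k ++ (sg q n ++ ((sg (k+1) (q-1)).reverse ++ (sg (p+1) j).reverse)))) ?_ ?_ _ _
      ((sgp 1 p (by omega) (by omega) (by omega)).app r1
      ((sgp (j+1) k (by omega) (by omega) (by omega)).app r3
      ((sgp q n (by omega) (by omega) (by omega)).app (hs _ _ d2)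
      ((PF.rev hs (sgp (k+1) (q-1) (by omega) (by omega) (by omega))).app (hs _ _ r2)
      (PF.rev hs (sgp (p+1) j (by omega) (by omega) (by omega))))))) (hs _ _ c2)
    · simp only [List.nodup_append', List.nodup_reverse, nodup_sg, true_and, List.disjoint_left, List.mem_reverse, mem_sg, List.mem_append]
      refine ⟨⟨⟨fun a ha => ?_, fun a ha => ?_⟩, fun a ha => ?_⟩, fun a ha => ?_⟩ <;> omega
    · intro k; simp only [List.mem_append, List.mem_reverse, mem_sg]; omega
  · set A := (Finset.Icc 1 n).filter (fun i => R 1 i) with hA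
    set B := (Finset.Icc 1 n).filter (fun i => R i n) with hB
    set C := (Finset.Icc 1 n).filter (fun i => w i = 2) with hC
    have eA : (A.image (fun i => i - 1)).card = A.card := by
      apply Finset.card_image_of_injOn
      intro i hi j hj hij
      simp only [hA, Finset.coe_filter, Set.mem_setOf_eq, Finset.mem_Icc] at hi hj
      simp only at hij
      omega
    have memA : ∀ i, i ∈ A.image (fun i => i - 1) → 1 ≤ i ∧ i < n ∧ R 1 (i+1) := by
      intro i hi
      simp only [hA, Finset.mem_image, Finset.mem_filter, Finset.mem_Icc] at hi
      obtain ⟨a, ⟨⟨h1, h2⟩, h3⟩, rfl⟩ := hi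
      have : a ≠ 1 := by rintro rfl; exact hirr _ h3
      rw [show a - 1 + 1 = a by omega]
      exact ⟨by omega, by omega, h3⟩
    have memB : ∀ i, i ∈ B → 1 ≤ i ∧ i < n ∧ R i n := by
      intro i hi
      simp only [hB, Finset.mem_filter, Finset.mem_Icc] at hi
      obtain ⟨⟨h1, h2⟩, h3⟩ := hi
      have : i ≠ n := by rintro rfl; exact hirr _ h3
      exact ⟨by omega, by omega, h3⟩
    have memC : ∀ i, i ∈ C → 1 ≤ i ∧ i < n ∧ ¬ R 1 (i+1) ∧ ¬ R i n := by
      intro i hi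
      simp only [hC, Finset.mem_filter, Finset.mem_Icc] at hi
      obtain ⟨⟨h1, h2⟩, h3⟩ := hi
      simp only [hw] at h3
      split_ifs at h3 with c1 c2 c3 c4
      all_goals first | omega | exact ⟨by omega, by omega, c3, c4⟩
    have d1 : Disjoint (A.image (fun i => i - 1)) B := by
      rw [Finset.disjoint_left]
      intro i hi hj
      have := memA i hi
      have := memB i hj
      exact F0 i (by tauto) (by tauto) (by tauto) (by tauto)
    have d2 : Disjoint (A.image (fun i => i - 1) ∪ B) C := by
      rw [Finset.disjoint_left]
      intro i hi hj
      have hc := memC i hj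
      rw [Finset.mem_union] at hi
      rcases hi with hi | hi
      · have := memA i hi; tauto
      · have := memB i hi; tauto
    have sub : (A.image (fun i => i - 1) ∪ B) ∪ C ⊆ Finset.Icc 1 (n-1) := by
      intro i hi
      rw [Finset.mem_union, Finset.mem_union] at hi
      rw [Finset.mem_Icc]
      rcases hi with (hi | hi) | hi
      · have := memA i hi; omega
      · have := memB i hi; omega
      · have := memC i hi; omega
    have := Finset.card_le_card sub
    rw [Finset.card_union_of_disjoint d2, Finset.card_union_of_disjoint d1, eA, Nat.card_Icc] at this
    omega

theorem tough_color {V α : Type*} [Fintype V] (G G' : SimpleGraph V) (ht : Tough 4 G)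
    (hle : G ≤ G') (S : Finset V) (f : V → α)
    (hf : ∀ a b, a ∉ S → b ∉ S → G'.Adj a b → f a = f b) (K : Finset α)
    (hK : ∀ k ∈ K, ∃ a, a ∉ S ∧ f a = k) (h2 : 2 ≤ K.card) : 4 * K.card ≤ S.card := by
  classical
  set H := G.induce ((↑S : Set V)ᶜ) with hH
  have hr : ∀ a b, H.Reachable a b → f a.1 = f b.1 := by
    intro a b ⟨p⟩
    induction p with
    | nil => rfl
    | @cons u v w h p ih =>
      rw [← ih]
      refine hf _ _ (fun h => u.2 (Finset.mem_coe.2 h)) (fun h => v.2 (Finset.mem_coe.2 h)) (hle ?_)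
      simpa [hH] using h
  have hnc : ¬ H.Connected := by
    intro hc
    obtain ⟨k1, hk1, k2, hk2, hne⟩ := Finset.one_lt_card.1 (show 1 < K.card by omega)
    obtain ⟨a, ha, rfl⟩ := hK k1 hk1
    obtain ⟨b, hb, rfl⟩ := hK k2 hk2
    exact hne (hr ⟨a, by simpa using ha⟩ ⟨b, by simpa using hb⟩ (hc.preconnected _ _))
  have h4 := ht S hnc
  have hcard : K.card ≤ Nat.card H.ConnectedComponent := by
    choose g hg1 hg2 using hK
    let F : K → H.ConnectedComponent := fun k => H.connectedComponentMk ⟨g k.1 k.2, by simpa using hg1 k.1 k.2⟩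
    have hF : Function.Injective F := by
      intro k1 k2 h
      have h' := hr _ _ (SimpleGraph.ConnectedComponent.exact h)
      simp only [hg2] at h'
      exact Subtype.ext h'
    have := Nat.card_le_card_of_injective F hF
    simpa using this
  have h5 : (4 : ℝ) * K.card ≤ S.card := by
    refine le_trans ?_ h4
    have : (K.card : ℝ) ≤ Nat.card H.ConnectedComponent := by exact_mod_cast hcard
    linarith
  exact_mod_cast h5

theorem esum {V : Type*} [Fintype V] [DecidableEq V] (G : SimpleGraph V) [DecidableRel G.Adj]
    (M : Finset V) (a : V) (ha : a ∈ M) :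
    ∑ b ∈ M.erase a, ((M.erase a).filter (fun y => G.Adj b y)).card + 2 * (M.filter (fun y => G.Adj a y)).card
     ≤ ∑ b ∈ M, (M.filter (fun y => G.Adj b y)).card := by
  rw [← Finset.add_sum_erase M _ ha]
  have h1 : ∀ b ∈ M.erase a, (M.filter (fun y => G.Adj b y)).card =
      ((M.erase a).filter (fun y => G.Adj b y)).card + (if G.Adj a b then 1 else 0) := by
    intro b hb
    conv_lhs => rw [← Finset.insert_erase ha, Finset.filter_insert]
    by_cases h : G.Adj a b
    · rw [if_pos h.symm, if_pos h, Finset.card_insert_of_notMem (by simp)]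
    · rw [if_neg (fun h' => h h'.symm), if_neg h]; rfl
  rw [Finset.sum_congr rfl h1, Finset.sum_add_distrib, ← Finset.card_filter]
  have h2 : (M.erase a).filter (fun y => G.Adj a y) = M.filter (fun y => G.Adj a y) := by
    ext y
    simp only [Finset.mem_filter, Finset.mem_erase]
    constructor
    · tauto
    · rintro ⟨h, h'⟩
      exact ⟨⟨h'.ne', h⟩, h'⟩
  rw [h2]
  omega

theorem matching_step {V : Type*} [Fintype V] [DecidableEq V] (G : SimpleGraph V) [DecidableRel G.Adj]
    (X : Finset V) (hX : ∀ a ∈ X, (X.filter (fun y => G.Adj a y)).card ≤ 2) :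
    ∃ Q ⊆ X, (∀ a ∈ X \ Q, ((X \ Q).filter (fun y => G.Adj a y)).card ≤ 1) ∧
      ∑ a ∈ X \ Q, ((X \ Q).filter (fun y => G.Adj a y)).card + 4 * Q.card ≤ 2 * X.card := by
  obtain ⟨Q, hQ, hmax⟩ := Finset.exists_max_image (X.powerset.filter (fun Q =>
    ∑ a ∈ X \ Q, ((X \ Q).filter (fun y => G.Adj a y)).card + 4 * Q.card ≤ 2 * X.card))
    Finset.card ⟨∅, by
      simp only [Finset.mem_filter, Finset.mem_powerset, Finset.empty_subset, true_and,
        Finset.sdiff_empty, Finset.card_empty]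
      have := Finset.sum_le_card_nsmul X (fun a => (X.filter (fun y => G.Adj a y)).card) 2 hX
      rw [smul_eq_mul] at this
      omega⟩
  simp only [Finset.mem_filter, Finset.mem_powerset] at hQ hmax
  refine ⟨Q, hQ.1, ?_, hQ.2⟩
  intro a ha
  by_contra hcon
  have he := esum G (X \ Q) a ha
  have ha' := Finset.mem_sdiff.1 ha
  have := hmax (insert a Q) ⟨Finset.insert_subset ha'.1 hQ.1, by
    rw [Finset.card_insert_of_notMem ha'.2, Finset.sdiff_insert]
    have h2 := hQ.2
    omega⟩
  rw [Finset.card_insert_of_notMem ha'.2] at this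
  omega

theorem partB {V : Type*} [Fintype V] [DecidableEq V] (G G' : SimpleGraph V) [DecidableRel G'.Adj]
    (ht : Tough 4 G) (hle : G ≤ G') (n : ℕ) (hn : n = Fintype.card V)
    (hP : ∀ i, 4 ≤ i → 2 * i < n → i ≤ (Finset.univ.filter (fun x => G'.degree x ≤ i)).card →
      i - 3 ≤ (Finset.univ.filter (fun x => n - i ≤ G'.degree x)).card)
    (hpair : ∀ x y, x ≠ y → ¬ G'.Adj x y → G'.degree x + G'.degree y + 4 ≤ n)
    (hnc : ∃ x y, x ≠ y ∧ ¬ G'.Adj x y) : False := by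
  obtain ⟨x0, y0, hx0⟩ := hnc
  obtain ⟨v, hv, hvmax⟩ := Finset.exists_max_image
    (Finset.univ.filter (fun x => ∃ y, x ≠ y ∧ ¬ G'.Adj x y)) (fun x => G'.degree x)
    ⟨x0, by simp; exact ⟨y0, hx0⟩⟩
  simp only [Finset.mem_filter, Finset.mem_univ, true_and] at hv hvmax
  set X := Finset.univ.filter (fun y => v ≠ y ∧ ¬ G'.Adj v y) with hXd
  have memX : ∀ y, y ∈ X ↔ v ≠ y ∧ ¬ G'.Adj v y := by intro y; simp [hXd]
  obtain ⟨y1, hy1⟩ := hv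
  obtain ⟨u, hu, humax⟩ := Finset.exists_max_image X (fun x => G'.degree x) ⟨y1, (memX y1).2 hy1⟩
  have huX := (memX u).1 hu
  set s := G'.degree u with hs
  set d := G'.degree v with hd
  have hsd : s ≤ d := hvmax u ⟨v, huX.1.symm, fun h => huX.2 h.symm⟩
  have hsum : d + s + 4 ≤ n := hpair v u huX.1 huX.2
  have hXcard : X.card + d + 1 = n := by
    have : X = (insert v (G'.neighborFinset v))ᶜ := by
      ext y
      simp only [memX, Finset.mem_compl, Finset.mem_insert, SimpleGraph.mem_neighborFinset, not_or]
      tauto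
    rw [this, Finset.card_compl, Finset.card_insert_of_notMem (by simp), SimpleGraph.card_neighborFinset_eq_degree, hn]
    have : d < Fintype.card V := G'.degree_lt_card_verts v
    omega
  have hXnu : ∀ a ∈ X, G'.degree a ≤ s := fun a ha => humax a ha
  have h8 : 8 ≤ s := by
    have := tough_color G G' ht hle (G'.neighborFinset u) (fun x => decide (x = u)) ?_ {true, false} ?_ (by simp)
    · simpa using this
    · intro a b ha hb hab
      simp only [SimpleGraph.mem_neighborFinset] at ha hb
      simp only [decide_eq_decide]
      constructor
      · rintro rfl; exact absurd hab hb
      · rintro rfl; exact absurd hab.symm ha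
    · intro k hk
      cases k with
      | true => exact ⟨u, by simp, by simp⟩
      | false => exact ⟨v, by simpa using fun h => huX.2 h.symm, by simpa using huX.1⟩
  set H := Finset.univ.filter (fun x => d < G'.degree x) with hHd
  have memH : ∀ x, x ∈ H ↔ d < G'.degree x := by intro x; simp [hHd]
  have huniv : ∀ x ∈ H, ∀ y, x ≠ y → G'.Adj x y := by
    intro x hx y hxy
    by_contra hcon
    have := hvmax x ⟨y, hxy, hcon⟩
    have := (memH x).1 hx
    omega
  have hXH : ∀ a ∈ X, a ∉ H := by
    intro a ha h
    have := hXnu a ha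
    have := (memH a).1 h
    omega
  have hHN : ∀ a ∈ X, H ⊆ G'.neighborFinset a := by
    intro a ha x hx
    rw [SimpleGraph.mem_neighborFinset]
    exact (huniv x hx a (fun h => hXH a ha (h ▸ hx))).symm
  have hXle : ∀ i, s ≤ i → X.card ≤ (Finset.univ.filter (fun x => G'.degree x ≤ i)).card := by
    intro i hi
    apply Finset.card_le_card
    intro a ha
    have := hXnu a ha
    simp; omega
  have hHge : ∀ i, d + i < n → (Finset.univ.filter (fun x => n - i ≤ G'.degree x)).card ≤ H.card := by
    intro i hi
    apply Finset.card_le_card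
    intro a ha
    simp only [Finset.mem_filter, Finset.mem_univ, true_and] at ha
    rw [memH]
    omega
  have hvH : v ∉ H := by rw [memH]; omega
  have hvX : v ∉ X := by rw [memX]; simp
  rcases le_or_gt (2 * s + 7) n with hcase | hcase
  · have h1 := hP (s+3) (by omega) (by omega) (le_trans (by omega) (hXle (s+3) (by omega)))
    have h2 := hHge (s+3) (by omega)
    have hNH : ∀ a ∈ X, H = G'.neighborFinset a := by
      intro a ha
      apply Finset.eq_of_subset_of_card_le (hHN a ha)
      rw [SimpleGraph.card_neighborFinset_eq_degree]
      have := hXnu a ha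
      omega
    have hHs : H.card ≤ s := by
      have := Finset.card_le_card (hHN u hu)
      rwa [SimpleGraph.card_neighborFinset_eq_degree] at this
    have := tough_color G G' ht hle H (fun x => if x ∈ X then some x else none) ?_ (Finset.insertNone X) ?_ ?_
    · rw [Finset.card_insertNone] at this
      omega
    · intro a b ha hb hab
      have na : a ∉ X := by
        intro h
        rw [hNH a h] at hb
        simp at hb
        exact hb hab
      have nb : b ∉ X := by
        intro h
        rw [hNH b h] at ha
        simp at ha
        exact ha hab.symm
      simp only [if_neg na, if_neg nb]
    · intro k hk
      cases k with
      | none => exact ⟨v, hvH, by simp [hvX]⟩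
      | some a =>
        rw [Finset.some_mem_insertNone] at hk
        exact ⟨a, hXH a hk, by simp [hk]⟩
    · rw [Finset.card_insertNone]; omega
  · have h1 := hP (s+1) (by omega) (by omega) (le_trans (by omega) (hXle (s+1) (by omega)))
    have h2 := hHge (s+1) (by omega)
    have hX2 : ∀ a ∈ X, (X.filter (fun y => G'.Adj a y)).card ≤ 2 := by
      intro a ha
      have hdis : Disjoint H (X.filter (fun y => G'.Adj a y)) := by
        rw [Finset.disjoint_left]
        intro x hx hx'
        exact hXH x (Finset.mem_filter.1 hx').1 hx
      have hsub : H ∪ X.filter (fun y => G'.Adj a y) ⊆ G'.neighborFinset a := by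
        apply Finset.union_subset (hHN a ha)
        intro x hx
        rw [SimpleGraph.mem_neighborFinset]
        exact (Finset.mem_filter.1 hx).2
      have h3 := Finset.card_le_card hsub
      rw [Finset.card_union_of_disjoint hdis, SimpleGraph.card_neighborFinset_eq_degree] at h3
      have := hXnu a ha
      omega
    obtain ⟨Q, hQX, hQ1, hQ2⟩ := matching_step G' X hX2
    set M := X \ Q with hM
    have hMX : ∀ a ∈ M, a ∈ X := fun a ha => (Finset.mem_sdiff.1 ha).1
    have hMcard : M.card + Q.card = X.card := Finset.card_sdiff_add_card_eq_card hQX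
    let f : V → Finset V := fun x => if x ∈ M then M.filter (fun y => y = x ∨ G'.Adj x y) else ∅
    have fM : ∀ x ∈ M, f x = insert x (M.filter (fun y => G'.Adj x y)) := by
      intro x hx
      simp only [f, if_pos hx]
      ext y
      simp only [Finset.mem_filter, Finset.mem_insert]
      constructor
      · tauto
      · rintro (rfl | h) <;> tauto
    have fcard : ∀ x ∈ M, (f x).card = (M.filter (fun y => G'.Adj x y)).card + 1 := by
      intro x hx
      rw [fM x hx, Finset.card_insert_of_notMem (by simp)]
    have fN : ∀ x, x ∉ M → f x = ∅ := fun x hx => by simp only [f, if_neg hx]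
    have hne : ∅ ∉ M.image f := by
      intro h
      obtain ⟨x, hx, hx'⟩ := Finset.mem_image.1 h
      have := fcard x hx
      rw [hx'] at this
      simp at this
    -- count of colours
    have hc : ∑ x ∈ M, (2 - (M.filter (fun y => G'.Adj x y)).card) ≤ 2 * (M.image f).card := by
      rw [← Finset.sum_fiberwise_of_maps_to (fun x hx => Finset.mem_image_of_mem f hx), mul_comm, ← smul_eq_mul]
      apply Finset.sum_le_card_nsmul
      intro k hk
      obtain ⟨x0, hx0, rfl⟩ := Finset.mem_image.1 hk
      have hfib : M.filter (fun x => f x = f x0) ⊆ f x0 := by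
        intro x hx
        obtain ⟨hx1, hx2⟩ := Finset.mem_filter.1 hx
        rw [← hx2, fM x hx1]
        exact Finset.mem_insert_self _ _
      have h3 := Finset.card_le_card hfib
      have h4 : ∑ x ∈ M.filter (fun x => f x = f x0), (2 - (M.filter (fun y => G'.Adj x y)).card) ≤
          (M.filter (fun x => f x = f x0)).card • (3 - (f x0).card) := by
        apply Finset.sum_le_card_nsmul
        intro x hx
        obtain ⟨hx1, hx2⟩ := Finset.mem_filter.1 hx
        have := fcard x hx1
        rw [hx2] at this
        omega
      refine h4.trans ?_
      rw [smul_eq_mul]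
      have h5 := fcard x0 hx0
      have h6 := hQ1 x0 hx0
      have h7 : (f x0).card = 1 ∨ (f x0).card = 2 := by omega
      rcases h7 with h7 | h7 <;> rw [h7] at h3 ⊢ <;> omega
    have hc2 : ∑ x ∈ M, (2 - (M.filter (fun y => G'.Adj x y)).card) + ∑ x ∈ M, (M.filter (fun y => G'.Adj x y)).card
        = 2 * M.card := by
      rw [← Finset.sum_add_distrib, mul_comm]
      apply Finset.sum_const_nat
      intro x hx
      have := hQ1 x hx
      omega
    have hc3 : ∑ x ∈ M, (M.filter (fun y => G'.Adj x y)).card ≤ M.card := by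
      have := Finset.sum_le_card_nsmul M _ 1 hQ1
      simpa using this
    have := tough_color G G' ht hle (G'.neighborFinset v ∪ Q) f ?_ (insert ∅ (M.image f)) ?_ ?_
    · rw [Finset.card_insert_of_notMem hne] at this
      have h3 := Finset.card_union_le (G'.neighborFinset v) Q
      rw [SimpleGraph.card_neighborFinset_eq_degree] at h3
      omega
    · have hout : ∀ a, a ∉ G'.neighborFinset v ∪ Q → a = v ∨ a ∈ M := by
        intro a ha
        simp only [Finset.mem_union, SimpleGraph.mem_neighborFinset, not_or] at ha
        by_cases h : a = v
        · exact Or.inl h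
        · right
          rw [hM, Finset.mem_sdiff, memX]
          exact ⟨⟨fun h' => h h'.symm, ha.1⟩, ha.2⟩
      intro a b ha hb hab
      have na : a ≠ v := by
        rintro rfl
        simp only [Finset.mem_union, SimpleGraph.mem_neighborFinset, not_or] at hb
        exact hb.1 hab
      have nb : b ≠ v := by
        rintro rfl
        simp only [Finset.mem_union, SimpleGraph.mem_neighborFinset, not_or] at ha
        exact ha.1 hab.symm
      have ma := (hout a ha).resolve_left na
      have mb := (hout b hb).resolve_left nb
      have e1 : M.filter (fun y => G'.Adj a y) = {b} := by
        symm
        apply Finset.eq_of_subset_of_card_le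
        · simp [mb, hab]
        · simpa using hQ1 a ma
      have e2 : M.filter (fun y => G'.Adj b y) = {a} := by
        symm
        apply Finset.eq_of_subset_of_card_le
        · simp [ma, hab.symm]
        · simpa using hQ1 b mb
      rw [fM a ma, fM b mb, e1, e2, Finset.pair_comm]
    · intro k hk
      rcases Finset.mem_insert.1 hk with rfl | hk
      · refine ⟨v, ?_, fN v (fun h => hvX (hMX v h))⟩
        simp only [Finset.mem_union, SimpleGraph.mem_neighborFinset, not_or]
        exact ⟨G'.loopless.irrefl v, fun h => hvX (hQX h)⟩
      · obtain ⟨x, hx, rfl⟩ := Finset.mem_image.1 hk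
        refine ⟨x, ?_, rfl⟩
        have := (memX x).1 (hMX x hx)
        simp only [Finset.mem_union, SimpleGraph.mem_neighborFinset, not_or]
        exact ⟨this.2, (Finset.mem_sdiff.1 hx).2⟩
    · rw [Finset.card_insert_of_notMem hne]
      omega

def HamL {V : Type*} (G : SimpleGraph V) : Prop :=
  ∃ l : List V, l.Nodup ∧ (∀ x, x ∈ l) ∧ ∃ a b, PF G.Adj l a b ∧ G.Adj b a

theorem hamL_isHam {V : Type*} [Fintype V] [DecidableEq V] (G : SimpleGraph V)
    (h3 : 3 ≤ Fintype.card V) (h : HamL G) : G.IsHamiltonian := by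
  obtain ⟨l, hnd, hfull, a, b, ⟨hc, ha, hb⟩, hba⟩ := h
  have hne : l ≠ [] := by rintro rfl; simp at ha
  have hlen : 3 ≤ l.length := by
    rw [← List.toFinset_card_of_nodup hnd]
    have : l.toFinset = Finset.univ := by ext x; simp [hfull]
    rw [this]; exact h3
  have ha' : l.head hne = a := by
    rw [List.head?_eq_some_head hne] at ha; exact Option.some.inj ha
  have hb' : l.getLast hne = b := by
    rw [List.getLast?_eq_some_getLast hne] at hb; exact Option.some.inj hb
  subst ha' hb'
  intro _
  set p := Walk.ofSupport l hne hc with hp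
  have hs : p.support = l := Walk.support_ofSupport hne hc
  have hpath : p.IsPath := by rw [Walk.isPath_def, hs]; exact hnd
  have hl : p.length + 1 = l.length := by
    have h := Walk.length_support p
    rw [hs] at h
    exact h.symm
  have hH : p.IsHamiltonian := hpath.isHamiltonian_of_mem (fun x => by rw [hs]; exact hfull x)
  refine ⟨_, Walk.cons hba p, ?_⟩
  have hcy : (Walk.cons hba p).IsCycle := by
    rw [Walk.cons_isCycle_iff]
    refine ⟨hpath, ?_⟩
    intro he
    rw [Sym2.eq_swap] at he
    have := hpath.length_eq_one_of_mem_edges he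
    omega
  refine ⟨hcy, ?_⟩
  intro z
  have hz := hH z
  rw [Walk.support_tail_of_not_nil _ (by simp)]
  simpa using hz

theorem rotL {V : Type*} (R Q : V → V → Prop) (hsub : ∀ x y, Q x y → R x y)
    (l : List V) (hnd : l.Nodup) (hfull : ∀ x, x ∈ l) (a b : V) (hpf : PF R l a b) (hba : R b a)
    (hbad : ¬ (l.IsChain Q ∧ Q b a)) :
    ∃ l' : List V, l'.Nodup ∧ (∀ x, x ∈ l') ∧ ∃ a' b', PF R l' a' b' ∧ R b' a' ∧ ¬ Q b' a' := by
  by_cases hq : Q b a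
  · have hnc : ¬ l.IsChain Q := fun h => hbad ⟨h, hq⟩
    rw [List.isChain_iff_forall_rel_of_append_cons_cons] at hnc
    push Not at hnc
    obtain ⟨u, w, l1, l2, rfl, hn⟩ := hnc
    obtain ⟨hc, h1, h2⟩ := hpf
    have e : l1 ++ u :: w :: l2 = (l1 ++ [u]) ++ (w :: l2) := by simp
    rw [e] at hc hnd hfull h1 h2
    rw [List.isChain_append] at hc
    obtain ⟨c1, c2, c3⟩ := hc
    have p1 : PF R (l1 ++ [u]) a u := by
      refine ⟨c1, ?_, by simp⟩
      rw [List.head?_append] at h1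
      cases hh : (l1 ++ [u]).head? with
      | none => simp at hh
      | some z => rw [hh] at h1; simpa using h1
    have p2 : PF R (w :: l2) w b := by
      refine ⟨c2, rfl, ?_⟩
      rw [List.getLast?_append] at h2
      cases hh : (w :: l2).getLast? with
      | none => simp at hh
      | some z => rw [hh] at h2; simpa using h2
    refine ⟨(w :: l2) ++ (l1 ++ [u]), ?_, ?_, w, u, p2.app hba p1, c3 u (by simp) w (by simp), hn⟩
    · exact (List.perm_append_comm.nodup_iff).1 hnd
    · intro x; exact (List.perm_append_comm.mem_iff).1 (hfull x)
  · exact ⟨l, hnd, hfull, a, b, hpf, hba, hq⟩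

theorem pathL {V : Type*} [Fintype V] [DecidableEq V] (G : SimpleGraph V)
    (h3 : 3 ≤ Fintype.card V) (hnh : ¬ HamL G) (x y : V)
    (hH : HamL (G ⊔ SimpleGraph.edge x y)) :
    ∃ l : List V, l.Nodup ∧ (∀ x, x ∈ l) ∧ PF G.Adj l x y := by
  obtain ⟨l0, n0, f0, a0, b0, p0, e0⟩ := hH
  obtain ⟨l, hnd, hfull, a, b, hpf, hba, hnb⟩ := rotL _ G.Adj
    (fun p q h => by rw [SimpleGraph.sup_adj]; exact Or.inl h) l0 n0 f0 a0 b0 p0 e0 (by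
      rintro ⟨h1, h2⟩
      exact hnh ⟨l0, n0, f0, a0, b0, ⟨h1, p0.2⟩, h2⟩)
  have hlen : 3 ≤ l.length := by
    rw [← List.toFinset_card_of_nodup hnd]
    have : l.toFinset = Finset.univ := by ext x; simp [hfull]
    rw [this]; exact h3
  have key : ∀ p q, (G ⊔ SimpleGraph.edge x y).Adj p q → ¬ G.Adj p q → (p = x ∧ q = y) ∨ (p = y ∧ q = x) := by
    intro p q h h'
    rw [SimpleGraph.sup_adj, SimpleGraph.edge_adj] at h
    tauto
  have kb := key b a hba hnb
  have hc : l.IsChain G.Adj := by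
    rw [List.isChain_iff_forall_rel_of_append_cons_cons]
    intro p q l1 l2 hl
    by_contra hpq
    have hadj := List.isChain_iff_forall_rel_of_append_cons_cons.1 hpf.1 hl
    have kp := key p q hadj hpq
    have hcase : (p = a ∧ q = b) ∨ (p = b ∧ q = a) := by grind
    obtain ⟨-, h1, h2⟩ := hpf
    subst hl
    rcases hcase with ⟨rfl, rfl⟩ | ⟨rfl, rfl⟩
    · have e1 : l1 = [] := by
        cases l1 with
        | nil => rfl
        | cons z t => simp at h1; subst h1; simp at hnd
      subst e1
      have e2 : l2 = [] := by
        rcases List.eq_nil_or_concat l2 with h | ⟨t, z, rfl⟩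
        · exact h
        · have : z = q := by simpa [List.getLast?_cons] using h2
          subst this; simp at hnd
      subst e2
      simp at hlen
    · rcases List.eq_nil_or_concat l2 with rfl | ⟨t, z, rfl⟩
      · simp at h2; subst h2; simp [List.nodup_append] at hnd
      · have : z = p := by simpa [List.getLast?_cons] using h2
        subst this; simp [List.nodup_append] at hnd
  have hpg : PF G.Adj l a b := ⟨hc, hpf.2⟩
  rcases kb with ⟨rfl, rfl⟩ | ⟨rfl, rfl⟩
  · exact ⟨l.reverse, by simpa using hnd, by simpa using hfull, hpg.rev (fun _ _ h => h.symm)⟩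
  · exact ⟨l, hnd, hfull, hpg⟩

theorem hamL_top {V : Type*} [Fintype V] [DecidableEq V] (G : SimpleGraph V)
    (h3 : 3 ≤ Fintype.card V) (hall : ∀ x y, x ≠ y → G.Adj x y) : HamL G := by
  have hnd := Finset.nodup_toList (Finset.univ : Finset V)
  have hl : 3 ≤ (Finset.univ : Finset V).toList.length := by
    rw [Finset.length_toList]; exact h3
  have hfull : ∀ x, x ∈ (Finset.univ : Finset V).toList := by simp
  generalize (Finset.univ : Finset V).toList = l at *
  have hc : l.IsChain G.Adj := (List.Pairwise.imp (fun h => hall _ _ h) hnd).isChain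
  refine ⟨l, hnd, hfull, l[0], l[l.length-1], ⟨hc, ?_, ?_⟩, ?_⟩
  · rw [List.head?_eq_getElem?]; simp
  · rw [List.getLast?_eq_getElem?]; simp
  · apply hall
    intro h
    have := (hnd.getElem_inj_iff).1 h
    omega

theorem cloV {V : Type*} [Fintype V] [DecidableEq V] (G G' : SimpleGraph V) [DecidableRel G'.Adj]
    (ht : Tough 4 G) (hle : G ≤ G') (h3 : 3 ≤ Fintype.card V) (hnh : ¬ HamL G') (x y : V)
    (l : List V) (hnd : l.Nodup) (hfull : ∀ x, x ∈ l) (hpf : PF G'.Adj l x y)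
    (hd : Fintype.card V ≤ G'.degree x + G'.degree y + 3) : False := by
  classical
  have hlen : l.length = Fintype.card V := by
    rw [← List.toFinset_card_of_nodup hnd]
    have : l.toFinset = Finset.univ := by ext x; simp [hfull]
    rw [this]; rfl
  set n := Fintype.card V with hn
  set v : ℕ → V := fun i => l.getD (i-1) x with hv
  have hvi : ∀ i (h1 : 1 ≤ i) (h2 : i ≤ n), v i = l[i-1] := by
    intro i h1 h2
    simp only [hv]
    rw [List.getD_eq_getElem]
  have hinj : ∀ i j, 1 ≤ i → i ≤ n → 1 ≤ j → j ≤ n → v i = v j → i = j := by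
    intro i j h1 h2 h3 h4 h
    rw [hvi i h1 h2, hvi j h3 h4] at h
    have := (hnd.getElem_inj_iff).1 h
    omega
  have hsurj : ∀ w : V, ∃ i, 1 ≤ i ∧ i ≤ n ∧ v i = w := by
    intro w
    obtain ⟨i, hi, h⟩ := List.mem_iff_getElem.1 (hfull w)
    refine ⟨i+1, by omega, by omega, ?_⟩
    rw [hvi _ (by omega) (by omega)]
    simpa using h
  obtain ⟨hc, hx, hy⟩ := hpf
  have hv1 : v 1 = x := by
    rw [hvi _ (by omega) (by omega)]
    rw [List.head?_eq_getElem?, List.getElem?_eq_getElem (by omega)] at hx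
    simpa using hx
  have hvn : v n = y := by
    rw [hvi _ (by omega) (by omega)]
    rw [List.getLast?_eq_getElem?, List.getElem?_eq_getElem (by omega)] at hy
    simpa [hlen] using hy
  choose idx hi1 hi2 hi3 using hsurj
  have hidx : ∀ p, 1 ≤ p → p ≤ n → idx (v p) = p := fun p h1 h2 =>
    hinj _ _ (hi1 _) (hi2 _) h1 h2 (hi3 _)
  refine clo n h3 (fun p q => G'.Adj (v p) (v q)) (fun _ _ h => h.symm) (fun _ h => G'.loopless.irrefl _ h) ?_ ?_ ?_ ?_
  · intro i h1 h2
    show G'.Adj (v i) (v (i+1))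
    rw [hvi _ h1 (by omega), hvi _ (by omega) (by omega)]
    have := List.isChain_iff_getElem.1 hc (i-1) (by omega)
    have e : i - 1 + 1 = i + 1 - 1 := by omega
    simpa only [e] using this
  · intro m hm1 hm2 a b ⟨q1, q2, q3⟩ hba
    refine hnh ⟨m.map v, ?_, ?_, v a, v b, ⟨?_, ?_, ?_⟩, hba⟩
    · refine List.Nodup.map_on ?_ hm1
      intro p hp q hq h
      exact hinj _ _ ((hm2 p).1 hp).1 ((hm2 p).1 hp).2 ((hm2 q).1 hq).1 ((hm2 q).1 hq).2 h
    · intro w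
      exact List.mem_map.2 ⟨idx w, (hm2 _).2 ⟨hi1 w, hi2 w⟩, hi3 w⟩
    · rw [List.isChain_map]; exact q1
    · rw [List.head?_map, q2]; rfl
    · rw [List.getLast?_map, q3]; rfl
  · have g1 : G'.degree x ≤ ((Finset.Icc 1 n).filter (fun i => G'.Adj (v 1) (v i))).card := by
      rw [← SimpleGraph.card_neighborFinset_eq_degree]
      refine Finset.card_le_card_of_injOn idx ?_ ?_
      · intro w hw
        have hw' : G'.Adj x w := by simpa using hw
        simp [hi1, hi2, hi3, hv1, hw']
      · intro w _ z _ h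
        rw [← hi3 w, ← hi3 z, h]
    have g2 : G'.degree y ≤ ((Finset.Icc 1 n).filter (fun i => G'.Adj (v i) (v n))).card := by
      rw [← SimpleGraph.card_neighborFinset_eq_degree]
      refine Finset.card_le_card_of_injOn idx ?_ ?_
      · intro w hw
        have hw' : G'.Adj w y := by simpa using G'.adj_comm _ _ |>.1 (by simpa using hw)
        simp [hi1, hi2, hi3, hvn, hw']
      · intro w _ z _ h
        rw [← hi3 w, ← hi3 z, h]
    omega
  · intro S f hS hf K hK h2
    have hm : ∀ p, 1 ≤ p → p ≤ n → p ∉ S → v p ∉ S.image v := by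
      intro p h1 h2 h3 h
      obtain ⟨q, hq, e⟩ := Finset.mem_image.1 h
      have hq' := Finset.mem_Icc.1 (hS hq)
      have := hinj _ _ hq'.1 hq'.2 h1 h2 e
      subst this; exact h3 hq
    have := tough_color G G' ht hle (S.image v) (fun w => f (idx w)) ?_ K ?_ h2
    · exact this.trans Finset.card_image_le
    · intro a b ha hb hab
      have ha' : idx a ∉ S := fun h => ha (Finset.mem_image.2 ⟨_, h, hi3 a⟩)
      have hb' : idx b ∉ S := fun h => hb (Finset.mem_image.2 ⟨_, h, hi3 b⟩)
      rcases lt_trichotomy (idx a) (idx b) with h | h | h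
      · exact hf _ _ (hi1 a) h (hi2 b) ha' hb' (by simpa only [hi3] using hab)
      · exact congrArg f h
      · exact (hf _ _ (hi1 b) h (hi2 a) hb' ha' (by simpa only [hi3] using hab.symm)).symm
    · intro k hk
      obtain ⟨p, p1, p2, p3, p4⟩ := hK k hk
      exact ⟨v p, hm p p1 p2 p3, by simp only [hidx p p1 p2, p4]⟩

theorem stmt_0 {V : Type*} [Fintype V] [DecidableEq V] {n : ℕ} (hn : 3 ≤ n)
    (G : SimpleGraph V) [DecidableRel G.Adj]
    (v : ℕ → V)
    (hinj : ∀ i j, 1 ≤ i → i ≤ n → 1 ≤ j → j ≤ n → v i = v j → i = j)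
    (hsurj : ∀ w : V, ∃ i, 1 ≤ i ∧ i ≤ n ∧ v i = w)
    (hmono : ∀ i j, 1 ≤ i → i ≤ j → j ≤ n → G.degree (v i) ≤ G.degree (v j))
    (htough : Tough 4 G)
    (hP : ∀ i, 1 ≤ i → 2 * i < n → 4 ≤ i → G.degree (v i) ≤ i →
      n - i ≤ G.degree (v (n - i + 4))) :
    G.IsHamiltonian := by
  classical
  have hcard : n = Fintype.card V := by
    have e : (Finset.Icc 1 n).image v = Finset.univ := by
      ext w
      obtain ⟨i, h1, h2, h3⟩ := hsurj w
      simp only [Finset.mem_image, Finset.mem_Icc, Finset.mem_univ, iff_true]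
      exact ⟨i, ⟨h1, h2⟩, h3⟩
    have c := Finset.card_image_of_injOn (s := Finset.Icc 1 n) (f := v) (by
      intro i hi j hj h
      simp only [Finset.coe_Icc, Set.mem_Icc] at hi hj
      exact hinj i j hi.1 hi.2 hj.1 hj.2 h)
    rw [e] at c
    simpa using c.symm
  have h3 : 3 ≤ Fintype.card V := by omega
  by_contra hnot
  have hG : ¬ HamL G := fun h => hnot (hamL_isHam G h3 h)
  obtain ⟨G', hle, hmax⟩ := Set.Finite.exists_le_maximal
    (Set.toFinite {H : SimpleGraph V | ¬ HamL H}) (show G ∈ {H : SimpleGraph V | ¬ HamL H} from hG)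
  have hnh : ¬ HamL G' := hmax.prop
  have hnc : ∃ x y, x ≠ y ∧ ¬ G'.Adj x y := by
    by_contra hcon
    push Not at hcon
    exact hnh (hamL_top G' h3 hcon)
  have hdle : ∀ w, G.degree w ≤ G'.degree w := fun w => SimpleGraph.degree_le_of_le hle
  refine partB G G' htough hle n hcard ?_ ?_ hnc
  · intro i h4 hin hc
    have hdi : G.degree (v i) ≤ i := by
      by_contra hlt
      push Not at hlt
      have hsub : (Finset.univ.filter (fun x => G'.degree x ≤ i)) ⊆ (Finset.Icc 1 (i-1)).image v := by
        intro w hw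
        have hw' : G'.degree w ≤ i := by simpa using hw
        obtain ⟨j, j1, j2, rfl⟩ := hsurj w
        refine Finset.mem_image.2 ⟨j, Finset.mem_Icc.2 ⟨j1, ?_⟩, rfl⟩
        by_contra hji
        have := hmono i j (by omega) (by omega) j2
        have := hdle (v j)
        omega
      have := (Finset.card_le_card hsub).trans Finset.card_image_le
      simp at this
      omega
    have hdn := hP i (by omega) hin h4 hdi
    have hsub : (Finset.Icc (n-i+4) n).image v ⊆ (Finset.univ.filter (fun x => n - i ≤ G'.degree x)) := by
      intro w hw
      obtain ⟨j, hj, rfl⟩ := Finset.mem_image.1 hw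
      rw [Finset.mem_Icc] at hj
      have := hmono (n-i+4) j (by omega) hj.1 hj.2
      have := hdle (v j)
      simp only [Finset.mem_filter, Finset.mem_univ, true_and]
      omega
    have hc2 := Finset.card_le_card hsub
    rw [Finset.card_image_of_injOn (by
      intro a ha b hb h
      simp only [Finset.coe_Icc, Set.mem_Icc] at ha hb
      exact hinj a b (by omega) ha.2 (by omega) hb.2 h), Nat.card_Icc] at hc2
    omega
  · intro x y hxy hadj
    by_contra hlt
    have hH : HamL (G' ⊔ SimpleGraph.edge x y) := by
      by_contra hno
      have h1 := hmax.le_of_ge (y := G' ⊔ SimpleGraph.edge x y) hno le_sup_left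
      apply hadj
      apply h1
      rw [SimpleGraph.sup_adj, SimpleGraph.edge_adj]
      exact Or.inr ⟨Or.inl ⟨rfl, rfl⟩, hxy⟩
    obtain ⟨l, l1, l2, l3⟩ := pathL G' h3 hnh x y hH
    exact cloV G G' htough hle h3 hnh x y l l1 l2 l3 (by omega)
end

section
/- For every integer t with 1 ≤ t ≤ 3: if G is a t-tough graph on n ≥ 3 vertices whose degree sequence d_1 ≤ d_2 ≤ … ≤ d_n satisfies: for every index i < n/2, if d_i ≤ i then d_{n-i+t} ≥ n-i, then G is Hamiltonian. -/
open SimpleGraph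

section HamTough
open Classical in
/-- neighbours as a finset -/
noncomputable def nb {V : Type*} [Fintype V] (G : SimpleGraph V) (a : V) : Finset V :=
  Finset.univ.filter (fun y => G.Adj a y)

theorem mem_nb {V : Type*} [Fintype V] (G : SimpleGraph V) (a y : V) :
    y ∈ nb G a ↔ G.Adj a y := by simp [nb]

/-- Hamiltonian cycle as a sequence -/
def HamSeq {V : Type*} (G : SimpleGraph V) (n : ℕ) (y : ℕ → V) : Prop :=
  (∀ a b, a < n → b < n → y a = y b → a = b) ∧ (∀ j, j + 1 < n → G.Adj (y j) (y (j+1))) ∧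
    G.Adj (y (n-1)) (y 0)

/-- Hamiltonian path as a sequence -/
def PathSeq {V : Type*} (G : SimpleGraph V) (n : ℕ) (y : ℕ → V) : Prop :=
  (∀ a b, a < n → b < n → y a = y b → a = b) ∧ (∀ j, j + 1 < n → G.Adj (y j) (y (j+1)))

theorem cross1 {V : Type*} (G : SimpleGraph V) (n : ℕ) (x : ℕ → V) (hx : PathSeq G n x)
    (c : ℕ) (hc : c + 1 < n) (h1 : G.Adj (x 0) (x (c+1))) (h2 : G.Adj (x (n-1)) (x c)) :
    ∃ y, HamSeq G n y := by
  obtain ⟨hi, ha⟩ := hx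
  refine ⟨fun j => if j ≤ c then x j else x (n - j + c), ?_, ?_, ?_⟩
  · intro a b han hbn h
    simp only at h
    split_ifs at h <;> have := hi _ _ (by omega) (by omega) h <;> omega
  · intro j hj
    simp only
    by_cases hjc : j + 1 ≤ c
    · rw [if_pos (by omega), if_pos hjc]; exact ha j hj
    · by_cases hjc2 : j ≤ c
      · obtain rfl : j = c := by omega
        rw [if_pos le_rfl, if_neg (by omega)]
        rw [show n - (j+1) + j = n - 1 by omega]
        exact h2.symm
      · rw [if_neg hjc2, if_neg hjc]
        have := ha (n - (j+1) + c) (by omega)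
        rw [show n - (j+1) + c + 1 = n - j + c by omega] at this
        exact this.symm
  · simp only
    rw [if_pos (Nat.zero_le _)]
    by_cases h : n - 1 ≤ c
    · omega
    · rw [if_neg h, show n - (n-1) + c = c + 1 by omega]; exact h1.symm

theorem cross2 {V : Type*} (G : SimpleGraph V) (n : ℕ) (x : ℕ → V) (hx : PathSeq G n x)
    (c d : ℕ) (hcd : c + 1 < d) (hd : d < n) (h1 : G.Adj (x 0) (x (c+1)))
    (h2 : G.Adj (x (n-1)) (x (d-1))) (h3 : G.Adj (x c) (x d)) :
    ∃ y, HamSeq G n y := by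
  obtain ⟨hi, ha⟩ := hx
  refine ⟨fun j => if j ≤ c then x j else if j ≤ c + (n - d) then x (j - c - 1 + d)
    else x (n - j + c), ?_, ?_, ?_⟩
  · intro a b han hbn h
    simp only at h
    split_ifs at h <;> have := hi _ _ (by omega) (by omega) h <;> omega
  · intro j hj
    simp only
    by_cases hjc : j + 1 ≤ c
    · rw [if_pos (by omega), if_pos hjc]; exact ha j hj
    by_cases hjc2 : j ≤ c
    · obtain rfl : j = c := by omega
      rw [if_pos le_rfl, if_neg (by omega), if_pos (by omega)]
      rw [show j + 1 - j - 1 + d = d by omega]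
      exact h3
    by_cases hjc3 : j + 1 ≤ c + (n - d)
    · rw [if_neg hjc2, if_neg hjc, if_pos (by omega), if_pos hjc3]
      have := ha (j - c - 1 + d) (by omega)
      rwa [show j - c - 1 + d + 1 = j + 1 - c - 1 + d by omega] at this
    by_cases hjc4 : j ≤ c + (n - d)
    · rw [if_neg hjc2, if_neg hjc, if_pos hjc4, if_neg hjc3]
      rw [show j - c - 1 + d = n - 1 by omega, show n - (j+1) + c = d - 1 by omega]
      exact h2
    · rw [if_neg hjc2, if_neg hjc, if_neg hjc4, if_neg hjc3]
      have := ha (n - (j+1) + c) (by omega)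
      rw [show n - (j+1) + c + 1 = n - j + c by omega] at this
      exact this.symm
  · simp only
    rw [if_pos (Nat.zero_le _), if_neg (by omega), if_neg (by omega),
      show n - (n-1) + c = c + 1 by omega]
    exact h1.symm

theorem path_structure {V : Type*} [Fintype V] [DecidableEq V] (G : SimpleGraph V) (n : ℕ)
    (hn : 3 ≤ n) (hV : Fintype.card V = n) (x : ℕ → V) (hx : PathSeq G n x)
    (u v : V) (hu : x 0 = u) (hv : x (n-1) = v)
    (hno : ¬ ∃ y, HamSeq G n y) :
    (nb G u).card + (nb G v).card + 1 ≤ n ∧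
    ∃ Y : Finset V, Y.card ≤ 2 * (n - 1 - ((nb G u).card + (nb G v).card)) ∧
      ∀ w w', w ∉ Y → w' ∉ Y → w ≠ u → w ≠ v → w' ≠ u → w' ≠ v → ¬ G.Adj u w → ¬ G.Adj v w →
        ¬ G.Adj u w' → ¬ G.Adj v w' → ¬ G.Adj w w' := by
  classical
  have hi := hx.1
  have hsurj : ∀ w, ∃ j, j < n ∧ x j = w := by
    have himg : (Finset.range n).image x = Finset.univ := by
      apply Finset.eq_univ_of_card
      rw [Finset.card_image_of_injOn, Finset.card_range, hV]
      intro a ha b hb h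
      exact hi a b (by simpa using ha) (by simpa using hb) h
    intro w
    have : w ∈ (Finset.range n).image x := by rw [himg]; simp
    simpa using this
  set A := (Finset.range (n-1)).filter (fun j => G.Adj u (x (j+1))) with hA
  set B := (Finset.range (n-1)).filter (fun j => G.Adj v (x j)) with hB
  have hcA : A.card = (nb G u).card := by
    rw [← Finset.card_image_of_injOn (f := fun j => x (j+1)) (s := A)]
    · congr 1
      ext w
      simp only [Finset.mem_image, hA, Finset.mem_filter, Finset.mem_range, mem_nb]
      constructor
      · rintro ⟨j, ⟨hj, h⟩, rfl⟩; exact h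
      · intro h
        obtain ⟨j, hj, rfl⟩ := hsurj w
        have : j ≠ 0 := by rintro rfl; rw [hu] at h; exact G.loopless.irrefl _ h
        refine ⟨j-1, ⟨by omega, ?_⟩, ?_⟩ <;> rw [show j - 1 + 1 = j by omega]
        exact h
    · intro a ha b hb h
      simp only [hA, Finset.coe_filter, Finset.mem_range, Set.mem_ofPred_eq] at ha hb
      have := hi _ _ (by omega) (by omega) h
      omega
  have hcB : B.card = (nb G v).card := by
    rw [← Finset.card_image_of_injOn (f := fun j => x j) (s := B)]
    · congr 1
      ext w
      simp only [Finset.mem_image, hB, Finset.mem_filter, Finset.mem_range, mem_nb]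
      constructor
      · rintro ⟨j, ⟨hj, h⟩, rfl⟩; exact h
      · intro h
        obtain ⟨j, hj, rfl⟩ := hsurj w
        have : j ≠ n-1 := by rintro rfl; rw [hv] at h; exact G.loopless.irrefl _ h
        exact ⟨j, ⟨by omega, h⟩, rfl⟩
    · intro a ha b hb h
      simp only [hB, Finset.coe_filter, Finset.mem_range, Set.mem_ofPred_eq] at ha hb
      exact hi _ _ (by omega) (by omega) h
  have hdis : Disjoint A B := by
    rw [Finset.disjoint_left]
    intro j hjA hjB
    simp only [hA, hB, Finset.mem_filter, Finset.mem_range] at hjA hjB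
    exact hno (cross1 G n x hx j (by omega) (by rw [hu]; exact hjA.2) (by rw [hv]; exact hjB.2))
  have hsub : A ∪ B ⊆ Finset.range (n-1) :=
    Finset.union_subset (Finset.filter_subset _ _) (Finset.filter_subset _ _)
  have hcU : (A ∪ B).card = A.card + B.card := Finset.card_union_of_disjoint hdis
  have hle := Finset.card_le_card hsub
  rw [Finset.card_range] at hle
  refine ⟨by omega, ?_⟩
  set M := Finset.range (n-1) \ (A ∪ B) with hM
  have hcM : M.card = n - 1 - (A ∪ B).card := by
    rw [hM, Finset.card_sdiff_of_subset hsub, Finset.card_range]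
  refine ⟨M.image x ∪ M.image (fun j => x (j+1)), ?_, ?_⟩
  · refine (Finset.card_union_le _ _).trans ?_
    have h1 := Finset.card_image_le (s := M) (f := x)
    have h2 := Finset.card_image_le (s := M) (f := fun j => x (j+1))
    omega
  · have key : ∀ c d, c < n → d < n → x c ∉ M.image x ∪ M.image (fun j => x (j+1)) →
        x d ∉ M.image x ∪ M.image (fun j => x (j+1)) → x c ≠ v → x d ≠ u →
        ¬ G.Adj v (x c) → ¬ G.Adj u (x d) → c < d → ¬ G.Adj (x c) (x d) := by
      intro c d hc hd hcY hdY hcv hdu hvc hud hcd hadj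
      have hc1 : c ≠ n - 1 := by rintro rfl; exact hcv hv
      have hcM' : c ∉ M := fun h => hcY (Finset.mem_union_left _ (Finset.mem_image_of_mem x h))
      have hdM' : d - 1 ∉ M := fun h => hdY (Finset.mem_union_right _ (by
        refine Finset.mem_image.2 ⟨d-1, h, ?_⟩
        rw [show d - 1 + 1 = d by omega]))
      have hcA' : G.Adj u (x (c+1)) := by
        by_contra hcon
        apply hcM'
        simp only [hM, hA, hB, Finset.mem_sdiff, Finset.mem_range, Finset.mem_union,
          Finset.mem_filter]
        refine ⟨by omega, ?_⟩
        tauto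
      have hdB' : G.Adj v (x (d-1)) := by
        by_contra hcon
        apply hdM'
        simp only [hM, hA, hB, Finset.mem_sdiff, Finset.mem_range, Finset.mem_union,
          Finset.mem_filter]
        rw [show d - 1 + 1 = d by omega]
        refine ⟨by omega, ?_⟩
        tauto
      have hne : c + 1 ≠ d := by
        rintro rfl
        exact hud hcA'
      exact hno (cross2 G n x hx c d (by omega) hd (by rw [hu]; exact hcA')
        (by rw [hv]; exact hdB') hadj)
    intro w w' hw hw' hwu hwv hwu' hwv' h1 h2 h3 h4 hadj
    obtain ⟨c, hc, rfl⟩ := hsurj w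
    obtain ⟨d, hd, rfl⟩ := hsurj w'
    rcases lt_trichotomy c d with h | h | h
    · exact key c d hc hd hw hw' hwv hwu' h2 h3 h hadj
    · subst h; exact G.loopless.irrefl _ hadj
    · exact key d c hd hc hw' hw hwv' hwu h4 h1 h hadj.symm

/-- combinatorial consequence of toughness -/
def ToughC {V : Type*} [Fintype V] (t : ℕ) (G : SimpleGraph V) : Prop :=
  ∀ (I S : Finset V) (v : V), I.Nonempty → v ∉ I → v ∉ S → (∀ w ∈ I, w ∉ S) →
    (∀ w ∈ I, ∀ y, G.Adj w y → y ∈ S) → t * (I.card + 1) ≤ S.card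

open Classical in
/-- vertices of degree at least `q` -/
noncomputable def hi {V : Type*} [Fintype V] (G : SimpleGraph V) (q : ℕ) : Finset V :=
  Finset.univ.filter (fun y => q ≤ (nb G y).card)

open Classical in
/-- vertices of degree at most `q` -/
noncomputable def lo {V : Type*} [Fintype V] (G : SimpleGraph V) (q : ℕ) : Finset V :=
  Finset.univ.filter (fun y => (nb G y).card ≤ q)

theorem mem_hi {V : Type*} [Fintype V] (G : SimpleGraph V) (q : ℕ) (y : V) :
    y ∈ hi G q ↔ q ≤ (nb G y).card := by simp [hi]

theorem mem_lo {V : Type*} [Fintype V] (G : SimpleGraph V) (q : ℕ) (y : V) :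
    y ∈ lo G q ↔ (nb G y).card ≤ q := by simp [lo]

/-- degree condition -/
def DegC {V : Type*} [Fintype V] (n t : ℕ) (G : SimpleGraph V) : Prop :=
  ∀ q, t ≤ q → 2 * q < n → q ≤ (lo G q).card → q + 1 ≤ (hi G (n - q)).card + t

theorem min_deg {V : Type*} [Fintype V] (G : SimpleGraph V) (t : ℕ) (hT : ToughC t G)
    (x y : V) (hxy : x ≠ y) (h : ¬ G.Adj x y) : 2 * t ≤ (nb G x).card := by
  have := hT {x} (nb G x) y (by simp) (by simpa using hxy.symm) (by simpa [mem_nb] using h)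
    (by intro w hw; simp only [Finset.mem_singleton] at hw; subst hw; simp [mem_nb])
    (by intro w hw; simp only [Finset.mem_singleton] at hw; subst hw; simp [mem_nb])
  simp at this
  omega

/-- if `v` is such that all its nonneighbours have degree at most `m` -/
theorem lo_card {V : Type*} [Fintype V] [DecidableEq V] (G : SimpleGraph V) (n : ℕ)
    (hV : Fintype.card V = n) (v : V) (m : ℕ)
    (h : ∀ w, w ≠ v → ¬ G.Adj v w → (nb G w).card ≤ m) :
    n ≤ (lo G m).card + (nb G v).card + 1 := by
  have : (Finset.univ : Finset V) ⊆ insert v (lo G m ∪ nb G v) := by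
    intro w _
    simp only [Finset.mem_insert, Finset.mem_union, mem_lo, mem_nb]
    by_cases h1 : w = v
    · exact Or.inl h1
    by_cases h2 : G.Adj v w
    · exact Or.inr (Or.inr h2)
    · exact Or.inr (Or.inl (h w h1 h2))
  have h1 := Finset.card_le_card this
  have h2 := Finset.card_insert_le v (lo G m ∪ nb G v)
  have h3 := Finset.card_union_le (lo G m) (nb G v)
  rw [Finset.card_univ, hV] at h1
  omega

theorem hi_card {V : Type*} [Fintype V] [DecidableEq V] (G : SimpleGraph V) (n t k : ℕ)
    (hV : Fintype.card V = n) (hP : DegC n t G) (v : V) (m : ℕ)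
    (h : ∀ w, w ≠ v → ¬ G.Adj v w → (nb G w).card ≤ m)
    (hs : m + (nb G v).card + k + 1 ≤ n) (h2 : 2 * (m + k) < n) (h3 : t ≤ m + k) :
    m + k + 1 ≤ (hi G (n - k - m)).card + t := by
  have h1 := lo_card G n hV v m h
  have h4 : lo G m ⊆ lo G (m + k) := by
    intro w; simp only [mem_lo]; omega
  have h5 := Finset.card_le_card h4
  have := hP (m + k) h3 h2 (by omega)
  rwa [show n - (m + k) = n - k - m by omega] at this

theorem rec_lemma {V : Type*} [Fintype V] [DecidableEq V] (G : SimpleGraph V) (n t k r : ℕ)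
    (hV : Fintype.card V = n) (hP : DegC n t G) (hT : ToughC t G) (hr : r + k + 1 = t)
    (hcl : ∀ x y, x ≠ y → ¬ G.Adj x y → (nb G x).card + (nb G y).card + k + 1 ≤ n) :
    ∀ j, 2 * (j + k) < n → j ≤ (hi G (n - k - j)).card + r →
      ∀ w, (nb G w).card ≤ j → (nb G w \ hi G (n - k - j)).card ≤ r := by
  classical
  intro j
  induction j using Nat.strong_induction_on with
  | _ j ih =>
  intro hj hE
  have base : ∀ w, (nb G w).card ≤ j → (∀ e ∈ hi G (n - k - j), G.Adj w e) →
      (nb G w \ hi G (n - k - j)).card ≤ r := by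
    intro w hw h
    rw [Finset.card_sdiff_of_subset (by intro e he; rw [mem_nb]; exact h e he)]
    omega
  by_cases hall : ∀ x, (nb G x).card ≤ j → ∀ e ∈ hi G (n - k - j), G.Adj x e
  · intro w hw; exact base w hw (hall w hw)
  push Not at hall
  let Bad := Finset.univ.filter (fun x => (nb G x).card ≤ j ∧ ∃ e ∈ hi G (n - k - j), ¬ G.Adj x e)
  have hBne : Bad.Nonempty := by
    obtain ⟨x, hx, e, he, hxe⟩ := hall
    exact ⟨x, by simp only [Bad, Finset.mem_filter, Finset.mem_univ, true_and]
                 exact ⟨hx, e, he, hxe⟩⟩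
  obtain ⟨x, hxB, hmax⟩ := Finset.exists_max_image Bad (fun x => (nb G x).card) hBne
  simp only [Bad, Finset.mem_filter, Finset.mem_univ, true_and] at hxB hmax
  obtain ⟨hxj, e, he, hxe⟩ := hxB
  have he' := he
  rw [mem_hi] at he'
  have hne : x ≠ e := by
    rintro rfl; omega
  have hsum := hcl x e hne hxe
  set m := (nb G x).card with hm
  have hmj : m < j := by omega
  have hmin := min_deg G t hT x e hne hxe
  have hcard := hi_card G n t k hV hP e m (by
    intro w hwe hadj
    by_cases hwj : (nb G w).card ≤ j
    · exact hmax w ⟨hwj, e, he, fun h => hadj h.symm⟩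
    · have := hcl w e hwe (fun h => hadj h.symm)
      omega) (by omega) (by omega) (by omega)
  intro w hw
  by_cases hwm : (nb G w).card ≤ m
  · have h1 := ih m hmj (by omega) (by omega) w hwm
    refine le_trans (Finset.card_le_card ?_) h1
    intro y
    simp only [Finset.mem_sdiff, mem_hi]
    intro ⟨h1, h2⟩
    exact ⟨h1, by omega⟩
  · apply base w hw
    intro f hf
    by_contra hcon
    exact hwm (hmax w ⟨hw, f, hf, hcon⟩)

theorem count_lemma {V : Type*} [Fintype V] [DecidableEq V] (G : SimpleGraph V) (t r : ℕ)
    (hT : ToughC t G) (I E : Finset V) (v : V) (hI : I.Nonempty) (hvI : v ∉ I) (hvE : v ∉ E)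
    (hIE : ∀ w ∈ I, w ∉ E) (hind : ∀ w ∈ I, ∀ w' ∈ I, ¬ G.Adj w w')
    (hIv : ∀ w ∈ I, ¬ G.Adj w v) (hdeg : ∀ w ∈ I, (nb G w \ E).card ≤ r) :
    t * (I.card + 1) ≤ E.card + r * I.card := by
  have h := hT I (E ∪ I.biUnion (fun w => nb G w \ E)) v hI hvI ?_ ?_ ?_
  · refine h.trans ((Finset.card_union_le _ _).trans ?_)
    have := Finset.card_biUnion_le_card_mul I (fun w => nb G w \ E) r hdeg
    rw [mul_comm r]
    omega
  · simp only [Finset.mem_union, Finset.mem_biUnion, Finset.mem_sdiff, mem_nb, not_or, not_exists]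
    refine ⟨hvE, ?_⟩
    rintro w ⟨hw, h1, _⟩
    exact hIv w hw h1
  · intro w' hw'
    simp only [Finset.mem_union, Finset.mem_biUnion, Finset.mem_sdiff, mem_nb, not_or, not_exists]
    refine ⟨hIE w' hw', ?_⟩
    rintro w ⟨hw, h1, _⟩
    exact hind w hw w' hw' h1
  · intro w hw y hy
    simp only [Finset.mem_union, Finset.mem_biUnion, Finset.mem_sdiff, mem_nb]
    by_cases h : y ∈ E
    · exact Or.inl h
    · exact Or.inr ⟨w, hw, hy, h⟩

theorem core_s1 {V : Type*} [Fintype V] [DecidableEq V] (G : SimpleGraph V) (n t : ℕ)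
    (hn : 3 ≤ n) (ht1 : 1 ≤ t) (ht3 : t ≤ 3)
    (hV : Fintype.card V = n) (hP : DegC n t G) (hT : ToughC t G)
    (hno : ¬ ∃ y, HamSeq G n y)
    (hpath : ∀ u v, u ≠ v → ¬ G.Adj u v → ∃ x, PathSeq G n x ∧ x 0 = u ∧ x (n-1) = v)
    (hne : ∃ u v, u ≠ v ∧ ¬ G.Adj u v) : False := by
  classical
  let Q : Finset (V × V) := Finset.univ.filter (fun p => p.1 ≠ p.2 ∧ ¬ G.Adj p.1 p.2)
  have hQ : Q.Nonempty := by
    obtain ⟨u, v, h1, h2⟩ := hne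
    exact ⟨(u, v), by simp [Q, h1, h2]⟩
  obtain ⟨p, hp, hmax⟩ := Finset.exists_max_image Q
    (fun p => (nb G p.1).card + (nb G p.2).card) hQ
  obtain ⟨u, v, huv, hadj, hle, hmax⟩ : ∃ u v, u ≠ v ∧ ¬ G.Adj u v ∧
      (nb G u).card ≤ (nb G v).card ∧ ∀ x y, x ≠ y → ¬ G.Adj x y →
      (nb G x).card + (nb G y).card ≤ (nb G u).card + (nb G v).card := by
    have hm : ∀ x y, x ≠ y → ¬ G.Adj x y →
      (nb G x).card + (nb G y).card ≤ (nb G p.1).card + (nb G p.2).card := by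
      intro x y h1 h2
      exact hmax (x, y) (by simp [Q, h1, h2])
    simp only [Q, Finset.mem_filter, Finset.mem_univ, true_and] at hp
    rcases le_total (nb G p.1).card (nb G p.2).card with h | h
    · exact ⟨p.1, p.2, hp.1, hp.2, h, hm⟩
    · refine ⟨p.2, p.1, hp.1.symm, fun h => hp.2 h.symm, h, ?_⟩
      intro x y h1 h2
      rw [add_comm (nb G p.2).card]
      exact hm x y h1 h2
  obtain ⟨x, hx, hxu, hxv⟩ := hpath u v huv hadj
  obtain ⟨hsum, Y, hY, hYind⟩ := path_structure G n hn hV x hx u v hxu hxv hno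
  have hmin := min_deg G t hT u v huv hadj
  have hdv : ∀ w, w ≠ v → ¬ G.Adj v w → (nb G w).card ≤ (nb G u).card := by
    intro w h1 h2
    have := hmax w v h1 (fun h => h2 h.symm)
    omega
  obtain ⟨i, hi'⟩ : ∃ i, i = (nb G u).card := ⟨_, rfl⟩
  obtain ⟨k', hk'⟩ : ∃ k', k' = n - 1 - ((nb G u).card + (nb G v).card) := ⟨_, rfl⟩
  -- general facts for a given `k`
  have facts : ∀ k r, r + k + 1 = t → k ≤ k' → 2 * (i + k) < n →
      ∃ E : Finset V, i ≤ E.card + r ∧ E.card ≤ i ∧ v ∉ E ∧ (∀ w ∈ E, i < (nb G w).card) ∧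
        (∀ w, w ≠ v → ¬ G.Adj v w → (nb G w \ E).card ≤ r) ∧ E ⊆ nb G u ∩ nb G v := by
    intro k r hr hk h2
    have hc := hi_card G n t k hV hP v i (by rw [hi']; exact hdv) (by omega) h2 (by omega)
    have hsub : ∀ w ∈ hi G (n - k - i), i < (nb G w).card := by
      intro w hw
      rw [mem_hi] at hw
      omega
    have hsu : hi G (n - k - i) ⊆ nb G u := by
      intro w hw
      rw [mem_nb]
      by_contra hcon
      have h3 : u ≠ w := by rintro rfl; have := hsub _ hw; omega
      have := hmax u w h3 hcon
      rw [mem_hi] at hw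
      omega
    have hve : v ∉ hi G (n - k - i) := by
      intro h
      have := hsu h
      rw [mem_nb] at this
      exact hadj this
    have hsv : hi G (n - k - i) ⊆ nb G v := by
      intro w hw
      rw [mem_nb]
      by_contra hcon
      have h3 : v ≠ w := by rintro rfl; exact hve hw
      have := hmax v w h3 hcon
      rw [mem_hi] at hw
      omega
    refine ⟨hi G (n - k - i), by omega, ?_, hve, hsub, ?_, Finset.subset_inter hsu hsv⟩
    · rw [hi']; exact hi' ▸ Finset.card_le_card hsu
    · intro w h3 h4
      refine rec_lemma G n t k r hV hP hT hr ?_ i h2 (by omega) w (by rw [hi']; exact hdv w h3 h4)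
      intro x y h5 h6
      have := hmax x y h5 h6
      omega
  -- the `r = 0` case
  have caseL : ∀ k, k + 1 = t → k ≤ k' → 2 * (i + k) < n → False := by
    intro k hr hk h2
    obtain ⟨E, h3, h4, h5, h6, h7, h8⟩ := facts k 0 (by omega) hk h2
    have hsub : ∀ w, w ≠ v → ¬ G.Adj v w → ∀ y, G.Adj w y → y ∈ E := by
      intro w hw1 hw2 y hy
      have := h7 w hw1 hw2
      by_contra hcon
      have h9 : y ∈ nb G w \ E := by simp [mem_nb, hy, hcon]
      have := Finset.card_pos.2 ⟨y, h9⟩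
      omega
    have hL := count_lemma G t 0 hT (Finset.univ \ insert v (nb G v)) E v
      ⟨u, by simp [mem_nb, huv, G.adj_comm v u, hadj]⟩ (by simp) h5 ?_ ?_ ?_ ?_
    · rw [Finset.card_sdiff_of_subset (Finset.subset_univ _), Finset.card_univ, hV,
        Finset.card_insert_of_notMem (by simp [mem_nb])] at hL
      have : 1 * (n - ((nb G v).card + 1) + 1) ≤ t * (n - ((nb G v).card + 1) + 1) :=
        Nat.mul_le_mul_right _ ht1
      omega
    · intro w hw hwE
      simp only [Finset.mem_sdiff, Finset.mem_univ, true_and, Finset.mem_insert, mem_nb,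
        not_or] at hw
      have := h6 w hwE
      have := hdv w hw.1 hw.2
      omega
    · intro w hw w' hw' h
      simp only [Finset.mem_sdiff, Finset.mem_univ, true_and, Finset.mem_insert, mem_nb,
        not_or] at hw hw'
      have := h6 w' (hsub w hw.1 hw.2 w' h)
      have := hdv w' hw'.1 hw'.2
      omega
    · intro w hw h
      simp only [Finset.mem_sdiff, Finset.mem_univ, true_and, Finset.mem_insert, mem_nb,
        not_or] at hw
      exact hw.2 h.symm
    · intro w hw
      simp only [Finset.mem_sdiff, Finset.mem_univ, true_and, Finset.mem_insert, mem_nb,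
        not_or] at hw
      exact h7 w hw.1 hw.2
  have caseI : ∀ k r, r + k + 1 = t → k ≤ k' → 2 * (i + k) < n →
      ∃ a e, e ≤ a + k' ∧ i ≤ e + r ∧ t * (a + 1) ≤ e + r * a := by
    intro k r hr hk h2
    obtain ⟨E, h3, h4, h5, h6, h7, h8⟩ := facts k r hr hk h2
    let W := ((Finset.univ \ (nb G u ∪ nb G v)) \ {u, v}) \ Y
    have hmW : ∀ w, w ∈ W ↔ (¬ G.Adj u w ∧ ¬ G.Adj v w) ∧ (w ≠ u ∧ w ≠ v) ∧ w ∉ Y := by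
      intro w
      simp [W, mem_nb, and_assoc]
    have hcW : E.card ≤ W.card + 1 + k' := by
      have c1 := Finset.le_card_sdiff Y ((Finset.univ \ (nb G u ∪ nb G v)) \ {u, v})
      have c2 := Finset.le_card_sdiff ({u, v} : Finset V) (Finset.univ \ (nb G u ∪ nb G v))
      have c3 := Finset.card_sdiff_of_subset (Finset.subset_univ (nb G u ∪ nb G v))
      have c4 := Finset.card_union_add_card_inter (nb G u) (nb G v)
      have c5 := Finset.card_le_card h8
      have c6 : ({u, v} : Finset V).card ≤ 2 := Finset.card_le_two
      rw [Finset.card_univ, hV] at c3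
      have c7 : W.card = (((Finset.univ \ (nb G u ∪ nb G v)) \ {u, v}) \ Y).card := rfl
      omega
    have huW : u ∉ W := by rw [hmW]; tauto
    have hIm : ∀ w ∈ insert u W, w ≠ v ∧ ¬ G.Adj v w := by
      intro w hw
      rw [Finset.mem_insert, hmW] at hw
      rcases hw with rfl | hw
      · exact ⟨huv, fun h => hadj h.symm⟩
      · tauto
    refine ⟨(insert u W).card, E.card, ?_, h3, ?_⟩
    · rw [Finset.card_insert_of_notMem huW]; omega
    · refine count_lemma G t r hT (insert u W) E v ⟨u, by simp⟩ ?_ h5 ?_ ?_ ?_ ?_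
      · intro h; exact (hIm v h).1 rfl
      · intro w hw hwE
        have := h6 w hwE
        have := hdv w (hIm w hw).1 (hIm w hw).2
        omega
      · intro w hw w' hw' h
        rw [Finset.mem_insert, hmW] at hw hw'
        rcases hw with rfl | hw
        · rcases hw' with rfl | hw'
          · exact G.loopless.irrefl _ h
          · exact hw'.1.1 h
        · rcases hw' with rfl | hw'
          · exact hw.1.1 h.symm
          · exact hYind w w' hw.2.2 hw'.2.2 hw.2.1.1 hw.2.1.2 hw'.2.1.1 hw'.2.1.2 hw.1.1 hw.1.2
              hw'.1.1 hw'.1.2 h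
      · intro w hw h
        exact (hIm w hw).2 h.symm
      · intro w hw
        exact h7 w (hIm w hw).1 (hIm w hw).2
  interval_cases t
  · exact caseL 0 rfl (by omega) (by omega)
  · by_cases hk : k' ≤ 1
    · obtain ⟨a, e, h1, h2, h3⟩ := caseI 0 1 rfl (by omega) (by omega)
      omega
    · exact caseL 1 rfl (by omega) (by omega)
  · by_cases hk : k' ≤ 2
    · obtain ⟨a, e, h1, h2, h3⟩ := caseI 0 2 rfl (by omega) (by omega)
      omega
    · by_cases h4 : 2 * (i + 2) < n
      · exact caseL 2 rfl (by omega) h4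
      · obtain ⟨a, e, h1, h2, h3⟩ := caseI 1 1 rfl (by omega) (by omega)
        omega

theorem walk_of_seq {V : Type*} (G : SimpleGraph V) (y : ℕ → V) :
    ∀ k, (∀ j, j < k → G.Adj (y j) (y (j+1))) →
      ∃ p : G.Walk (y k) (y 0), p.support = ((List.range (k+1)).map y).reverse ∧ p.length = k := by
  intro k
  induction k with
  | zero => intro _; exact ⟨Walk.nil, by simp, rfl⟩
  | succ k ih =>
    intro h
    obtain ⟨p, hp, hl⟩ := ih (fun j hj => h j (by omega))
    refine ⟨Walk.cons (h k (by omega)).symm p, ?_, by simp [hl]⟩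
    rw [Walk.support_cons, hp, List.range_succ (n := k+1)]
    simp

theorem ham_of_seq {V : Type*} [Fintype V] [DecidableEq V] (G : SimpleGraph V) (n : ℕ)
    (hn : 3 ≤ n) (hV : Fintype.card V = n) (y : ℕ → V) (hy : HamSeq G n y) :
    G.IsHamiltonian := by
  obtain ⟨hinj, hadj, hcl⟩ := hy
  obtain ⟨p, hp, hl⟩ := walk_of_seq G y (n-1) (fun j hj => hadj j (by omega))
  intro _
  have hpath : p.IsPath := by
    rw [Walk.isPath_def, hp, List.nodup_reverse]
    apply List.Nodup.map_on _ List.nodup_range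
    intro a ha b hb h
    simp only [List.mem_range] at ha hb
    exact hinj a b (by omega) (by omega) h
  refine ⟨y 0, Walk.cons hcl.symm p, ?_⟩
  rw [Walk.isHamiltonianCycle_iff_isCycle_and_length_eq]
  constructor
  · rw [Walk.cons_isCycle_iff]
    refine ⟨hpath, ?_⟩
    intro hmem
    have hlen : p.length = 1 := by
      have := hpath.length_eq_one_of_mem_edges (by rwa [Sym2.eq_swap] at hmem)
      exact this
    omega
  · simp [hl, hV]; omega

theorem toughC_of_tough {V : Type*} [Fintype V] (G : SimpleGraph V) (t : ℕ)
    (h : Tough (t : ℝ) G) : ToughC t G := by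
  classical
  intro I S v hI hvI hvS hIS hN
  set H := G.induce ((↑S : Set V)ᶜ) with hH
  have hmem : ∀ w ∈ insert v I, w ∈ ((↑S : Set V)ᶜ) := by
    intro w hw
    rw [Finset.mem_insert] at hw
    rcases hw with rfl | hw
    · simpa using hvS
    · simpa using hIS w hw
  have hiso : ∀ (w z : ((↑S : Set V)ᶜ : Set V)), w.1 ∈ I → H.Reachable w z → w = z := by
    intro w z hw hr
    obtain ⟨p⟩ := hr
    cases p with
    | nil => rfl
    | cons ha q =>
      rename_i b
      have : G.Adj w.1 b.1 := ha
      exact absurd (hN w.1 hw b.1 this) (fun hb => b.2 (Finset.mem_coe.2 hb))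
  let f : {w // w ∈ insert v I} → H.ConnectedComponent :=
    fun w => H.connectedComponentMk ⟨w.1, hmem w.1 w.2⟩
  have hf : Function.Injective f := by
    intro a b hab
    have hr : H.Reachable _ _ := ConnectedComponent.exact hab
    have ha := a.2
    have hb := b.2
    rw [Finset.mem_insert] at ha hb
    apply Subtype.ext
    rcases ha with ha | ha
    · rcases hb with hb | hb
      · rw [ha, hb]
      · have := hiso _ _ hb hr.symm
        exact (Subtype.mk.inj this).symm
    · have := hiso _ _ ha hr
      exact Subtype.mk.inj this
  have hcard : I.card + 1 ≤ Nat.card H.ConnectedComponent := by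
    have := Nat.card_le_card_of_injective f hf
    rwa [Nat.card_eq_fintype_card, Fintype.card_coe, Finset.card_insert_of_notMem hvI] at this
  have hnc : ¬ H.Connected := by
    intro hc
    have : Subsingleton H.ConnectedComponent := hc.preconnected.subsingleton_connectedComponent
    have h1 := Finite.card_le_one_iff_subsingleton.2 this
    have := Finset.card_pos.2 hI
    omega
  have h1 := h S hnc
  have h2 : t * Nat.card H.ConnectedComponent ≤ S.card := by exact_mod_cast h1
  exact (Nat.mul_le_mul_left t hcard).trans h2

theorem toughC_mono {V : Type*} [Fintype V] (G G' : SimpleGraph V) (t : ℕ) (hle : G ≤ G')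
    (h : ToughC t G) : ToughC t G' := by
  intro I S v hI hvI hvS hIS hN
  exact h I S v hI hvI hvS hIS (fun w hw y hy => hN w hw y (hle hy))

theorem degC_mono {V : Type*} [Fintype V] (G G' : SimpleGraph V) (n t : ℕ) (hle : G ≤ G')
    (h : DegC n t G) : DegC n t G' := by
  have hd : ∀ w, (nb G w).card ≤ (nb G' w).card := by
    intro w
    apply Finset.card_le_card
    intro y
    simp only [mem_nb]
    exact fun hy => hle hy
  intro q h1 h2 h3
  have h4 : (lo G' q).card ≤ (lo G q).card := Finset.card_le_card (by
    intro w; simp only [mem_lo]; have := hd w; omega)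
  have h5 : (hi G (n-q)).card ≤ (hi G' (n-q)).card := Finset.card_le_card (by
    intro w; simp only [mem_hi]; have := hd w; omega)
  have := h q h1 h2 (by omega)
  omega

theorem path_of_max {V : Type*} (G : SimpleGraph V) (n : ℕ) (hn : 3 ≤ n)
    (hno : ¬ ∃ y, HamSeq G n y) (u v : V)
    (hex : ∃ y, HamSeq (G ⊔ edge u v) n y) :
    ∃ x, PathSeq G n x ∧ x 0 = u ∧ x (n-1) = v := by
  obtain ⟨z, hinj, hadj, hcl⟩ := hex
  have hrev : (∃ x, PathSeq G n x ∧ x 0 = v ∧ x (n-1) = u) →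
      ∃ x, PathSeq G n x ∧ x 0 = u ∧ x (n-1) = v := by
    rintro ⟨x, ⟨h1, h2⟩, h3, h4⟩
    refine ⟨fun j => x (n - 1 - j), ⟨?_, ?_⟩, by simpa using h4, by simpa using h3⟩
    · intro a b ha hb h
      have := h1 _ _ (by omega) (by omega) h
      omega
    · intro j hj
      have := h2 (n - 1 - (j+1)) (by omega)
      rw [show n - 1 - (j+1) + 1 = n - 1 - j by omega] at this
      exact this.symm
  have hE : ∀ a b, (G ⊔ edge u v).Adj a b → ¬ G.Adj a b → (a = u ∧ b = v) ∨ (a = v ∧ b = u) := by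
    intro a b h1 h2
    rw [sup_adj, edge_adj] at h1
    tauto
  by_cases hlast : G.Adj (z (n-1)) (z 0)
  · obtain ⟨j, hj, hnj⟩ : ∃ j, j + 1 < n ∧ ¬ G.Adj (z j) (z (j+1)) := by
      by_contra hcon
      push Not at hcon
      exact hno ⟨z, hinj, hcon, hlast⟩
    have huniq : ∀ k, k + 1 < n → k ≠ j → G.Adj (z k) (z (k+1)) := by
      intro k hk hkj
      by_contra hcon
      have e1 := hE _ _ (hadj j hj) hnj
      have e2 := hE _ _ (hadj k hk) hcon
      rcases e1 with ⟨e1, e1'⟩ | ⟨e1, e1'⟩ <;> rcases e2 with ⟨e2, e2'⟩ | ⟨e2, e2'⟩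
      · exact hkj (hinj k j (by omega) (by omega) (e2.trans e1.symm))
      · have := hinj k (j+1) (by omega) (by omega) (e2.trans e1'.symm)
        have := hinj (k+1) j (by omega) (by omega) (e2'.trans e1.symm)
        omega
      · have := hinj k (j+1) (by omega) (by omega) (e2.trans e1'.symm)
        have := hinj (k+1) j (by omega) (by omega) (e2'.trans e1.symm)
        omega
      · exact hkj (hinj k j (by omega) (by omega) (e2.trans e1.symm))
    have hP : ∃ x, PathSeq G n x ∧ x 0 = z (j+1) ∧ x (n-1) = z j := by
      refine ⟨fun k => if k + (j+1) < n then z (k + (j+1)) else z (k + (j+1) - n), ⟨?_, ?_⟩, ?_, ?_⟩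
      · intro a b ha hb h
        simp only at h
        split_ifs at h <;> have := hinj _ _ (by omega) (by omega) h <;> omega
      · intro k hk
        simp only
        by_cases h1 : k + 1 + (j+1) < n
        · rw [if_pos (by omega), if_pos h1, show k + 1 + (j+1) = k + (j+1) + 1 by omega]
          exact huniq _ (by omega) (by omega)
        · by_cases h2 : k + (j+1) < n
          · rw [if_pos h2, if_neg h1, show k + (j+1) = n - 1 by omega,
              show k + 1 + (j+1) - n = 0 by omega]
            exact hlast
          · rw [if_neg h2, if_neg h1,
              show k + 1 + (j+1) - n = k + (j+1) - n + 1 by omega]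
            exact huniq _ (by omega) (by omega)
      · simp only
        rw [if_pos (by omega), zero_add]
      · simp only
        rw [if_neg (by omega), show n - 1 + (j+1) - n = j by omega]
    rcases hE _ _ (hadj j hj) hnj with ⟨e1, e2⟩ | ⟨e1, e2⟩
    · rw [e1, e2] at hP; exact hrev hP
    · rw [e1, e2] at hP; exact hP
  · have e0 := hE _ _ hcl hlast
    have hP : PathSeq G n z := by
      refine ⟨hinj, ?_⟩
      intro k hk
      by_contra hcon
      have e2 := hE _ _ (hadj k hk) hcon
      rcases e0 with ⟨e1, e1'⟩ | ⟨e1, e1'⟩ <;> rcases e2 with ⟨e2, e2'⟩ | ⟨e2, e2'⟩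
      · have := hinj k (n-1) (by omega) (by omega) (e2.trans e1.symm)
        omega
      · have := hinj k 0 (by omega) (by omega) (e2.trans e1'.symm)
        have := hinj (k+1) (n-1) (by omega) (by omega) (e2'.trans e1.symm)
        omega
      · have := hinj k 0 (by omega) (by omega) (e2.trans e1'.symm)
        have := hinj (k+1) (n-1) (by omega) (by omega) (e2'.trans e1.symm)
        omega
      · have := hinj k (n-1) (by omega) (by omega) (e2.trans e1.symm)
        omega
    rcases e0 with ⟨e1, e2⟩ | ⟨e1, e2⟩
    · exact hrev ⟨z, hP, e2, e1⟩
    · exact ⟨z, hP, e2, e1⟩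

theorem main_thm {V : Type*} [Fintype V] [DecidableEq V] (G : SimpleGraph V) (n t : ℕ)
    (hn : 3 ≤ n) (ht1 : 1 ≤ t) (ht3 : t ≤ 3)
    (hV : Fintype.card V = n) (hP : DegC n t G) (hT : ToughC t G) (v : ℕ → V)
    (hv : ∀ a b, a < n → b < n → v a = v b → a = b) : G.IsHamiltonian := by
  classical
  by_contra hnH
  have hno : ¬ ∃ y, HamSeq G n y := by
    rintro ⟨y, hy⟩; exact hnH (ham_of_seq G n hn hV y hy)
  let F : Set (SimpleGraph V) := {K | ¬ ∃ y, HamSeq K n y}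
  obtain ⟨K, hGK, hK⟩ := (Set.toFinite F).exists_le_maximal (a := G) hno
  have hKno : ¬ ∃ y, HamSeq K n y := hK.1
  refine core_s1 K n t hn ht1 ht3 hV (degC_mono G K n t hGK hP) (toughC_mono G K t hGK hT) hKno ?_ ?_
  · intro a b hab hadj
    apply path_of_max K n hn hKno a b
    by_contra hcon
    have h1 : K ⊔ edge a b ≤ K := hK.2 (show (K ⊔ edge a b) ∈ F from hcon) le_sup_left
    apply hadj
    apply h1
    rw [sup_adj, edge_adj]
    exact Or.inr ⟨Or.inl ⟨rfl, rfl⟩, hab⟩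
  · by_contra hcon
    push Not at hcon
    apply hKno
    refine ⟨v, hv, ?_, ?_⟩
    · intro j hj
      apply hcon
      intro h
      have := hv _ _ (by omega) hj h
      omega
    · apply hcon
      intro h
      have := hv _ _ (by omega) (by omega) h
      omega

end HamTough

/-- For every integer `t` with `1 ≤ t ≤ 3`: if `G` is a `t`-tough graph on `n ≥ 3`
vertices whose degree sequence `d_1 ≤ d_2 ≤ … ≤ d_n` satisfies: for every index
`i < n/2`, if `d_i ≤ i` then `d_{n-i+t} ≥ n-i`, then `G` is Hamiltonian. -/
theorem stmt_1 {V : Type*} [Fintype V] [DecidableEq V] {n : ℕ} (hn : 3 ≤ n)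
    (t : ℕ) (ht1 : 1 ≤ t) (ht3 : t ≤ 3)
    (G : SimpleGraph V) [DecidableRel G.Adj]
    (v : ℕ → V)
    (hinj : ∀ i j, 1 ≤ i → i ≤ n → 1 ≤ j → j ≤ n → v i = v j → i = j)
    (hsurj : ∀ w : V, ∃ i, 1 ≤ i ∧ i ≤ n ∧ v i = w)
    (hmono : ∀ i j, 1 ≤ i → i ≤ j → j ≤ n → G.degree (v i) ≤ G.degree (v j))
    (htough : Tough (t : ℝ) G)
    (hP : ∀ i, 1 ≤ i → 2 * i < n → t ≤ i → G.degree (v i) ≤ i →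
      n - i ≤ G.degree (v (n - i + t))) :
    G.IsHamiltonian := by
  classical
  have hcardV : Fintype.card V = n := by
    have himg : (Finset.Icc 1 n).image v = Finset.univ := by
      ext w
      simp only [Finset.mem_image, Finset.mem_Icc, Finset.mem_univ, iff_true]
      obtain ⟨i, h1, h2, h3⟩ := hsurj w
      exact ⟨i, ⟨h1, h2⟩, h3⟩
    rw [← Finset.card_univ, ← himg, Finset.card_image_of_injOn]
    · simp
    · intro a ha b hb h
      simp only [Finset.coe_Icc, Set.mem_Icc] at ha hb
      exact hinj a b ha.1 ha.2 hb.1 hb.2 h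
  have hdeg : ∀ w, (nb G w).card = G.degree w := by
    intro w
    rw [← G.card_neighborFinset_eq_degree]
    congr 1
    ext y
    simp [mem_nb]
  refine main_thm G n t hn ht1 ht3 hcardV ?_ (toughC_of_tough G t htough) (fun j => v (j+1)) ?_
  · intro q hq1 hq2 hq3
    have hdq : G.degree (v q) ≤ q := by
      by_contra hcon
      push Not at hcon
      have hsub : lo G q ⊆ (Finset.Ico 1 q).image v := by
        intro w hw
        rw [mem_lo, hdeg] at hw
        obtain ⟨j, h1, h2, rfl⟩ := hsurj w
        refine Finset.mem_image.2 ⟨j, ?_, rfl⟩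
        rw [Finset.mem_Ico]
        refine ⟨h1, ?_⟩
        by_contra hjq
        have := hmono q j (by omega) (by omega) h2
        omega
      have h1 := (Finset.card_le_card hsub).trans Finset.card_image_le
      rw [Nat.card_Ico] at h1
      omega
    have h1 := hP q (by omega) hq2 hq1 hdq
    have hsub : (Finset.Icc (n - q + t) n).image v ⊆ hi G (n - q) := by
      intro w hw
      obtain ⟨j, hj, rfl⟩ := Finset.mem_image.1 hw
      rw [Finset.mem_Icc] at hj
      rw [mem_hi, hdeg]
      exact h1.trans (hmono _ _ (by omega) hj.1 hj.2)
    have h2 := Finset.card_le_card hsub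
    rw [Finset.card_image_of_injOn, Nat.card_Icc] at h2
    · omega
    · intro a ha b hb h
      simp only [Finset.coe_Icc, Set.mem_Icc] at ha hb
      exact hinj a b (by omega) ha.2 (by omega) hb.2 h
  · intro a b ha hb h
    have := hinj _ _ (by omega) (by omega) (by omega) (by omega) h
    omega
end

section
/- For every integer t ≥ 2, a (3t−1)/2-tough graph G on n ≥ 3 vertices is Hamiltonian if and only if its t-closure G^{*t} is Hamiltonian. -/
open SimpleGraph

/-- A graph is `t`-closed if it has no pair of distinct non-adjacent vertices whose
degree sum is at least `n - t`, i.e. the `t`-closure operation can add no edge. -/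
def IsTClosed {V : Type*} [Fintype V] (t : ℕ) (H : SimpleGraph V) : Prop :=
  ∀ u v : V, u ≠ v → ¬ H.Adj u v →
    (H.neighborSet u).ncard + (H.neighborSet v).ncard < Fintype.card V - t

/-- The `t`-closure of `G`: the graph obtained from `G` by repeatedly adding an edge
between two non-adjacent vertices whose current degree sum is at least `n - t`, until
no such pair remains. Equivalently, it is the smallest `t`-closed supergraph of `G`. -/
def tClosure {V : Type*} [Fintype V] (t : ℕ) (G : SimpleGraph V) : SimpleGraph V :=
  sInf {H | G ≤ H ∧ IsTClosed t H}


lemma ham_of_fun {V : Type*} [Fintype V] [DecidableEq V] (G : SimpleGraph V) (N : ℕ) (hN : 2 ≤ N)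
    (hc : Fintype.card V = N + 1) (c : ℕ → V) (hs : ∀ x, ∃ k, k ≤ N ∧ c k = x)
    (ha : ∀ k, k < N → G.Adj (c k) (c (k + 1))) (hl : G.Adj (c N) (c 0)) : G.IsHamiltonian := by
  intro _
  obtain ⟨m, rfl⟩ : ∃ m, N = m + 2 := ⟨N - 2, by omega⟩
  have key : ∀ a b : Fin (m + 3), b - a = 1 → G.Adj (c a.val) (c b.val) := by
    intro a b hab
    have hb : b = a + 1 := by rw [← hab]; abel
    subst hb
    rw [Fin.val_add_one]
    split_ifs with h
    · subst h; simpa using hl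
    · apply ha
      have := a.is_lt
      have h2 : a.val ≠ m + 2 := fun h' => h (Fin.ext (by simpa using h'))
      omega
  let f : cycleGraph (m + 3) →g G :=
    { toFun := fun i => c i.val
      map_rel' := by
        intro a b hab
        rw [cycleGraph_adj] at hab
        rcases hab with hab | hab
        · exact (key _ _ hab).symm
        · exact key _ _ hab }
  have hsurj : Function.Surjective f := by
    intro x
    obtain ⟨k, hk, rfl⟩ := hs x
    exact ⟨⟨k, by omega⟩, rfl⟩
  have hbij : Function.Bijective f := by
    rw [Fintype.bijective_iff_surjective_and_card]
    exact ⟨hsurj, by simp [hc]⟩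
  refine ⟨_, _, Walk.IsHamiltonianCycle.map (f := f) (p := cycleGraph.cycle m) hbij ?_⟩
  rw [Walk.isHamiltonianCycle_iff_isCycle_and_length_eq]
  exact ⟨cycleGraph.isCycle_cycle, by simp [cycleGraph.length_cycle]⟩

structure HP {V : Type*} [Fintype V] [DecidableEq V] (H : SimpleGraph V) (N : ℕ) (v : ℕ → V) :
    Prop where
  hN : 2 ≤ N
  card : Fintype.card V = N + 1
  inj : ∀ i j, i ≤ N → j ≤ N → v i = v j → i = j
  surj : ∀ x, ∃ k, k ≤ N ∧ v k = x
  adj : ∀ k, k < N → H.Adj (v k) (v (k + 1))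
  nham : ¬ H.IsHamiltonian

section
variable {V : Type*} [Fintype V] [DecidableEq V] {H : SimpleGraph V} {N : ℕ} {v : ℕ → V}

lemma HP.no_cycle (h : HP H N v) (σ : ℕ → ℕ) (a1 b1 a2 b2 a3 b3 a4 b4 : ℕ)
    (h1 : H.Adj (v a1) (v b1)) (h2 : H.Adj (v a2) (v b2)) (h3 : H.Adj (v a3) (v b3))
    (h4 : H.Adj (v a4) (v b4))
    (hs : ∀ m, m ≤ N → ∃ k, k ≤ N ∧ σ k = m)
    (ha : ∀ k, k < N → (σ (k+1) = σ k + 1 ∧ σ (k+1) ≤ N) ∨ (σ k = σ (k+1) + 1 ∧ σ k ≤ N) ∨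
      (σ k = a1 ∧ σ (k+1) = b1) ∨ (σ k = a2 ∧ σ (k+1) = b2) ∨ (σ k = a3 ∧ σ (k+1) = b3) ∨
      (σ k = a4 ∧ σ (k+1) = b4))
    (hl : (σ N = a1 ∧ σ 0 = b1) ∨ (σ N = a2 ∧ σ 0 = b2)) : False := by
  apply h.nham
  refine ham_of_fun H N h.hN h.card (fun k => v (σ k)) ?_ ?_ ?_
  · intro x
    obtain ⟨m, hm, rfl⟩ := h.surj x
    obtain ⟨k, hk, rfl⟩ := hs m hm
    exact ⟨k, hk, rfl⟩
  · intro k hk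
    rcases ha k hk with ⟨e, l⟩ | ⟨e, l⟩ | ⟨e, l⟩ | ⟨e, l⟩ | ⟨e, l⟩ | ⟨e, l⟩
    · simp only [e]; exact h.adj _ (by omega)
    · simp only [e]; exact (h.adj _ (by omega)).symm
    all_goals simp only [e, l]; assumption
  · rcases hl with ⟨e, l⟩ | ⟨e, l⟩ <;> simp only [e, l] <;> assumption

/-- first label -/
def LX (H : SimpleGraph V) (N : ℕ) (v : ℕ → V) (i : ℕ) : Prop := i < N ∧ H.Adj (v 0) (v (i + 1))
/-- second label -/
def LY (H : SimpleGraph V) (N : ℕ) (v : ℕ → V) (i : ℕ) : Prop := i < N ∧ H.Adj (v N) (v i)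

lemma HP.r0 (h : HP H N v) (i : ℕ) (hx : LX H N v i) (hy : LY H N v i) : False := by
  obtain ⟨hi, hx⟩ := hx
  obtain ⟨_, hy⟩ := hy
  refine h.no_cycle (fun k => if k ≤ i then k else N + i + 1 - k) (i+1) 0 i N i N i N hx.symm
    hy.symm hy.symm hy.symm ?_ ?_ ?_
  · intro m hm
    by_cases h1 : m ≤ i
    · exact ⟨m, hm, by simp [h1]⟩
    · refine ⟨N + i + 1 - m, by omega, ?_⟩
      split_ifs <;> omega
  · intro k hk
    split_ifs <;> omega
  · split_ifs <;> omega

lemma HP.r1 (h : HP H N v) (i j : ℕ) (hij : i < j) (hx : LX H N v i) (hy : LY H N v j)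
    (ha : H.Adj (v i) (v (j + 1))) : False := by
  obtain ⟨hi, hx⟩ := hx
  obtain ⟨hj, hy⟩ := hy
  refine h.no_cycle (fun k => if k ≤ i then i - k else if k ≤ j then k else N + j + 1 - k)
    (j+1) i 0 (i+1) j N j N ha.symm hx hy.symm hy.symm ?_ ?_ ?_
  · intro m hm
    by_cases h1 : m ≤ i
    · refine ⟨i - m, by omega, ?_⟩
      split_ifs <;> omega
    · by_cases h2 : m ≤ j
      · refine ⟨m, by omega, ?_⟩
        split_ifs <;> omega
      · refine ⟨N + j + 1 - m, by omega, ?_⟩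
        split_ifs <;> omega
  · intro k hk
    split_ifs <;> omega
  · split_ifs <;> omega

lemma HP.r2 (h : HP H N v) (j i : ℕ) (hij : j + 1 ≤ i) (hx : LX H N v i) (hy : LY H N v (j + 1))
    (ha : H.Adj (v j) (v i)) : False := by
  obtain ⟨hi, hx⟩ := hx
  obtain ⟨hj, hy⟩ := hy
  refine h.no_cycle (fun k => if k ≤ j then k else if k ≤ i then i + j + 1 - k else N + i + 1 - k)
    (i+1) 0 j i (j+1) N (j+1) N hx.symm ha hy.symm hy.symm ?_ ?_ ?_
  · intro m hm
    by_cases h1 : m ≤ j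
    · refine ⟨m, by omega, ?_⟩
      split_ifs <;> omega
    · by_cases h2 : m ≤ i
      · refine ⟨i + j + 1 - m, by omega, ?_⟩
        split_ifs <;> omega
      · refine ⟨N + i + 1 - m, by omega, ?_⟩
        split_ifs <;> omega
  · intro k hk
    split_ifs <;> omega
  · split_ifs <;> omega

lemma HP.r3 (h : HP H N v) (q j : ℕ) (hij : q ≤ j) (hjN : j + 2 ≤ N) (hx : LX H N v j)
    (hy : LY H N v q)
    (ha : H.Adj (v (q + 1)) (v (j + 2))) : False := by
  obtain ⟨hi, hx⟩ := hx
  obtain ⟨hj, hy⟩ := hy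
  refine h.no_cycle (fun k => if k ≤ q then k else if k + j + 1 ≤ N + q then N + q + 1 - k
      else k + j + 1 - N)
    (j+1) 0 q N (j+2) (q+1) q N hx.symm hy.symm ha.symm hy.symm ?_ ?_ ?_
  · intro m hm
    by_cases h1 : m ≤ q
    · refine ⟨m, by omega, ?_⟩
      split_ifs <;> omega
    · by_cases h2 : m ≤ j + 1
      · refine ⟨m + N - j - 1, by omega, ?_⟩
        split_ifs <;> omega
      · refine ⟨N + q + 1 - m, by omega, ?_⟩
        split_ifs <;> omega
  · intro k hk
    split_ifs <;> omega
  · split_ifs <;> omega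

lemma HP.r4a (h : HP H N v) (q j : ℕ) (hij : q + 1 < j) (hjN : j + 1 ≤ N) (hx : LX H N v (q + 1))
    (hy : LY H N v q) (ha : H.Adj (v (q + 1)) (v j))
    (hb : H.Adj (v (q + 1)) (v (j + 1))) : False := by
  obtain ⟨hi, hx⟩ := hx
  obtain ⟨hj, hy⟩ := hy
  refine h.no_cycle (fun k => if k ≤ q then k else if k + j ≤ N + q then N + q + 1 - k
      else if k + j = N + q + 1 then q + 1 else N + q + 2 - k)
    (q+2) 0 q N (j+1) (q+1) (q+1) j hx.symm hy.symm hb.symm ha ?_ ?_ ?_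
  · intro m hm
    by_cases h1 : m ≤ q
    · refine ⟨m, by omega, ?_⟩
      split_ifs <;> omega
    · by_cases h2 : m = q + 1
      · refine ⟨N + q + 1 - j, by omega, ?_⟩
        split_ifs <;> omega
      · by_cases h3 : m ≤ j
        · refine ⟨N + q + 2 - m, by omega, ?_⟩
          split_ifs <;> omega
        · refine ⟨N + q + 1 - m, by omega, ?_⟩
          split_ifs <;> omega
  · intro k hk
    split_ifs <;> omega
  · split_ifs <;> omega

lemma HP.r4b (h : HP H N v) (q j : ℕ) (hij : j < q) (hx : LX H N v (q + 1))
    (hy : LY H N v q) (ha : H.Adj (v (q + 1)) (v j))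
    (hb : H.Adj (v (q + 1)) (v (j + 1))) : False := by
  obtain ⟨hi, hx⟩ := hx
  obtain ⟨hj, hy⟩ := hy
  refine h.no_cycle (fun k => if k ≤ j then k else if k = j + 1 then q + 1 else
      if k ≤ q + 1 then k - 1 else N + q + 2 - k)
    (q+2) 0 q N j (q+1) (q+1) (j+1) hx.symm hy.symm ha.symm hb ?_ ?_ ?_
  · intro m hm
    by_cases h1 : m ≤ j
    · refine ⟨m, by omega, ?_⟩
      split_ifs <;> omega
    · by_cases h2 : m = q + 1
      · refine ⟨j + 1, by omega, ?_⟩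
        split_ifs <;> omega
      · by_cases h3 : m ≤ q
        · refine ⟨m + 1, by omega, ?_⟩
          split_ifs <;> omega
        · refine ⟨N + q + 2 - m, by omega, ?_⟩
          split_ifs <;> omega
  · intro k hk
    split_ifs <;> omega
  · split_ifs <;> omega

end

lemma tough_label {V α : Type*} [Fintype V] {τ : ℝ} (hτ : 0 ≤ τ) {G : SimpleGraph V}
    (hG : Tough τ G) (S : Finset V) (φ : V → α)
    (hφ : ∀ x y, x ∉ S → y ∉ S → G.Adj x y → φ x = φ y) (T : Finset V) (hTS : ∀ x ∈ T, x ∉ S)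
    (hT : ∀ x ∈ T, ∀ y ∈ T, φ x = φ y → x = y) (h2 : 2 ≤ T.card) : τ * T.card ≤ S.card := by
  have hreach : ∀ x y : ((↑S : Set V)ᶜ : Set V), (G.induce ((↑S : Set V)ᶜ)).Reachable x y →
      φ x = φ y := by
    rintro x y ⟨p⟩
    induction p with
    | nil => rfl
    | cons hadj p ih =>
      rw [← ih]
      rename_i a b c
      exact hφ _ _ (fun hh => a.2 (by simpa using hh)) (fun hh => b.2 (by simpa using hh)) (by simpa using hadj)
  have hnc : ¬ (G.induce ((↑S : Set V)ᶜ)).Connected := by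
    intro hc
    obtain ⟨x, hx, y, hy, hxy⟩ := Finset.one_lt_card.mp (show 1 < T.card by omega)
    exact hxy (hT x hx y hy (hreach ⟨x, by simpa using hTS x hx⟩ ⟨y, by simpa using hTS y hy⟩
      (hc.preconnected _ _)))
  refine le_trans ?_ (hG S hnc)
  apply mul_le_mul_of_nonneg_left _ hτ
  norm_cast
  have : Nat.card T ≤ Nat.card (G.induce ((↑S : Set V)ᶜ)).ConnectedComponent := by
    apply Nat.card_le_card_of_injective
      (fun x : T => (G.induce ((↑S : Set V)ᶜ)).connectedComponentMk
        ⟨x.1, by simpa using hTS x.1 x.2⟩)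
    intro x y hxy
    have := hreach _ _ (ConnectedComponent.exact hxy)
    exact Subtype.ext (hT _ x.2 _ y.2 this)
  simpa using this

section
variable {V : Type*} [Fintype V] [DecidableEq V] {G H : SimpleGraph V} {N : ℕ} {v : ℕ → V}

lemma HP.tough (h : HP H N v) {τ : ℝ} (hτ : 0 ≤ τ) (hG : Tough τ G) (hGH : G ≤ H)
    (I : Finset ℕ) (φ : ℕ → ℕ)
    (hφ : ∀ i j, i < j → j ≤ N → i ∉ I → j ∉ I → H.Adj (v i) (v j) → φ i = φ j)
    (T : Finset ℕ) (hTN : ∀ i ∈ T, i ≤ N) (hTI : ∀ i ∈ T, i ∉ I)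
    (hT : ∀ i ∈ T, ∀ j ∈ T, φ i = φ j → i = j) (h2 : 2 ≤ T.card) : τ * T.card ≤ I.card := by
  choose idx hidx hv using h.surj
  have hiv : ∀ i, i ≤ N → idx (v i) = i := fun i hi => h.inj _ _ (hidx _) hi (hv _)
  have hcT : (T.image v).card = T.card :=
    Finset.card_image_of_injOn fun i hi j hj hij => h.inj i j (hTN i hi) (hTN j hj) hij
  have hmem : ∀ x, x ∉ I.image v → idx x ∉ I := fun x hx hI =>
    hx (Finset.mem_image.mpr ⟨_, hI, hv x⟩)
  have := tough_label hτ hG ((I.filter (· ≤ N)).image v) (fun x => φ (idx x)) ?_ (T.image v) ?_ ?_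
    (by rw [hcT]; exact h2)
  · rw [hcT] at this
    refine this.trans ?_
    norm_cast
    exact Finset.card_image_le.trans (Finset.card_filter_le _ _)
  · intro x y hx hy hxy
    have hx' : idx x ∉ I := fun hI => hx (Finset.mem_image.mpr ⟨_, by simp [hI, hidx], hv x⟩)
    have hy' : idx y ∉ I := fun hI => hy (Finset.mem_image.mpr ⟨_, by simp [hI, hidx], hv y⟩)
    have hadj : H.Adj (v (idx x)) (v (idx y)) := by rw [hv, hv]; exact hGH hxy
    rcases lt_trichotomy (idx x) (idx y) with hl | hl | hl
    · exact hφ _ _ hl (hidx _) hx' hy' hadj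
    · rw [hl]
    · exact (hφ _ _ hl (hidx _) hy' hx' hadj.symm).symm
  · intro x hx hxI
    obtain ⟨i, hi, rfl⟩ := Finset.mem_image.mp hx
    obtain ⟨j, hj, hji⟩ := Finset.mem_image.mp hxI
    simp only [Finset.mem_filter] at hj
    have := h.inj _ _ hj.2 (hTN i hi) hji
    subst this
    exact hTI _ hi hj.1
  · intro x hx y hy hxy
    obtain ⟨i, hi, rfl⟩ := Finset.mem_image.mp hx
    obtain ⟨j, hj, rfl⟩ := Finset.mem_image.mp hy
    rw [hiv i (hTN i hi), hiv j (hTN j hj)] at hxy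
    rw [hT i hi j hj hxy]

open Classical in
/-- unlabelled indices -/
noncomputable def LD (H : SimpleGraph V) (N : ℕ) (v : ℕ → V) : Finset ℕ :=
  (Finset.range N).filter fun i => ¬ LX H N v i ∧ ¬ LY H N v i

lemma mem_LD {i : ℕ} : i ∈ LD H N v ↔ i < N ∧ ¬ LX H N v i ∧ ¬ LY H N v i := by
  classical
  simp [LD]

lemma HP.card_LD (h : HP H N v) {t : ℕ} (hna : ¬ H.Adj (v 0) (v N))
    (hd : N + 1 ≤ t + (H.neighborSet (v 0)).ncard + (H.neighborSet (v N)).ncard) :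
    (LD H N v).card + 1 ≤ t := by
  classical
  let XS := (Finset.range N).filter fun i => LX H N v i
  let YS := (Finset.range N).filter fun i => LY H N v i
  have hX : (H.neighborSet (v 0)).ncard ≤ XS.card := by
    have : H.neighborSet (v 0) ⊆ ↑(XS.image fun i => v (i + 1)) := by
      intro x hx
      obtain ⟨k, hk, rfl⟩ := h.surj x
      have hx : H.Adj (v 0) (v k) := hx
      rcases k with _ | k
      · exact absurd hx (H.irrefl)
      · simp only [Finset.coe_image, Set.mem_image]
        exact ⟨k, by simp only [XS, Finset.coe_filter, Finset.mem_range, Set.mem_ofPred_eq]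
                     exact ⟨by omega, by omega, hx⟩, rfl⟩
    calc _ ≤ (↑(XS.image fun i => v (i + 1)) : Set V).ncard := Set.ncard_le_ncard this
      _ = _ := Set.ncard_coe_finset _
      _ ≤ _ := Finset.card_image_le
  have hY : (H.neighborSet (v N)).ncard ≤ YS.card := by
    have : H.neighborSet (v N) ⊆ ↑(YS.image fun i => v i) := by
      intro x hx
      obtain ⟨k, hk, rfl⟩ := h.surj x
      have hx : H.Adj (v N) (v k) := hx
      have hkN : k ≠ N := by rintro rfl; exact H.irrefl hx
      simp only [Finset.coe_image, Set.mem_image]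
      exact ⟨k, by simp only [YS, Finset.coe_filter, Finset.mem_range, Set.mem_ofPred_eq]
                   exact ⟨by omega, by omega, hx⟩, rfl⟩
    calc _ ≤ (↑(YS.image fun i => v i) : Set V).ncard := Set.ncard_le_ncard this
      _ = _ := Set.ncard_coe_finset _
      _ ≤ _ := Finset.card_image_le
  have hXY : Disjoint XS YS := by
    rw [Finset.disjoint_left]
    intro i hi hj
    simp only [XS, YS, Finset.mem_filter] at hi hj
    exact h.r0 i hi.2 hj.2
  have hD : Disjoint (XS ∪ YS) (LD H N v) := by
    rw [Finset.disjoint_left]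
    intro i hi hj
    rw [mem_LD] at hj
    simp only [XS, YS, Finset.mem_union, Finset.mem_filter] at hi
    tauto
  have hsub : (XS ∪ YS) ∪ LD H N v ⊆ Finset.range N := by
    intro i hi
    simp only [XS, YS, Finset.mem_union, Finset.mem_filter, mem_LD] at hi
    simp only [Finset.mem_range] at *
    tauto
  have := Finset.card_le_card hsub
  rw [Finset.card_union_of_disjoint hD, Finset.card_union_of_disjoint hXY, Finset.card_range] at this
  omega

lemma HP.tri (h : HP H N v) (i : ℕ) (hi : i < N) : LX H N v i ∨ LY H N v i ∨ i ∈ LD H N v := by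
  rw [mem_LD]; tauto

lemma HP.lx0 (h : HP H N v) : LX H N v 0 := ⟨by have := h.hN; omega, h.adj 0 (by have := h.hN; omega)⟩

lemma HP.noW (h : HP H N v) {t : ℕ} (ht : 2 ≤ t) (hG : Tough ((3 * t - 1 : ℝ) / 2) G) (hGH : G ≤ H)
    (hD : (LD H N v).card + 1 ≤ t)
    (hW : ∀ q, LY H N v q → LX H N v (q + 1) → False) : False := by
  classical
  have hN := h.hN
  let Ys : ℕ → Finset ℕ := fun k => (Finset.range k).filter fun i =>
    1 ≤ i ∧ LY H N v i ∧ ¬ LY H N v (i - 1)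
  have hYs : ∀ k, k ≤ N → (Ys k).card + (if 1 ≤ k ∧ LY H N v (k - 1) then 0 else 1) ≤
      ((LD H N v).filter (· < k)).card + 1 := by
    intro k
    induction k with
    | zero => intro _; simp [Ys]
    | succ k ih =>
      intro hk
      have ih := ih (by omega)
      have e1 : Ys (k + 1) = if 1 ≤ k ∧ LY H N v k ∧ ¬ LY H N v (k - 1) then insert k (Ys k)
          else Ys k := by
        simp only [Ys, Finset.range_add_one, Finset.filter_insert]
      have e2 : (Ys (k + 1)).card = (Ys k).card +
          if 1 ≤ k ∧ LY H N v k ∧ ¬ LY H N v (k - 1) then 1 else 0 := by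
        rw [e1]; split_ifs
        · rw [Finset.card_insert_of_notMem (by simp [Ys])]
        · rfl
      have e3 : ((LD H N v).filter (· < k + 1)).card = ((LD H N v).filter (· < k)).card +
          if k ∈ LD H N v then 1 else 0 := by
        split_ifs with hkD
        · rw [← Finset.card_insert_of_notMem (a := k) (by simp)]
          refine congrArg Finset.card ?_
          ext i; simp only [Finset.mem_filter, Finset.mem_insert]
          constructor
          · rintro ⟨a, b⟩
            rcases Nat.lt_succ_iff_lt_or_eq.mp b with c | c
            · exact Or.inr ⟨a, c⟩
            · exact Or.inl c
          · rintro (rfl | ⟨a, b⟩)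
            · exact ⟨hkD, by omega⟩
            · exact ⟨a, by omega⟩
        · rw [add_zero]
          refine congrArg Finset.card ?_
          ext i; simp only [Finset.mem_filter]
          refine and_congr_right fun a => ?_
          have : i ≠ k := by rintro rfl; exact hkD a
          omega
      rw [e2, e3]
      simp only [Nat.add_sub_cancel]
      rcases h.tri k (by omega) with hl | hl | hl
      · have hny : ¬ LY H N v k := fun hy => h.r0 k hl hy
        have : ¬ (1 ≤ k ∧ LY H N v (k - 1)) := by
          rintro ⟨a, b⟩
          exact hW (k - 1) b (by rwa [Nat.sub_add_cancel a])
        rw [if_neg this] at ih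
        simp only [hny, and_false, false_and, if_false]
        omega
      · by_cases hk1 : 1 ≤ k ∧ LY H N v (k - 1)
        · have z1 : ¬ (1 ≤ k ∧ LY H N v k ∧ ¬ LY H N v (k - 1)) := fun hh => hh.2.2 hk1.2
          have z2 : 1 ≤ k + 1 ∧ LY H N v k := ⟨by omega, hl⟩
          rw [if_pos hk1] at ih
          rw [if_neg z1, if_pos z2]
          omega
        · rw [if_neg hk1] at ih
          have : 1 ≤ k + 1 ∧ LY H N v k := ⟨by omega, hl⟩
          rw [if_pos this]
          split_ifs <;> omega
      · rw [if_pos hl]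
        have hl' := mem_LD.mp hl
        simp only [hl'.2.2, and_false, false_and, if_false]
        split_ifs at ih <;> omega
  have hYN := hYs N le_rfl
  have hYN : (Ys N).card ≤ (LD H N v).card + 1 := by
    have := Finset.card_filter_le (LD H N v) (· < N)
    omega
  let I : Finset ℕ := (LD H N v ∪ ((LD H N v).image (fun d => d - 1)).erase 0) ∪ Ys N
  have hIc : I.card ≤ 3 * (LD H N v).card + 1 := by
    have a1 := Finset.card_union_le (LD H N v ∪ ((LD H N v).image (fun d => d - 1)).erase 0) (Ys N)
    have a2 := Finset.card_union_le (LD H N v) (((LD H N v).image (fun d => d - 1)).erase 0)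
    have a3 := Finset.card_erase_le (s := (LD H N v).image (fun d => d - 1)) (a := 0)
    have a4 := Finset.card_image_le (s := LD H N v) (f := fun d => d - 1)
    simp only [I]
    omega
  have core : ∀ a b, a ≤ N → b ≤ N → b ∉ I → LX H N v a → ¬ LX H N v b → H.Adj (v a) (v b) →
      False := by
    intro a b ha hb hbI hxa hxb hadj
    by_cases hbN : b = N
    · subst hbN
      exact h.r0 a hxa ⟨hxa.1, hadj.symm⟩
    have hbN : b < N := by omega
    have hb0 : b ≠ 0 := by rintro rfl; exact hxb h.lx0
    simp only [I, Finset.mem_union, not_or, Finset.mem_erase, not_and, Finset.mem_image,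
      not_exists] at hbI
    obtain ⟨⟨b1, b2⟩, b3⟩ := hbI
    have hyb : LY H N v b := by
      rcases h.tri b hbN with c | c | c
      · exact absurd c hxb
      · exact c
      · exact absurd c b1
    have hyb1 : LY H N v (b - 1) := by
      by_contra hc
      exact b3 (by simp only [Ys, Finset.mem_filter, Finset.mem_range]; exact ⟨hbN, by omega, hyb, hc⟩)
    rcases lt_trichotomy a b with hl | hl | hl
    · by_cases hab : a = b - 1
      · subst hab; exact h.r0 _ hxa hyb1
      · refine h.r1 a (b - 1) (by omega) hxa hyb1 ?_
        rwa [Nat.sub_add_cancel (by omega)]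
    · subst hl; exact hxb hxa
    · have hyb2 : LY H N v (b + 1) := by
        rcases h.tri (b + 1) (by have := hxa.1; omega) with c | c | c
        · exact (hW b hyb c).elim
        · exact c
        · exact absurd (by omega) (b2 hb0 (b + 1) c)
      exact h.r2 b a (by omega) hxa hyb2 hadj.symm
  have hX0 := h.lx0
  have hXN : ¬ LX H N v N := fun hc => by have := hc.1; omega
  have hτ : (0 : ℝ) ≤ (3 * t - 1 : ℝ) / 2 := by
    have : (2 : ℝ) ≤ t := by exact_mod_cast ht
    linarith
  have hTc : ({0, N} : Finset ℕ).card = 2 := Finset.card_pair (by omega)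
  have := h.tough hτ hG hGH I (fun i => if LX H N v i then 0 else 1) ?_ {0, N} ?_ ?_ ?_ (by omega)
  · rw [hTc] at this
    have h1 : (I.card : ℝ) ≤ 3 * (LD H N v).card + 1 := by exact_mod_cast hIc
    have h2 : ((LD H N v).card : ℝ) + 1 ≤ t := by exact_mod_cast hD
    push_cast at this
    linarith
  · intro i j hij hj hiI hjI hadj
    split_ifs with c1 c2 c2
    · rfl
    · exact (core i j (by omega) hj hjI c1 c2 hadj).elim
    · exact (core j i (by omega) (by omega) hiI c2 c1 hadj.symm).elim
    · rfl
  · intro i hi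
    simp only [Finset.mem_insert, Finset.mem_singleton] at hi
    omega
  · intro i hi
    simp only [Finset.mem_insert, Finset.mem_singleton] at hi
    simp only [I, Finset.mem_union, not_or, Finset.mem_erase, not_and, Finset.mem_image,
      not_exists, Ys, Finset.mem_filter, Finset.mem_range, mem_LD]
    rcases hi with rfl | rfl
    · exact ⟨⟨fun _ hh => absurd hX0 hh, by simp⟩, by simp⟩
    · refine ⟨⟨fun hh => absurd hh (lt_irrefl _), fun _ x hx hxx => ?_⟩, fun hh => absurd hh (lt_irrefl _)⟩
      omega
  · intro i hi j hj hij
    simp only [Finset.mem_insert, Finset.mem_singleton] at hi hj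
    rcases hi with rfl | rfl <;> rcases hj with rfl | rfl <;> simp_all
end

section
variable {V : Type*} [Fintype V] [DecidableEq V] {G H : SimpleGraph V} {N : ℕ} {v : ℕ → V}

lemma arith_W (t w : ℕ) (ht : 2 ≤ t) (hw : 1 ≤ w) (a : (3 * t - 1) * (w + 1) ≤ 2 * (2 * w + w * (t - 1)))
    (b : (3 * t - 1) * (w + 1) ≤ 2 * (2 * w + 4 * (t - 1))) : False := by
  obtain ⟨s, rfl⟩ : ∃ s, t = s + 2 := ⟨t - 2, by omega⟩
  have e1 : 3 * (s + 2) - 1 = 3 * s + 5 := by omega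
  have e2 : s + 2 - 1 = s + 1 := by omega
  rw [e1, e2] at a b
  rcases le_or_gt w 4 with h | h
  · interval_cases w <;> omega
  · nlinarith

set_option maxHeartbeats 1000000 in
lemma HP.hasW (h : HP H N v) {t : ℕ} (ht : 2 ≤ t) (hG : Tough ((3 * t - 1 : ℝ) / 2) G) (hGH : G ≤ H)
    (hD : (LD H N v).card + 1 ≤ t)
    (q₀ : ℕ) (hq1 : LY H N v q₀) (hq2 : LX H N v (q₀ + 1)) : False := by
  classical
  have hN := h.hN
  let W : Finset ℕ := (Finset.range N).filter fun p => 1 ≤ p ∧ LY H N v (p - 1) ∧ LX H N v p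
  have hWm : ∀ p, p ∈ W ↔ 1 ≤ p ∧ LY H N v (p - 1) ∧ LX H N v p := by
    intro p
    simp only [W, Finset.mem_filter, Finset.mem_range]
    exact ⟨fun hh => hh.2, fun hh => ⟨hh.2.2.1, hh⟩⟩
  have hWs : ∀ q, q + 1 ∈ W ↔ LY H N v q ∧ LX H N v (q + 1) := by
    intro q; rw [hWm]; simp
  have hW0 : 0 ∉ W := by rw [hWm]; simp
  have nbr : ∀ p j, p ∈ W → j ≤ N → H.Adj (v p) (v j) → j + 1 ∉ W → (∀ i, i ∈ W → j ≠ i + 1) →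
      (p + 1 < j ∧ (j - 1 ∈ LD H N v ∨ j - 2 ∈ LD H N v)) ∨
      (j + 1 < p ∧ (j ∈ LD H N v ∨ j + 1 ∈ LD H N v)) := by
    intro p j hp hj hadj hj1 hj2
    obtain ⟨q, rfl⟩ : ∃ q, p = q + 1 := ⟨p - 1, by have := ((hWm p).mp hp).1; omega⟩
    obtain ⟨hy, hx⟩ := (hWs q).mp hp
    have c1 : j ≠ q := by rintro rfl; exact hj1 hp
    have c2 : j ≠ q + 2 := by rintro rfl; exact hj2 _ hp rfl
    have c3 : j ≠ q + 1 := by rintro rfl; exact H.irrefl hadj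
    rcases lt_or_gt_of_ne c1 with hl | hl
    · right
      refine ⟨by omega, ?_⟩
      have n1 : ¬ LX H N v j := fun hc => h.r1 j q hl hc hy hadj.symm
      have n2 : ¬ LY H N v (j + 1) := fun hc => h.r2 j (q + 1) (by omega) hx hc hadj.symm
      have hqN := hy.1
      rcases h.tri j (by omega) with c | c | c
      · exact absurd c n1
      · rcases h.tri (j + 1) (by omega) with d | d | d
        · exact absurd ((hWs j).mpr ⟨c, d⟩) hj1
        · exact absurd d n2
        · exact Or.inr d
      · exact Or.inl c
    · left
      refine ⟨by omega, ?_⟩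
      obtain ⟨m, rfl⟩ : ∃ m, j = m + 2 := ⟨j - 2, by omega⟩
      have n1 : ¬ LY H N v (m + 1) := fun hc => h.r1 (q + 1) (m + 1) (by omega) hx hc hadj
      have n2 : ¬ LX H N v m := fun hc => h.r3 q m (by omega) hj hc hy hadj
      show m + 1 ∈ _ ∨ m ∈ _
      rcases h.tri m (by omega) with c | c | c
      · exact absurd c n2
      · rcases h.tri (m + 1) (by omega) with d | d | d
        · exact absurd rfl (hj2 (m + 1) ((hWs m).mpr ⟨c, d⟩))
        · exact absurd d n1
        · exact Or.inl d
      · exact Or.inr c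
  let T : ℕ → Finset ℕ := fun p => (Finset.range (N + 1)).filter fun j =>
    H.Adj (v p) (v j) ∧ j + 1 ∉ W ∧ (∀ i, i ∈ W → j ≠ i + 1)
  have hTm : ∀ p j, j ∈ T p ↔ j ≤ N ∧ H.Adj (v p) (v j) ∧ j + 1 ∉ W ∧ (∀ i, i ∈ W → j ≠ i + 1) := by
    intro p j
    simp only [T, Finset.mem_filter, Finset.mem_range, Nat.lt_succ_iff]
  have hTc : ∀ p ∈ W, (T p).card ≤ (LD H N v).card := by
    intro p hp
    have hlab := (hWm p).mp hp
    apply Finset.card_le_card_of_injOn (fun j => if p < j then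
      (if j - 1 ∈ LD H N v then j - 1 else j - 2) else (if j ∈ LD H N v then j else j + 1))
    · intro j hj
      obtain ⟨a1, a2, a3, a4⟩ := (hTm p j).mp hj
      rcases nbr p j hp a1 a2 a3 a4 with ⟨b1, b2⟩ | ⟨b1, b2⟩
      · have : p < j := by omega
        simp only [this, if_true]
        split_ifs with c
        · exact c
        · exact b2.resolve_left c
      · have : ¬ p < j := by omega
        simp only [this, if_false]
        split_ifs with c
        · exact c
        · exact b2.resolve_left c
    · intro j hj k hk hjk
      obtain ⟨a1, a2, a3, a4⟩ := (hTm p j).mp hj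
      obtain ⟨a1', a2', a3', a4'⟩ := (hTm p k).mp hk
      obtain ⟨q, rfl⟩ : ∃ q, p = q + 1 := ⟨p - 1, by omega⟩
      obtain ⟨hy, hx⟩ := (hWs q).mp hp
      have hnc : ∀ i, i + 1 ≤ N → (q + 1 < i ∨ i < q) → H.Adj (v (q + 1)) (v i) →
          H.Adj (v (q + 1)) (v (i + 1)) → False := by
        rintro i hi (hh | hh) u1 u2
        · exact h.r4a q i hh hi hx hy u1 u2
        · exact h.r4b q i hh hx hy u1 u2
      have n1 : ∀ i, j = i + 1 → k = i → (q + 1 < i ∨ i < q) → False := by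
        rintro i rfl rfl hh
        exact hnc _ a1 hh a2' a2
      have n2 : ∀ i, k = i + 1 → j = i → (q + 1 < i ∨ i < q) → False := by
        rintro i rfl rfl hh
        exact hnc _ a1' hh a2 a2'
      have m1 := nbr _ j hp a1 a2 a3 a4
      have m2 := nbr _ k hp a1' a2' a3' a4'
      have n1' : ¬ (j = k + 1 ∧ (q + 1 < k ∨ k < q)) := fun hh => n1 k hh.1 rfl hh.2
      have n2' : ¬ (k = j + 1 ∧ (q + 1 < j ∨ j < q)) := fun hh => n2 j hh.1 rfl hh.2
      have m1' : q + 1 + 1 < j ∨ j + 1 < q + 1 := m1.imp And.left And.left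
      have m2' : q + 1 + 1 < k ∨ k + 1 < q + 1 := m2.imp And.left And.left
      clear m1 m2 n1 n2 hnc nbr
      dsimp only at hjk
      split_ifs at hjk <;> omega
  let I : Finset ℕ := (W.image (fun p => p + 1) ∪ W.image (fun p => p - 1)) ∪ W.biUnion T
  have hIm : ∀ j, j ∈ I ↔ ((∃ p ∈ W, p + 1 = j) ∨ (∃ p ∈ W, p - 1 = j)) ∨ ∃ p ∈ W, j ∈ T p := by
    intro j
    simp only [I, Finset.mem_union, Finset.mem_image, Finset.mem_biUnion]
  have hc0 : I.card ≤ 2 * W.card + (W.biUnion T).card := by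
    have a1 := Finset.card_union_le (W.image (fun p => p + 1) ∪ W.image (fun p => p - 1)) (W.biUnion T)
    have a2 := Finset.card_union_le (W.image (fun p => p + 1)) (W.image (fun p => p - 1))
    have a3 := Finset.card_image_le (s := W) (f := fun p => p + 1)
    have a4 := Finset.card_image_le (s := W) (f := fun p => p - 1)
    simp only [I]
    omega
  have hc1 : (W.biUnion T).card ≤ W.card * (t - 1) := by
    apply Finset.card_biUnion_le_card_mul
    intro p hp
    have := hTc p hp
    omega
  have hc2 : (W.biUnion T).card ≤ 4 * (t - 1) := by
    have hsub : W.biUnion T ⊆ (LD H N v).biUnion fun d => {d - 1, d, d + 1, d + 2} := by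
      intro j hj
      obtain ⟨p, hp, hj⟩ := Finset.mem_biUnion.mp hj
      obtain ⟨a1, a2, a3, a4⟩ := (hTm p j).mp hj
      rw [Finset.mem_biUnion]
      simp only [Finset.mem_insert, Finset.mem_singleton]
      rcases nbr p j hp a1 a2 a3 a4 with ⟨b1, b2 | b2⟩ | ⟨b1, b2 | b2⟩
      · exact ⟨_, b2, by omega⟩
      · exact ⟨_, b2, by omega⟩
      · exact ⟨_, b2, by omega⟩
      · exact ⟨_, b2, by omega⟩
    have a1 := Finset.card_le_card hsub
    have a2 : ((LD H N v).biUnion fun d => ({d - 1, d, d + 1, d + 2} : Finset ℕ)).card ≤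
        (LD H N v).card * 4 := by
      apply Finset.card_biUnion_le_card_mul
      intro d _
      exact Finset.card_le_four
    omega
  have hXY : ∀ i, i ∈ W → ∀ j, j ∈ W → j ≠ i + 1 := by
    rintro i hi j hj rfl
    exact h.r0 i ((hWm i).mp hi).2.2 ((hWs i).mp hj).1
  have hind : ∀ i j, i ∈ W → j ∈ W → i < j → H.Adj (v i) (v j) → False := by
    intro i j hi hj hij hadj
    have := hXY i hi j hj
    have hj' := (hWm j).mp hj
    refine h.r1 i (j - 1) (by omega) ((hWm i).mp hi).2.2 hj'.2.1 ?_
    rwa [Nat.sub_add_cancel hj'.1]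
  have hWI : ∀ i ∈ W, i ∉ I := by
    intro i hi hI
    rcases (hIm i).mp hI with (⟨p, hp, e⟩ | ⟨p, hp, e⟩) | ⟨p, hp, e⟩
    · exact hXY p hp i hi e.symm
    · exact hXY i hi p hp (by have := ((hWm p).mp hp).1; omega)
    · obtain ⟨a1, a2, a3, a4⟩ := (hTm p i).mp e
      rcases lt_trichotomy i p with hl | hl | hl
      · exact hind i p hi hp hl a2.symm
      · subst hl; exact H.irrefl a2
      · exact hind p i hp hi hl a2
  have h0I : 0 ∉ I := by
    intro hI
    rcases (hIm 0).mp hI with (⟨p, hp, e⟩ | ⟨p, hp, e⟩) | ⟨p, hp, e⟩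
    · omega
    · have hp' := (hWm p).mp hp
      rw [e] at hp'
      exact h.r0 0 h.lx0 hp'.2.1
    · obtain ⟨a1, a2, a3, a4⟩ := (hTm p 0).mp e
      have hp' := (hWm p).mp hp
      refine h.r0 (p - 1) ⟨hp'.2.1.1, ?_⟩ hp'.2.1
      rw [Nat.sub_add_cancel hp'.1]
      exact a2.symm
  have hclosed : ∀ i j, i ∈ W → j ≤ N → j ∉ I → H.Adj (v i) (v j) → False := by
    intro i j hi hj hjI hadj
    apply hjI
    rw [hIm]
    by_cases c1 : j + 1 ∈ W
    · exact Or.inl (Or.inr ⟨j + 1, c1, by omega⟩)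
    · by_cases c2 : ∃ p ∈ W, p + 1 = j
      · exact Or.inl (Or.inl c2)
      · refine Or.inr ⟨i, hi, (hTm i j).mpr ⟨hj, hadj, c1, ?_⟩⟩
        intro p hp e
        exact c2 ⟨p, hp, e.symm⟩
  have hw1 : 1 ≤ W.card := Finset.card_pos.mpr ⟨q₀ + 1, (hWs q₀).mpr ⟨hq1, hq2⟩⟩
  have hTc' : (insert 0 W).card = W.card + 1 := Finset.card_insert_of_notMem hW0
  have hτ : (0 : ℝ) ≤ (3 * t - 1 : ℝ) / 2 := by
    have : (2 : ℝ) ≤ t := by exact_mod_cast ht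
    linarith
  have main := h.tough hτ hG hGH I (fun i => if i ∈ W then i else 0) ?_ (insert 0 W) ?_ ?_ ?_ (by omega)
  · rw [hTc'] at main
    have main' : (3 * t - 1) * (W.card + 1) ≤ 2 * I.card := by
      have e : ((3 * t - 1 : ℕ) : ℝ) = 3 * t - 1 := by
        rw [Nat.cast_sub (by omega)]; push_cast; ring
      have : (((3 * t - 1) * (W.card + 1) : ℕ) : ℝ) ≤ ((2 * I.card : ℕ) : ℝ) := by
        rw [Nat.cast_mul, e]
        push_cast at main ⊢
        linarith
      exact_mod_cast this
    exact arith_W t W.card ht hw1 (main'.trans (by omega)) (main'.trans (by omega))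
  · intro i j hij hj hiI hjI hadj
    have c1 : i ∉ W := fun hi => hclosed i j hi hj hjI hadj
    have c2 : j ∉ W := fun hi => hclosed j i hi (by omega) hiI hadj.symm
    simp [c1, c2]
  · intro i hi
    rcases Finset.mem_insert.mp hi with rfl | hi
    · omega
    · have := ((hWm i).mp hi).2.2.1
      omega
  · intro i hi
    rcases Finset.mem_insert.mp hi with rfl | hi
    · exact h0I
    · exact hWI i hi
  · intro i hi j hj hij
    rw [Finset.mem_insert] at hi hj
    have e : ∀ i, (i = 0 ∨ i ∈ W) → (if i ∈ W then i else 0) = i := by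
      rintro i (rfl | hi)
      · rw [if_neg hW0]
      · rw [if_pos hi]
    rw [e i hi, e j hj] at hij
    exact hij

lemma HP.false (h : HP H N v) {t : ℕ} (ht : 2 ≤ t) (hG : Tough ((3 * t - 1 : ℝ) / 2) G) (hGH : G ≤ H)
    (hna : ¬ H.Adj (v 0) (v N))
    (hd : N + 1 ≤ t + (H.neighborSet (v 0)).ncard + (H.neighborSet (v N)).ncard) : False := by
  have hD := h.card_LD hna hd
  exact h.noW ht hG hGH hD fun q a b => h.hasW ht hG hGH hD q a b

lemma closure_step (hn : 3 ≤ Fintype.card V) {t : ℕ} (ht : 2 ≤ t)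
    (hG : Tough ((3 * t - 1 : ℝ) / 2) G) (hGH : G ≤ H) (u w : V) (huw : u ≠ w)
    (hna : ¬ H.Adj u w)
    (hd : Fintype.card V - t ≤ (H.neighborSet u).ncard + (H.neighborSet w).ncard)
    (hham : (H ⊔ edge u w).IsHamiltonian) : H.IsHamiltonian := by
  by_contra hnh
  have : Nontrivial V := ⟨u, w, huw⟩
  obtain ⟨p, hp⟩ := hham.exists_isHamiltonianCycle u
  have hlen := hp.length_eq
  obtain ⟨N, hN⟩ : ∃ N, Fintype.card V = N + 1 := ⟨Fintype.card V - 1, by omega⟩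
  rw [hN] at hlen
  let c : ℕ → V := p.getVert
  have hc0 : c 0 = u := p.getVert_zero
  have hcN : c (N + 1) = u := by simp only [c]; rw [← hlen]; exact p.getVert_length
  have hadj : ∀ k, k < N + 1 → (H ⊔ edge u w).Adj (c k) (c (k + 1)) := fun k hk =>
    p.adj_getVert_succ (by omega)
  have hinj : ∀ i j, 1 ≤ i → i ≤ N + 1 → 1 ≤ j → j ≤ N + 1 → c i = c j → i = j := by
    intro i j hi hi' hj hj' hij
    exact hp.isCycle.getVert_injOn ⟨hi, by omega⟩ ⟨hj, by omega⟩ hij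
  have hinj0 : ∀ i j, i ≤ N → j ≤ N → c i = c j → i = j := by
    intro i j hi hj hij
    exact hp.isCycle.getVert_injOn' (by simp; omega) (by simp; omega) hij
  have hsurj : ∀ x, ∃ k, 1 ≤ k ∧ k ≤ N + 1 ∧ c k = x := by
    intro x
    obtain ⟨k, hk, hk'⟩ := Walk.mem_support_iff_exists_getVert.mp (hp.mem_support x)
    rcases Nat.eq_zero_or_pos k with rfl | hk0
    · exact ⟨N + 1, by omega, le_rfl, by rw [hcN, ← hk, p.getVert_zero]⟩
    · exact ⟨k, hk0, by omega, hk⟩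
  have hsurj0 : ∀ x, ∃ k, k ≤ N ∧ c k = x := by
    intro x
    obtain ⟨k, hk1, hk2, hk3⟩ := hsurj x
    by_cases hk : k = N + 1
    · subst hk; exact ⟨0, by omega, by rw [hc0, ← hk3, hcN]⟩
    · exact ⟨k, by omega, hk3⟩
  have hstep : ∀ k, k < N + 1 → H.Adj (c k) (c (k + 1)) ∨ (k = 0 ∧ c 1 = w) ∨ (k = N ∧ c N = w) := by
    intro k hk
    have := hadj k hk
    rw [sup_adj, edge_adj] at this
    rcases this with a | ⟨⟨a, b⟩ | ⟨a, b⟩, _⟩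
    · exact Or.inl a
    · have : k = 0 := hinj0 k 0 (by omega) (by omega) (by rw [a, hc0])
      subst this
      exact Or.inr (Or.inl ⟨rfl, b⟩)
    · have : k + 1 = N + 1 := hinj _ _ (by omega) (by omega) (by omega) (by omega) (by rw [b, hcN])
      have : k = N := by omega
      subst this
      exact Or.inr (Or.inr ⟨rfl, a⟩)
  by_cases hw1 : c 1 = w
  · have hwN : c N ≠ w := by
      intro hh
      have := hinj0 1 N (by omega) (by omega) (by rw [hw1, hh])
      omega
    have hP : HP H N (fun i => c (i + 1)) :=
      { hN := by omega
        card := hN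
        inj := fun i j hi hj hij => by
          have := hinj (i+1) (j+1) (by omega) (by omega) (by omega) (by omega) hij
          omega
        surj := fun x => by
          obtain ⟨k, a, b, e⟩ := hsurj x
          exact ⟨k - 1, by omega, by simpa only [Nat.sub_add_cancel a] using e⟩
        adj := fun k hk => by
          rcases hstep (k + 1) (by omega) with a | a | a
          · exact a
          · omega
          · exact absurd a.2 hwN
        nham := hnh }
    refine hP.false ht hG hGH ?_ ?_
    · simp only [zero_add, hw1, hcN]
      exact fun hh => hna hh.symm
    · simp only [zero_add, hw1, hcN]
      omega
  · by_cases hwN : c N = w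
    · have hP : HP H N c :=
        { hN := by omega
          card := hN
          inj := hinj0
          surj := hsurj0
          adj := fun k hk => by
            rcases hstep k (by omega) with a | a | a
            · exact a
            · exact absurd a.2 hw1
            · omega
          nham := hnh }
      refine hP.false ht hG hGH ?_ ?_
      · rw [hc0, hwN]; exact hna
      · rw [hc0, hwN]; omega
    · apply hnh
      have hs : ∀ k, k < N + 1 → H.Adj (c k) (c (k + 1)) := by
        intro k hk
        rcases hstep k hk with a | a | a
        · exact a
        · exact absurd a.2 hw1
        · exact absurd a.2 hwN
      refine ham_of_fun H N (by omega) hN c hsurj0 (fun k hk => hs k (by omega)) ?_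
      have := hs N (by omega)
      rwa [hcN, ← hc0] at this
end

/-- For every integer `t ≥ 2`, a `(3t-1)/2`-tough graph `G` on `n ≥ 3` vertices is
Hamiltonian if and only if its `t`-closure `G^{*t}` is Hamiltonian. -/
theorem stmt_2 {V : Type*} [Fintype V] [DecidableEq V]
    (hn : 3 ≤ Fintype.card V)
    (t : ℕ) (ht : 2 ≤ t)
    (G : SimpleGraph V) (htough : Tough ((3 * t - 1 : ℝ) / 2) G) :
    G.IsHamiltonian ↔ (tClosure t G).IsHamiltonian := by
  constructor
  · intro h
    exact h.mono (le_sInf fun H hH => hH.1)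
  · intro h
    by_contra hG
    obtain ⟨H, hGH, hmax⟩ := (Set.toFinite {H : SimpleGraph V | ¬ H.IsHamiltonian}).exists_le_maximal
      (show G ∈ {H : SimpleGraph V | ¬ H.IsHamiltonian} from hG)
    have hnh : ¬ H.IsHamiltonian := hmax.1
    have hcl : IsTClosed t H := by
      intro u w huw hna
      by_contra hd
      apply hnh
      refine closure_step hn ht htough hGH u w huw hna (by omega) ?_
      by_contra hc
      have hle : H ⊔ edge u w ≤ H := hmax.2 hc le_sup_left
      exact hna (hle (by rw [sup_adj, edge_adj]; exact Or.inr ⟨Or.inl ⟨rfl, rfl⟩, huw⟩))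
    exact hnh (h.mono (sInf_le (show H ∈ {H | G ≤ H ∧ IsTClosed t H} from ⟨hGH, hcl⟩)))
end

section
/- Let G be a 2-tough graph on n ≥ 3 vertices and let x and y be two non-adjacent vertices of G with d(x) + d(y) ≥ n − 1. Then the graph G' obtained from G by adding the edge xy is Hamiltonian if and only if G is Hamiltonian. -/
open SimpleGraph

section aux

variable {V : Type*} [Fintype V] [DecidableEq V]

lemma ham_of_fun_s3 (hn : 3 ≤ Fintype.card V) (G : SimpleGraph V) (f : ℕ → V)
    (hinj : ∀ i j, i < Fintype.card V → j < Fintype.card V → f i = f j → i = j)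
    (hadj : ∀ i, i + 1 < Fintype.card V → G.Adj (f i) (f (i + 1)))
    (hclose : G.Adj (f (Fintype.card V - 1)) (f 0)) : G.IsHamiltonian := by
  intro _
  set n := Fintype.card V with hnn
  have key : ∀ k, k < n → ∃ p : G.Walk (f 0) (f k), p.support = (List.range (k + 1)).map f := by
    intro k
    induction k with
    | zero => intro _; exact ⟨Walk.nil, by simp⟩
    | succ k ih =>
      intro hk
      obtain ⟨p, hp⟩ := ih (by omega)
      refine ⟨p.concat (hadj k hk), ?_⟩
      rw [Walk.support_concat, hp, List.range_succ (n := k + 1)]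
      simp
  obtain ⟨p, hp⟩ := key (n - 1) (by omega)
  have hlen : p.length = n - 1 := by
    have := p.length_support
    rw [hp] at this
    simp at this
    omega
  have hpath : p.IsPath := by
    rw [Walk.isPath_def, hp]
    refine List.Nodup.map_on ?_ List.nodup_range
    intro a ha b hb h
    simp at ha hb
    exact hinj a b (by omega) (by omega) h
  refine ⟨_, Walk.cons hclose p, ?_⟩
  rw [Walk.isHamiltonianCycle_iff_isCycle_and_length_eq]
  refine ⟨?_, by simp [hlen]; omega⟩
  rw [Walk.isCycle_iff_isPath_tail_and_le_length]
  refine ⟨by simpa using hpath, by simp [hlen]; omega⟩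

lemma ham_of_perm (hn : 3 ≤ Fintype.card V) (G : SimpleGraph V) (v : ℕ → V)
    (hinj : ∀ i j, i < Fintype.card V → j < Fintype.card V → v i = v j → i = j)
    (hadj : ∀ i, i + 1 < Fintype.card V → G.Adj (v i) (v (i + 1)))
    (s : ℕ → ℕ) (hs : ∀ i, i < Fintype.card V → s i < Fintype.card V)
    (hsi : ∀ i j, i < Fintype.card V → j < Fintype.card V → s i = s j → i = j)
    (hsa : ∀ i, i + 1 < Fintype.card V → s (i + 1) = s i + 1 ∨ s i = s (i + 1) + 1 ∨
      G.Adj (v (s i)) (v (s (i + 1))))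
    (hclose : G.Adj (v (s (Fintype.card V - 1))) (v (s 0))) : G.IsHamiltonian := by
  refine ham_of_fun_s3 hn G (fun i => v (s i)) ?_ ?_ hclose
  · intro i j hi hj h
    exact hsi i j hi hj (hinj _ _ (hs i hi) (hs j hj) h)
  · intro i hi
    have h1 := hs i (by omega)
    have h2 := hs (i + 1) hi
    rcases hsa i hi with h | h | h
    · simp only [h]; exact hadj _ (by omega)
    · simp only [h]; exact (hadj _ (by omega)).symm
    · exact h

lemma exists_path (hn : 3 ≤ Fintype.card V) (G : SimpleGraph V) (x y : V) (hxy : x ≠ y)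
    (h : (G ⊔ fromEdgeSet {s(x, y)}).IsHamiltonian) (hG : ¬ G.IsHamiltonian) :
    ∃ v : ℕ → V, v 0 = x ∧ v (Fintype.card V - 1) = y ∧
      (∀ i j, i < Fintype.card V → j < Fintype.card V → v i = v j → i = j) ∧
      (∀ i, i + 1 < Fintype.card V → G.Adj (v i) (v (i + 1))) := by
  have : Nontrivial V := ⟨x, y, hxy⟩
  obtain ⟨p, hp⟩ := h.exists_isHamiltonianCycle x
  have hlen := hp.length_eq
  set n := Fintype.card V with hnn
  have main : ∀ p : (G ⊔ fromEdgeSet {s(x, y)}).Walk x x, p.IsHamiltonianCycle →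
      p.length = n → p.getVert (n - 1) = y → ∃ v : ℕ → V, v 0 = x ∧ v (n - 1) = y ∧
      (∀ i j, i < n → j < n → v i = v j → i = j) ∧
      (∀ i, i + 1 < n → G.Adj (v i) (v (i + 1))) := by
    intro p hp hlen hy
    have hinj : ∀ i j, i < n → j < n → p.getVert i = p.getVert j → i = j := by
      intro i j hi hj h
      exact hp.isCycle.getVert_injOn' (by simp; omega) (by simp; omega) h
    refine ⟨p.getVert, by simp, hy, hinj, ?_⟩
    intro i hi
    have := p.adj_getVert_succ (i := i) (by omega)
    rw [sup_adj] at this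
    rcases this with h | h
    · exact h
    · exfalso
      simp at h
      have h0 : p.getVert 0 = x := by simp
      rcases h.1 with ⟨h1, h2⟩ | ⟨h1, h2⟩
      · have := hinj i 0 (by omega) (by omega) (h1.trans h0.symm)
        have := hinj (i+1) (n-1) (by omega) (by omega) (h2.trans hy.symm)
        omega
      · have := hinj (i+1) 0 (by omega) (by omega) (h2.trans h0.symm)
        omega
  by_cases hy : p.getVert (n - 1) = y
  · exact main p hp hlen hy
  by_cases hy1 : p.getVert 1 = y
  · have hr : p.reverse.IsHamiltonianCycle := by
      rw [Walk.isHamiltonianCycle_iff_isCycle_and_length_eq]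
      exact ⟨hp.isCycle.reverse, by simp [hlen, hnn]⟩
    refine main p.reverse hr (by simp [hlen]) ?_
    rw [Walk.getVert_reverse, hlen, show n - (n - 1) = 1 by omega, hy1]
  exfalso
  apply hG
  have hinj : ∀ i j, i < n → j < n → p.getVert i = p.getVert j → i = j := by
    intro i j hi hj h
    exact hp.isCycle.getVert_injOn' (by simp; omega) (by simp; omega) h
  have h0 : p.getVert 0 = x := by simp
  have hN : p.getVert n = x := by rw [← hlen]; simp
  have hadj : ∀ i, i < n → G.Adj (p.getVert i) (p.getVert (i + 1)) := by
    intro i hi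
    have := p.adj_getVert_succ (i := i) (by omega)
    rw [sup_adj] at this
    rcases this with h | h
    · exact h
    · exfalso
      simp at h
      rcases h.1 with ⟨h1, h2⟩ | ⟨h1, h2⟩
      · have := hinj i 0 (by omega) (by omega) (h1.trans h0.symm)
        subst this
        exact hy1 h2
      · by_cases hi' : i + 1 < n
        · have := hinj (i+1) 0 (by omega) (by omega) (h2.trans h0.symm)
          omega
        · have : i = n - 1 := by omega
          subst this
          exact hy h1
  refine ham_of_fun_s3 hn G p.getVert hinj (fun i hi => hadj i (by omega)) ?_
  have := hadj (n - 1) (by omega)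
  rw [show n - 1 + 1 = n by omega, hN] at this
  rwa [h0]

lemma reach_inv {W : Type*} (H : SimpleGraph W) (P : W → Prop)
    (hP : ∀ a b, H.Adj a b → P a → P b) (a b : W) (h : H.Reachable a b) (ha : P a) : P b := by
  obtain ⟨w⟩ := h
  induction w with
  | nil => exact ha
  | cons h _ ih => exact ih (hP _ _ h ha)

end aux

theorem stmt_3 {V : Type*} [Fintype V] [DecidableEq V]
    (hn : 3 ≤ Fintype.card V)
    (G : SimpleGraph V) [DecidableRel G.Adj]
    (htough : Tough 2 G)
    (x y : V) (hxy : x ≠ y) (hnadj : ¬ G.Adj x y)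
    (hdeg : Fintype.card V - 1 ≤ G.degree x + G.degree y) :
    (G ⊔ fromEdgeSet {s(x, y)}).IsHamiltonian ↔ G.IsHamiltonian := by
  classical
  refine ⟨fun h => ?_, fun h => h.mono le_sup_left⟩
  by_contra hG
  obtain ⟨v, v0, vn, hinj, hadj⟩ := exists_path hn G x y hxy h hG
  have hperm := ham_of_perm hn G v hinj hadj
  have hsurj : ∀ w, ∃ k, k < Fintype.card V ∧ v k = w := by
    intro w
    have : (Finset.range (Fintype.card V)).image v = Finset.univ := by
      apply Finset.eq_univ_of_card
      rw [Finset.card_image_of_injOn, Finset.card_range]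
      intro a ha b hb h
      simp at ha hb
      exact hinj a b ha hb h
    have hw := Finset.mem_univ w
    rw [← this] at hw
    simpa using hw
  set n := Fintype.card V with hnn
  -- rules
  have rule0 : ∀ i, i + 1 < n → G.Adj x (v (i + 1)) → G.Adj y (v i) → False := by
    intro i hi h1 h2
    apply hG
    refine hperm (fun k => if k ≤ i then k else n + i - k) ?_ ?_ ?_ ?_
    · intro k hk; split_ifs <;> omega
    · intro k l hk hl; split_ifs <;> omega
    · intro k hk
      by_cases hki : k = i
      · right; right
        rw [if_pos (by omega), if_neg (by omega), hki, show n + i - (i + 1) = n - 1 by omega, vn]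
        exact h2.symm
      · split_ifs <;> omega
    · rw [if_neg (by omega), if_pos (by omega), v0, show n + i - (n - 1) = i + 1 by omega]
      exact h1.symm
  have rule1 : ∀ i j, i < j → j < n → G.Adj x (v (i + 1)) → G.Adj y (v (j - 1)) →
      G.Adj (v i) (v j) → False := by
    intro i j hij hj h1 h2 h3
    by_cases hji : j = i + 1
    · subst hji; exact rule0 i hj h1 h2
    apply hG
    refine hperm (fun k => if k ≤ i then k else if k ≤ i + n - j then k + j - i - 1
      else n + i - k) ?_ ?_ ?_ ?_
    · intro k hk; split_ifs <;> omega
    · intro k l hk hl; split_ifs <;> omega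
    · intro k hk
      by_cases hki : k = i
      · right; right
        rw [if_pos (by omega), if_neg (by omega), if_pos (by omega), hki,
          show i + 1 + j - i - 1 = j by omega]
        exact h3
      by_cases hkj : k = i + n - j
      · right; right
        rw [if_neg (by omega), if_pos (by omega), if_neg (by omega), if_neg (by omega),
          show k + j - i - 1 = n - 1 by omega, show n + i - (k + 1) = j - 1 by omega, vn]
        exact h2
      split_ifs <;> omega
    · rw [if_neg (by omega), if_neg (by omega), if_pos (by omega), v0,
        show n + i - (n - 1) = i + 1 by omega]
      exact h1.symm
  have rule2 : ∀ i j, i < j → j + 1 < n → G.Adj x (v (j + 1)) → G.Adj y (v (i + 1)) →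
      G.Adj (v i) (v j) → False := by
    intro i j hij hj h1 h2 h3
    apply hG
    refine hperm (fun k => if k ≤ i then k else if k ≤ j then j + i + 1 - k
      else n + j - k) ?_ ?_ ?_ ?_
    · intro k hk; split_ifs <;> omega
    · intro k l hk hl; split_ifs <;> omega
    · intro k hk
      by_cases hki : k = i
      · right; right
        rw [if_pos (by omega), if_neg (by omega), if_pos (by omega), hki,
          show j + i + 1 - (i + 1) = j by omega]
        exact h3
      by_cases hkj : k = j
      · right; right
        rw [if_neg (by omega), if_pos (by omega), if_neg (by omega), if_neg (by omega),
          show j + i + 1 - k = i + 1 by omega, show n + j - (k + 1) = n - 1 by omega, vn]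
        exact h2.symm
      split_ifs <;> omega
    · rw [if_neg (by omega), if_neg (by omega), if_pos (by omega), v0,
        show n + j - (n - 1) = j + 1 by omega]
      exact h1.symm
  have rule3 : ∀ i j, 1 ≤ i → i < j → j < n → G.Adj y (v (i - 1)) → G.Adj x (v (j - 1)) →
      G.Adj (v i) (v j) → False := by
    intro i j hi hij hj h1 h2 h3
    apply hG
    refine hperm (fun k => if k < n - j then n - 1 - k else if k < n - i then k + j + i - n
      else k + i - n) ?_ ?_ ?_ ?_
    · intro k hk; split_ifs <;> omega
    · intro k l hk hl; split_ifs <;> omega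
    · intro k hk
      by_cases hki : k + 1 = n - j
      · right; right
        rw [if_pos (by omega), if_neg (by omega), if_pos (by omega),
          show n - 1 - k = j by omega, show k + 1 + j + i - n = i by omega]
        exact h3.symm
      by_cases hkj : k + 1 = n - i
      · right; right
        rw [if_neg (by omega), if_pos (by omega), if_neg (by omega), if_neg (by omega),
          show k + j + i - n = j - 1 by omega, show k + 1 + i - n = 0 by omega, v0]
        exact h2.symm
      split_ifs <;> omega
    · rw [if_neg (by omega), if_neg (by omega), if_pos (by omega),
        show n - 1 + i - n = i - 1 by omega, show n - 1 - 0 = n - 1 by omega, vn]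
      exact h1.symm
  -- dichotomy
  have hdich : ∀ k, k < n - 1 → (G.Adj y (v k) ↔ ¬ G.Adj x (v (k + 1))) := by
    intro k hk
    refine ⟨fun h1 h2 => rule0 k (by omega) h2 h1, fun h1 => ?_⟩
    by_contra h2
    have hdx : G.degree x ≤ ((Finset.range (n - 1)).filter (fun k => G.Adj x (v (k + 1)))).card := by
      rw [← card_neighborFinset_eq_degree]
      refine le_trans (Finset.card_le_card (t := ((Finset.range (n - 1)).filter
        (fun k => G.Adj x (v (k + 1)))).image (fun k => v (k + 1))) ?_) Finset.card_image_le
      intro w hw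
      rw [mem_neighborFinset] at hw
      obtain ⟨l, hl, rfl⟩ := hsurj w
      have : l ≠ 0 := by rintro rfl; rw [v0] at hw; exact G.irrefl hw
      obtain ⟨l, rfl⟩ := Nat.exists_eq_succ_of_ne_zero this
      simp only [Finset.mem_image, Finset.mem_filter, Finset.mem_range]
      exact ⟨l, ⟨by omega, hw⟩, rfl⟩
    have hdy : G.degree y ≤ ((Finset.range (n - 1)).filter (fun k => G.Adj y (v k))).card := by
      rw [← card_neighborFinset_eq_degree]
      refine le_trans (Finset.card_le_card (t := ((Finset.range (n - 1)).filter
        (fun k => G.Adj y (v k))).image v) ?_) Finset.card_image_le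
      intro w hw
      rw [mem_neighborFinset] at hw
      obtain ⟨l, hl, rfl⟩ := hsurj w
      have : l ≠ n - 1 := by rintro rfl; rw [vn] at hw; exact G.irrefl hw
      simp only [Finset.mem_image, Finset.mem_filter, Finset.mem_range]
      exact ⟨l, ⟨by omega, hw⟩, rfl⟩
    have hdisj : Disjoint ((Finset.range (n - 1)).filter (fun k => G.Adj x (v (k + 1))))
        ((Finset.range (n - 1)).filter (fun k => G.Adj y (v k))) := by
      rw [Finset.disjoint_filter]
      intro l hl h3 h4
      simp at hl
      exact rule0 l (by omega) h3 h4
    have hcard := Finset.card_union_of_disjoint hdisj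
    have hsub : ((Finset.range (n - 1)).filter (fun k => G.Adj x (v (k + 1)))) ∪
        ((Finset.range (n - 1)).filter (fun k => G.Adj y (v k))) ⊆
        (Finset.range (n - 1)).erase k := by
      intro l hl
      simp only [Finset.mem_union, Finset.mem_filter, Finset.mem_range, Finset.mem_erase] at hl ⊢
      refine ⟨?_, by omega⟩
      rintro rfl
      tauto
    have := Finset.card_le_card hsub
    rw [Finset.card_erase_of_mem (by simpa using hk), Finset.card_range] at this
    omega
  have A0 : ¬ G.Adj x (v 0) := by rw [v0]; exact G.irrefl
  have An : ¬ G.Adj x (v (n - 1)) := by rw [vn]; exact hnadj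
  have A1 : G.Adj x (v 1) := by have := hadj 0 (by omega); rwa [v0] at this
  set N := (Finset.range (n - 1)).filter
    (fun j => 1 ≤ j ∧ ¬ G.Adj x (v j) ∧ G.Adj x (v (j + 1))) with hN
  have memN : ∀ j, j ∈ N ↔ j < n - 1 ∧ 1 ≤ j ∧ ¬ G.Adj x (v j) ∧ G.Adj x (v (j + 1)) := by
    intro j; simp [hN]
  rcases N.eq_empty_or_nonempty with hE | ⟨j0, hj0⟩
  · -- cut vertex
    have hno : ∀ j, j < n - 1 → 1 ≤ j → ¬ G.Adj x (v j) → ¬ G.Adj x (v (j + 1)) := by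
      intro j h1 h2 h3 h4
      have := (memN j).2 ⟨h1, h2, h3, h4⟩
      rw [hE] at this
      simp at this
    have hex : ∃ m, ¬ G.Adj x (v (m + 1)) :=
      ⟨n - 2, by rwa [show n - 2 + 1 = n - 1 by omega]⟩
    obtain ⟨m, hm, hmin⟩ : ∃ m, ¬ G.Adj x (v (m + 1)) ∧ ∀ k < m, G.Adj x (v (k + 1)) :=
      ⟨Nat.find hex, Nat.find_spec hex, fun k hk => not_not.1 (Nat.find_min hex hk)⟩
    have hm1 : 1 ≤ m := by
      by_contra h0
      have : m = 0 := by omega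
      subst this
      exact hm A1
    have hmn : m < n - 1 := by
      by_contra h0
      apply An
      have := hmin (n - 2) (by omega)
      rwa [show n - 2 + 1 = n - 1 by omega] at this
    have hafter : ∀ k, m < k → k < n → ¬ G.Adj x (v k) := by
      intro k
      induction k with
      | zero => intro h; omega
      | succ k ih =>
        intro h1 h2
        by_cases hk : k = m
        · rw [hk]; exact hm
        · exact hno k (by omega) (by omega) (ih (by omega) (by omega))
    have hnc : ¬ (G.induce ((↑({v m} : Finset V) : Set V)ᶜ)).Connected := by
      intro hc
      have h0 : v 0 ∈ ((↑({v m} : Finset V) : Set V)ᶜ) := by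
        simp
        intro h; have := hinj 0 m (by omega) (by omega) h; omega
      have h1 : v (n - 1) ∈ ((↑({v m} : Finset V) : Set V)ᶜ) := by
        simp
        intro h; have := hinj (n - 1) m (by omega) (by omega) h; omega
      have hr := hc.preconnected ⟨v 0, h0⟩ ⟨v (n - 1), h1⟩
      have := reach_inv _ (fun w => ∃ k < m, w.1 = v k) ?_ _ _ hr ⟨0, by omega, rfl⟩
      · obtain ⟨k, hk, h⟩ := this
        have := hinj (n - 1) k (by omega) (by omega) h
        omega
      · rintro ⟨a, ha⟩ ⟨b, hb⟩ hab ⟨k, hk, rfl⟩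
        obtain ⟨l, hl, rfl⟩ := hsurj b
        have hab' : G.Adj (v k) (v l) := hab
        refine ⟨l, ?_, rfl⟩
        by_contra hlm
        have hne : l ≠ m := by rintro rfl; simp at hb
        refine rule1 k l (by omega) hl (hmin k hk) ?_ hab'
        rw [hdich _ (by omega), show l - 1 + 1 = l by omega]
        exact hafter l (by omega) hl
    have h2 := htough _ hnc
    have h0 : v 0 ∈ ((↑({v m} : Finset V) : Set V)ᶜ) := by
      simp
      intro h; have := hinj 0 m (by omega) (by omega) h; omega
    have : Nonempty (G.induce ((↑({v m} : Finset V) : Set V)ᶜ)).ConnectedComponent :=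
      ⟨connectedComponentMk _ ⟨v 0, h0⟩⟩
    have hpos : 0 < Nat.card (G.induce ((↑({v m} : Finset V) : Set V)ᶜ)).ConnectedComponent :=
      Nat.card_pos
    rw [Finset.card_singleton] at h2
    have h3 : (2 * Nat.card (G.induce ((↑({v m} : Finset V) : Set V)ᶜ)).ConnectedComponent) ≤ 1 := by
      exact_mod_cast h2
    omega
  · -- many isolated vertices
    set S : Finset V := (N.image (fun k => v (k + 1))) ∪ (N.image (fun k => v (k - 1))) with hS
    have hScard : S.card ≤ 2 * N.card := by
      have h1 := Finset.card_union_le (N.image (fun k => v (k + 1))) (N.image (fun k => v (k - 1)))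
      have h2 := Finset.card_image_le (s := N) (f := fun k => v (k + 1))
      have h3 := Finset.card_image_le (s := N) (f := fun k => v (k - 1))
      rw [← hS] at h1
      omega
    have hiso : ∀ j ∈ N, ∀ w, G.Adj (v j) w → w ∈ S := by
      intro j hj w hw
      obtain ⟨h1, h2, h3, h4⟩ := (memN j).1 hj
      obtain ⟨m, hm, rfl⟩ := hsurj w
      have hyj : G.Adj y (v (j - 1)) := by
        rw [hdich _ (by omega), show j - 1 + 1 = j by omega]; exact h3
      rcases lt_trichotomy j m with hjm | rfl | hjm
      · have hAm : G.Adj x (v m) := by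
          by_contra hA
          refine rule1 j m hjm hm h4 ?_ hw
          rw [hdich _ (by omega), show m - 1 + 1 = m by omega]; exact hA
        have hAm1 : ¬ G.Adj x (v (m - 1)) := fun hA => rule3 j m h2 hjm hm hyj hA hw
        apply Finset.mem_union_left
        rw [Finset.mem_image]
        refine ⟨m - 1, (memN _).2 ⟨by omega, by omega, hAm1, ?_⟩, ?_⟩
        · rwa [show m - 1 + 1 = m by omega]
        · simp only [show m - 1 + 1 = m by omega]
      · exact absurd hw G.irrefl
      · have hAm1 : ¬ G.Adj x (v (m + 1)) := fun hA => rule1 m j hjm (by omega) hA hyj hw.symm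
        have hAm2 : G.Adj x (v (m + 1 + 1)) := by
          by_contra hA
          refine rule2 m j hjm (by omega) h4 ?_ hw.symm
          rw [hdich _ (by omega)]; exact hA
        apply Finset.mem_union_right
        rw [Finset.mem_image]
        exact ⟨m + 1, (memN _).2 ⟨by omega, by omega, hAm1, hAm2⟩, by simp⟩
    set T := insert 0 N with hT
    have h0N : 0 ∉ N := fun h => by have := (memN 0).1 h; omega
    have hTcard : T.card = N.card + 1 := Finset.card_insert_of_notMem h0N
    have hTlt : ∀ k ∈ T, k < n := by
      intro k hk
      rcases Finset.mem_insert.1 hk with rfl | hk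
      · omega
      · have := (memN k).1 hk; omega
    have hTS : ∀ k ∈ T, v k ∈ ((↑S : Set V)ᶜ) := by
      intro k hk hkS
      have hkn := hTlt k hk
      have hkA : ¬ G.Adj x (v k) := by
        rcases Finset.mem_insert.1 hk with rfl | hk
        · exact A0
        · exact ((memN k).1 hk).2.2.1
      have hkA1 : G.Adj x (v (k + 1)) := by
        rcases Finset.mem_insert.1 hk with rfl | hk
        · exact A1
        · exact ((memN k).1 hk).2.2.2
      rcases Finset.mem_union.1 (Finset.mem_coe.1 hkS) with h | h
      · obtain ⟨l, hl, hlk⟩ := Finset.mem_image.1 h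
        obtain ⟨h1, h2, h3, h4⟩ := (memN l).1 hl
        have := hinj (l + 1) k (by omega) hkn hlk
        subst this
        exact hkA h4
      · obtain ⟨l, hl, hlk⟩ := Finset.mem_image.1 h
        obtain ⟨h1, h2, h3, h4⟩ := (memN l).1 hl
        have := hinj (l - 1) k (by omega) hkn hlk
        subst this
        rw [show l - 1 + 1 = l by omega] at hkA1
        exact h3 hkA1
    have hsep : ∀ k (hk : k ∈ N) l (hl : l ∈ T), (G.induce ((↑S : Set V)ᶜ)).Reachable
        ⟨v k, hTS k (Finset.mem_insert_of_mem hk)⟩ ⟨v l, hTS l hl⟩ → k = l := by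
      intro k hk l hl hr
      have := reach_inv _ (fun w => w.1 = v k) ?_ _ _ hr rfl
      · exact (hinj l k (hTlt l hl) (hTlt k (Finset.mem_insert_of_mem hk)) this).symm
      · rintro ⟨a, ha⟩ ⟨b, hb⟩ hab hak
        have hab' : G.Adj a b := hab
        simp only at hak
        subst hak
        exact absurd (hiso k hk b hab') hb
    let f : T → (G.induce ((↑S : Set V)ᶜ)).ConnectedComponent :=
      fun k => connectedComponentMk _ ⟨v k.1, hTS k.1 k.2⟩
    have hf : Function.Injective f := by
      rintro ⟨k, hk⟩ ⟨l, hl⟩ hkl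
      have hr := ConnectedComponent.exact hkl
      apply Subtype.ext
      rcases Finset.mem_insert.1 hk with hk0 | hk'
      · rcases Finset.mem_insert.1 hl with hl0 | hl'
        · exact hk0.trans hl0.symm
        · exact (hsep l hl' k hk hr.symm).symm
      · exact hsep k hk' l hl hr
    have hcc := Nat.card_le_card_of_injective f hf
    rw [Nat.card_eq_fintype_card, Fintype.card_coe, hTcard] at hcc
    have hnc : ¬ (G.induce ((↑S : Set V)ᶜ)).Connected := by
      intro hc
      have := hsep j0 hj0 0 (Finset.mem_insert_self _ _) (hc.preconnected _ _)
      subst this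
      exact h0N hj0
    have h2 := htough _ hnc
    have h3 : (2 * Nat.card (G.induce ((↑S : Set V)ᶜ)).ConnectedComponent) ≤ S.card := by
      exact_mod_cast h2
    omega
end
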